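/- Let d ≥ 4 and ε > 0. There exists a constant C = C(d,ε) with the following property. Let f(y_1,y_2,y_3) ∈ ℤ[y_1,y_2,y_3] be a polynomial of degree d which is absolutely irreducible over ℚ, and suppose that only finitely many affine subspaces of ℚ̄^3 of dimension 1 (affine lines) are contained in the zero set {y ∈ ℚ̄^3 : f(y) = 0}. Then for every real B ≥ 1 one has n(Y;B) ≤ C·B^{1+ε}. -/

import Mathlib

open MvPolynomial
section PartA
variable {k : Type*} [Field k]

instance vfin (N : ℕ) : FiniteDimensional k (restrictTotalDegree (Fin 2) k N) := by
  infer_instance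

theorem finrank_restr (N : ℕ) :
    2 * Module.finrank k (restrictTotalDegree (Fin 2) k N) = (N+1)*(N+2) := by
  have h1 : Module.finrank k (restrictTotalDegree (Fin 2) k N) =
      Nat.card {n : Fin 2 →₀ ℕ | (n.sum fun _ e => e) ≤ N} :=
    Module.finrank_eq_nat_card_basis (basisRestrictSupport k _)
  let T : Finset (ℕ × ℕ) := (Finset.range (N+1)).biUnion (fun i => Finset.HasAntidiagonal.antidiagonal i)
  have hT : 2 * T.card = (N+1)*(N+2) := by
    rw [Finset.card_biUnion]
    · simp only [Finset.Nat.card_antidiagonal]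
      clear h1 T
      induction N with
      | zero => simp
      | succ n ih => rw [Finset.sum_range_succ, mul_add, ih]; ring
    · intro i _ j _ hij
      simp only [Function.onFun]
      rw [Finset.disjoint_left]
      intro x hx hx'
      have hx1 := Finset.HasAntidiagonal.mem_antidiagonal.1 hx
      have hx2 := Finset.HasAntidiagonal.mem_antidiagonal.1 hx'
      omega
  have e : {n : Fin 2 →₀ ℕ | (n.sum fun _ e => e) ≤ N} ≃ T := by
    refine Equiv.subtypeEquiv (Finsupp.equivFunOnFinite.trans (finTwoArrowEquiv ℕ)) ?_
    intro a
    simp [T, Finsupp.sum_fintype, Fin.sum_univ_two]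
  rw [h1, Nat.card_congr e, Nat.card_eq_fintype_card, Fintype.card_coe, hT]

/-- multiplication by f as an image of the degree filtration -/
noncomputable def mulV (f : MvPolynomial (Fin 2) k) (N : ℕ) : Submodule k (MvPolynomial (Fin 2) k) :=
  (restrictTotalDegree (Fin 2) k N).map (LinearMap.mulLeft k f)

instance mulVfin (f : MvPolynomial (Fin 2) k) (N : ℕ) : FiniteDimensional k (mulV f N) := by
  unfold mulV; infer_instance

theorem mem_mulV {f : MvPolynomial (Fin 2) k} {N : ℕ} {u : MvPolynomial (Fin 2) k} :
    u ∈ mulV f N ↔ ∃ v, v.totalDegree ≤ N ∧ f * v = u := by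
  simp [mulV, Submodule.mem_map, mem_restrictTotalDegree]

theorem finrank_mulV {f : MvPolynomial (Fin 2) k} (hf : f ≠ 0) (N : ℕ) :
    2 * Module.finrank k (mulV f N) = (N+1)*(N+2) := by
  rw [← finrank_restr (k := k) N]
  congr 1
  unfold mulV
  exact (LinearEquiv.finrank_eq (Submodule.equivMapOfInjective (LinearMap.mulLeft k f)
    (fun a b hab => mul_left_cancel₀ hf hab) _)).symm

theorem mulV_le {f : MvPolynomial (Fin 2) k} {N M : ℕ} (h : f.totalDegree + N ≤ M) :
    mulV f N ≤ restrictTotalDegree (Fin 2) k M := by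
  intro u hu
  obtain ⟨v, hv, rfl⟩ := mem_mulV.1 hu
  rw [mem_restrictTotalDegree]
  exact (totalDegree_mul _ _).trans (by omega)

theorem bezout {f g : MvPolynomial (Fin 2) k} (hf : f ≠ 0) (hg : g ≠ 0) (h : IsRelPrime f g)
    {W : Type*} [AddCommGroup W] [Module k W] [FiniteDimensional k W]
    (Λ : MvPolynomial (Fin 2) k →ₗ[k] W) (hΛ : Function.Surjective Λ)
    (h1 : ∀ u, Λ (f * u) = 0) (h2 : ∀ u, Λ (g * u) = 0) :
    Module.finrank k W ≤ f.totalDegree * g.totalDegree := by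
  classical
  set m := f.totalDegree with hm
  set n := g.totalDegree with hn
  let b := Module.finBasis k W
  choose v hv using fun i => hΛ (b i)
  let N₀ := Finset.univ.sup (fun i => (v i).totalDegree)
  let r := N₀
  set N := r + m + n with hN
  let V := restrictTotalDegree (Fin 2) k N
  let Λ' : V →ₗ[k] W := Λ.domRestrict V
  have hr : LinearMap.range Λ' = ⊤ := by
    rw [eq_top_iff, ← b.span_eq, Submodule.span_le]
    rintro _ ⟨i, rfl⟩
    refine ⟨⟨v i, ?_⟩, hv i⟩
    rw [mem_restrictTotalDegree]
    have : (v i).totalDegree ≤ N₀ := Finset.le_sup (f := fun i => (v i).totalDegree) (Finset.mem_univ i)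
    omega
  have hrk := LinearMap.finrank_range_add_finrank_ker Λ'
  rw [hr, finrank_top] at hrk
  let A := mulV f (r + n)
  let B := mulV g (r + m)
  have hA : A ≤ V := mulV_le (by omega)
  have hB : B ≤ V := mulV_le (by omega)
  have hAB : Module.finrank k ↥(A ⊔ B) ≤ Module.finrank k (LinearMap.ker Λ') := by
    have : A ⊔ B ≤ (LinearMap.ker Λ').map V.subtype := by
      rw [sup_le_iff]
      constructor
      · intro u hu
        refine ⟨⟨u, hA hu⟩, ?_, rfl⟩
        obtain ⟨w, _, rfl⟩ := mem_mulV.1 hu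
        exact h1 w
      · intro u hu
        refine ⟨⟨u, hB hu⟩, ?_, rfl⟩
        obtain ⟨w, _, rfl⟩ := mem_mulV.1 hu
        exact h2 w
    refine (Submodule.finrank_mono this).trans ?_
    exact Submodule.finrank_map_le _ _
  have hinf : Module.finrank k ↥(A ⊓ B) ≤ Module.finrank k (mulV (f*g) r) := by
    refine Submodule.finrank_mono ?_
    rintro u ⟨hu1, hu2⟩
    obtain ⟨a, ha, rfl⟩ := mem_mulV.1 hu1
    obtain ⟨c, hc, hac⟩ := mem_mulV.1 hu2
    have hd : g ∣ f * a := ⟨c, hac.symm⟩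
    obtain ⟨e, he⟩ := h.symm.dvd_of_dvd_mul_left hd
    rw [mem_mulV]
    refine ⟨e, ?_, by rw [he]; ring⟩
    by_cases he0 : e = 0
    · simp [he0]
    · rw [he, totalDegree_mul_of_isDomain hg he0] at ha
      omega
  have hs := Submodule.finrank_sup_add_finrank_inf_eq A B
  have f1 := finrank_mulV hf (r + n)
  have f2 := finrank_mulV hg (r + m)
  have f3 := finrank_mulV (mul_ne_zero hf hg) r
  have f4 := finrank_restr (k := k) N
  change 2 * Module.finrank k V = _ at f4
  change 2 * Module.finrank k A = _ at f1
  change 2 * Module.finrank k B = _ at f2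
  have : 2 * Module.finrank k W + (r+n+1)*(r+n+2) + (r+m+1)*(r+m+2) ≤ (N+1)*(N+2) + (r+1)*(r+2) := by
    omega
  rw [hN] at this
  nlinarith

/-- separating polynomial -/
theorem exists_sep {n : ℕ} (s : Finset (Fin n → k)) (P : Fin n → k) :
    ∃ e : MvPolynomial (Fin n) k, eval P e ≠ 0 ∧ ∀ Q ∈ s, Q ≠ P → eval Q e = 0 := by
  classical
  induction s using Finset.induction with
  | empty => exact ⟨1, by simp, by simp⟩
  | insert a s ha ih =>
    obtain ⟨e, he, h⟩ := ih
    by_cases haP : a = P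
    · refine ⟨e, he, fun Q hQ hQP => ?_⟩
      rcases Finset.mem_insert.1 hQ with rfl | hQ
      · exact absurd haP hQP
      · exact h Q hQ hQP
    · obtain ⟨i, hi⟩ := Function.ne_iff.1 haP
      refine ⟨e * (X i - C (a i)), ?_, fun Q hQ hQP => ?_⟩
      · simp only [map_mul, map_sub, eval_X, eval_C]
        exact mul_ne_zero he (sub_ne_zero.2 (Ne.symm hi))
      · rcases Finset.mem_insert.1 hQ with rfl | hQ
        · simp
        · simp [h Q hQ hQP]

theorem bezout_points {f g : MvPolynomial (Fin 2) k} (hf : f ≠ 0) (hg : g ≠ 0)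
    (h : IsRelPrime f g) (s : Finset (Fin 2 → k)) (hs : ∀ P ∈ s, eval P f = 0 ∧ eval P g = 0) :
    s.card ≤ f.totalDegree * g.totalDegree := by
  classical
  let Λ : MvPolynomial (Fin 2) k →ₗ[k] (s → k) :=
    LinearMap.pi (fun P => (aeval (R := k) (P : Fin 2 → k)).toLinearMap)
  have hΛ : ∀ u P, Λ u P = eval (P : Fin 2 → k) u := fun u P => by
    simp [Λ, aeval_eq_eval]
  have := bezout hf hg h Λ ?_ ?_ ?_
  · simpa using this
  · rw [← LinearMap.range_eq_top, eq_top_iff, ← (Pi.basisFun k s).span_eq, Submodule.span_le]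
    rintro _ ⟨P, rfl⟩
    obtain ⟨e, he, h⟩ := exists_sep s (P : Fin 2 → k)
    refine ⟨C (eval (P : Fin 2 → k) e)⁻¹ * e, ?_⟩
    ext Q
    rw [hΛ]
    by_cases hQ : Q = P
    · subst hQ; simp [he]
    · have := h Q Q.2 (fun h => hQ (Subtype.ext h))
      simp [this, hQ]
  · intro u; ext P; rw [hΛ]; simp [(hs P P.2).1]
  · intro u; ext P; rw [hΛ]; simp [(hs P P.2).2]
end PartA

section PartD

theorem eval_aeval' {k σ τ : Type*} [CommRing k] (Φ : σ → MvPolynomial τ k) (Q : τ → k)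
    (f : MvPolynomial σ k) : eval Q (aeval Φ f) = eval (fun i => eval Q (Φ i)) f := by
  induction f using MvPolynomial.induction_on <;> simp_all

theorem det_dvd_of_expansion {ι κ α : Type*} [Fintype ι] [DecidableEq ι]
    (A : Finset α) (wt : α → ℕ) (p : ℤ) (E : ℕ) (M : Matrix ι ι ℤ) (c : ι → κ)
    (t : ι → α → ℤ) (G : κ → α → ι → ℤ)
    (hM : ∀ i j, p ^ E ∣ M i j - ∑ a ∈ A, p ^ wt a * t i a * G (c i) a j)
    (hE : ∀ τ : ι → α, (∀ i, τ i ∈ A) → (∀ i i', c i = c i' → τ i = τ i' → i = i') →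
      E ≤ ∑ i, wt (τ i)) :
    p ^ E ∣ M.det := by
  classical
  let M' : Matrix ι ι ℤ := Matrix.of (fun i j => ∑ a ∈ A, p ^ wt a * t i a * G (c i) a j)
  have h1 : p ^ E ∣ M.det - M'.det := by
    rw [← Ideal.mem_span_singleton, ← Ideal.Quotient.eq, RingHom.map_det, RingHom.map_det]
    congr 1
    ext i j
    simp only [RingHom.mapMatrix_apply, Matrix.map_apply]
    rw [Ideal.Quotient.eq, Ideal.mem_span_singleton]
    exact hM i j
  have h2 : M'.det = ∑ τ ∈ Fintype.piFinset (fun _ : ι => A),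
      (∏ i, (p ^ wt (τ i) * t i (τ i))) * Matrix.det (Matrix.of (fun i => G (c i) (τ i))) := by
    have e1 : M' = fun i => ∑ a ∈ A, (p ^ wt a * t i a) • G (c i) a := by
      funext i j
      simp [M', Finset.sum_apply]
    have e2 : M'.det = Matrix.detRowAlternating.toMultilinearMap
        (fun i => ∑ a ∈ A, (p ^ wt a * t i a) • G (c i) a) := by
      rw [e1]; rfl
    rw [e2, MultilinearMap.map_sum_finset]
    refine Finset.sum_congr rfl (fun τ _ => ?_)
    rw [MultilinearMap.map_smul_univ]
    rfl
  have h3 : p ^ E ∣ M'.det := by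
    rw [h2]
    refine Finset.dvd_sum (fun τ hτ => ?_)
    by_cases hinj : ∀ i i', c i = c i' → τ i = τ i' → i = i'
    · have := hE τ (fun i => Fintype.mem_piFinset.1 hτ i) hinj
      rw [Finset.prod_mul_distrib, Finset.prod_pow_eq_pow_sum]
      exact Dvd.dvd.mul_right (Dvd.dvd.mul_right (pow_dvd_pow _ this) _) _
    · push Not at hinj
      obtain ⟨i, i', hc, ht, hne⟩ := hinj
      rw [Matrix.det_zero_of_row_eq hne (by change G (c i) (τ i) = G (c i') (τ i'); rw [hc, ht])]
      simp
  have := dvd_add h1 h3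
  simpa using this

theorem taylor2 {n : ℕ} (f : MvPolynomial (Fin (n+1)) ℤ) (P : Fin (n+1) → ℤ) (h : ℤ) :
    ∃ c : ℤ, eval (Fin.cons (P 0 + h) (Fin.tail P) : Fin (n+1) → ℤ) f
      = eval P f + h * eval P (pderiv 0 f) + h ^ 2 * c := by
  induction f using MvPolynomial.induction_on with
  | C a => exact ⟨0, by simp⟩
  | add p q hp hq =>
    obtain ⟨a, ha⟩ := hp; obtain ⟨b, hb⟩ := hq
    exact ⟨a + b, by rw [map_add, ha, hb]; simp; ring⟩
  | mul_X p i hp =>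
    obtain ⟨a, ha⟩ := hp
    rw [map_mul, ha, eval_X, Derivation.leibniz]
    refine Fin.cases ?_ (fun j => ?_) i
    · refine ⟨eval P (pderiv 0 p) + (P 0 + h) * a, ?_⟩
      simp; ring
    · refine ⟨a * P j.succ, ?_⟩
      simp [Fin.tail]; ring

theorem eval_mod {σ : Type*} (f : MvPolynomial σ ℤ) (P Q : σ → ℤ) (m : ℤ)
    (h : ∀ i, m ∣ P i - Q i) : m ∣ eval P f - eval Q f := by
  induction f using MvPolynomial.induction_on with
  | C a => simp
  | add p q hp hq =>
    have := dvd_add hp hq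
    rw [map_add, map_add, add_sub_add_comm]
    exact this
  | mul_X p i hp =>
    have := dvd_add (Dvd.dvd.mul_right hp (P i)) (Dvd.dvd.mul_left (h i) (eval Q p))
    rw [map_mul, map_mul, eval_X, eval_X]
    rw [show (eval P) p * P i - (eval Q) p * Q i = ((eval P) p - (eval Q) p) * P i
      + (eval Q) p * (P i - Q i) by ring]
    exact this

theorem hensel {n : ℕ} (p : ℤ) (f : MvPolynomial (Fin (n+1)) ℤ) (P0 : Fin (n+1) → ℤ) (a : ℤ)
    (ha : p ∣ 1 - a * eval P0 (pderiv 0 f)) (K : ℕ) :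
    ∃ φ : MvPolynomial (Fin n) ℤ, ∀ P : Fin (n+1) → ℤ, (∀ i, p ∣ P i - P0 i) → eval P f = 0 →
      p ^ (K+1) ∣ P 0 - eval (Fin.tail P) φ := by
  induction K with
  | zero => exact ⟨C (P0 0), fun P hP _ => by simpa using hP 0⟩
  | succ K ih =>
    obtain ⟨φ, hφ⟩ := ih
    let Φ : Fin (n+1) → MvPolynomial (Fin n) ℤ := Fin.cons φ (fun i => X i)
    refine ⟨φ - C a * aeval Φ f, fun P hP hf => ?_⟩
    obtain ⟨e, he⟩ := hφ P hP hf
    have h1 : eval (Fin.tail P) (aeval Φ f) =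
        eval (Fin.cons (P 0 + (- p ^ (K+1) * e)) (Fin.tail P) : Fin (n+1) → ℤ) f := by
      rw [eval_aeval']
      congr 2
      funext i
      refine Fin.cases ?_ (fun j => ?_) i
      · simp [Φ]; linarith
      · simp [Φ, Fin.tail]
    obtain ⟨c, hc⟩ := taylor2 f P (- p ^ (K+1) * e)
    rw [map_sub, map_mul, eval_C, h1, hc, hf]
    have h2 : p ∣ 1 - a * eval P (pderiv 0 f) := by
      have := eval_mod (pderiv 0 f) P P0 p hP
      have := dvd_sub ha (Dvd.dvd.mul_left this a)
      rw [show 1 - a * eval P (pderiv 0 f) = 1 - a * eval P0 (pderiv 0 f)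
        - a * (eval P (pderiv 0 f) - eval P0 (pderiv 0 f)) by ring]
      exact this
    obtain ⟨w, hw⟩ := h2
    refine ⟨e * w + a * p ^ K * e ^ 2 * c, ?_⟩
    have h3 : eval (Fin.tail P) φ = P 0 - p ^ (K+1) * e := by linarith
    rw [h3]
    have h4 : a * eval P (pderiv 0 f) = 1 - p * w := by linarith
    have : a * (0 + -p ^ (K + 1) * e * eval P (pderiv 0 f) + (-p ^ (K + 1) * e) ^ 2 * c)
      = -p ^ (K+1) * e * (a * eval P (pderiv 0 f)) + a * (p ^ (K + 1) * e) ^ 2 * c := by ring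
    rw [this, h4]
    ring

theorem det_dvd {n : ℕ} (p : ℕ) [Fact p.Prime] (f : MvPolynomial (Fin (n+1)) ℤ)
    {ι : Type*} [Fintype ι] [DecidableEq ι] (pts : ι → Fin (n+1) → ℤ)
    (g : ι → MvPolynomial (Fin (n+1)) ℤ) (hf : ∀ i, eval (pts i) f = 0) (R : Finset ι)
    (hR : ∀ i ∈ R, ¬ (p : ℤ) ∣ eval (pts i) (pderiv 0 f)) (N : ℕ)
    (hN : (R.image (fun i => fun l => ((pts i l : ℤ) : ZMod p))).card ≤ N) (k T E : ℕ)
    (hT : ∀ A : Finset (Fin n →₀ ℕ), ∑ α ∈ A, (k - α.degree) ≤ T)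
    (hE : E + N * T ≤ R.card * k) :
    (p : ℤ) ^ E ∣ (Matrix.of fun i j => eval (pts i) (g j)).det := by
  classical
  let res : ι → Fin (n+1) → ZMod p := fun i l => ((pts i l : ℤ) : ZMod p)
  let c : ι → (Fin (n+1) → ZMod p) ⊕ ι := fun i => if i ∈ R then Sum.inl (res i) else Sum.inr i
  have key : ∀ γ : (Fin (n+1) → ZMod p) ⊕ ι, ∃ H : ι → MvPolynomial (Fin n) ℤ, ∀ i, c i = γ →
      ∃ t : Fin n → ℤ, ∀ j, (p : ℤ) ^ E ∣ eval (pts i) (g j) - eval (fun l => (p : ℤ) * t l) (H j) := by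
    rintro (r | i)
    · by_cases hr : ∃ i₀ ∈ R, res i₀ = r
      · obtain ⟨i₀, hi₀, rfl⟩ := hr
        have hcop : IsCoprime (p : ℤ) (eval (pts i₀) (pderiv 0 f)) :=
          (Prime.coprime_iff_not_dvd (Nat.prime_iff_prime_int.1 Fact.out)).2 (hR i₀ hi₀)
        obtain ⟨u, a, hua⟩ := hcop
        obtain ⟨φ, hφ⟩ := hensel (p : ℤ) f (pts i₀) a ⟨u, by linarith⟩ E
        refine ⟨fun j => aeval (fun l : Fin n => X l + C (pts i₀ l.succ))
          (aeval (Fin.cons φ (fun i => X i) : Fin (n+1) → MvPolynomial (Fin n) ℤ) (g j)), ?_⟩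
        intro i hi
        have hdv : ∀ l, (p : ℤ) ∣ pts i l - pts i₀ l := by
          intro l
          simp only [c] at hi
          split_ifs at hi with hiR
          have := congrFun (Sum.inl.inj hi) l
          rw [← ZMod.intCast_zmod_eq_zero_iff_dvd]
          simp only [res] at this
          push_cast
          rw [this, sub_self]
        choose t ht using hdv
        refine ⟨fun l => t l.succ, fun j => ?_⟩
        rw [eval_aeval', eval_aeval']
        apply eval_mod
        intro l
        have hP : (fun l : Fin n => eval (fun l : Fin n => (p : ℤ) * t l.succ)
            (X l + C (pts i₀ l.succ))) = Fin.tail (pts i) := by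
          funext l
          have := ht l.succ
          simp [Fin.tail]; linarith
        rw [hP]
        refine Fin.cases ?_ (fun l => ?_) l
        · simp only [Fin.cons_zero]
          exact (pow_dvd_pow _ (Nat.le_succ E)).trans (hφ (pts i) (fun l => ⟨_, ht l⟩) (hf i))
        · simp [Fin.tail]
      · refine ⟨0, fun i hi => ?_⟩
        exfalso
        simp only [c] at hi
        split_ifs at hi with hiR
        exact hr ⟨i, hiR, Sum.inl.inj hi⟩
    · refine ⟨fun j => C (eval (pts i) (g j)), fun i' hi' => ⟨0, fun j => ?_⟩⟩
      simp only [c] at hi'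
      split_ifs at hi' with hiR
      cases hi'
      simp
  choose H hH using key
  choose t ht using fun i => hH (c i) i rfl
  let A : Finset (Fin n →₀ ℕ) := Finset.univ.biUnion (fun i : ι => Finset.univ.biUnion
    (fun j : ι => (H (c i) j).support))
  refine det_dvd_of_expansion A (fun α => α.degree) (p : ℤ) E _ c
    (fun i α => ∏ l, t i l ^ α l) (fun γ α j => coeff α (H γ j)) ?_ ?_
  · intro i j
    have : eval (fun l => (p : ℤ) * t i l) (H (c i) j) = ∑ a ∈ A, (p : ℤ) ^ (Finsupp.degree a)
        * (∏ l, t i l ^ a l) * coeff a (H (c i) j) := by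
      rw [eval_eq', Finset.sum_subset (s₂ := A)]
      · refine Finset.sum_congr rfl (fun α _ => ?_)
        simp only [mul_pow, Finset.prod_mul_distrib, Finset.prod_pow_eq_pow_sum]
        rw [Finsupp.degree_eq_sum]
        ring
      · intro α hα
        simp only [A, Finset.mem_biUnion]
        exact ⟨i, Finset.mem_univ _, j, Finset.mem_univ _, hα⟩
      · intro α _ hα
        rw [notMem_support_iff.1 hα, zero_mul]
    rw [Matrix.of_apply, ← this]
    exact ht i j
  · intro τ _ hinj
    have h1 : R.card * k ≤ ∑ i ∈ R, (τ i).degree + ∑ i ∈ R, (k - (τ i).degree) := by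
      rw [← Finset.sum_add_distrib, ← smul_eq_mul, ← Finset.sum_const]
      exact Finset.sum_le_sum (fun i _ => by omega)
    have h2 : ∑ i ∈ R, (k - (τ i).degree) ≤ N * T := by
      rw [← Finset.sum_fiberwise_of_maps_to (g := res) (t := R.image res)
        (fun i hi => Finset.mem_image_of_mem _ hi)]
      calc _ ≤ ∑ r ∈ R.image res, T := by
            refine Finset.sum_le_sum (fun r _ => ?_)
            refine le_trans (le_of_eq ?_) (hT ((R.filter (fun i => res i = r)).image τ))
            rw [Finset.sum_image]
            intro i hi i' hi' h
            simp only [Finset.coe_filter, Set.mem_ofPred_eq] at hi hi'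
            refine hinj i i' ?_ h
            simp [c, hi.1, hi'.1, hi.2, hi'.2]
        _ = (R.image res).card * T := by simp
        _ ≤ N * T := Nat.mul_le_mul_right _ hN
    have h3 : ∑ i ∈ R, (τ i).degree ≤ ∑ i, (τ i).degree :=
      Finset.sum_le_sum_of_subset (Finset.subset_univ R)
    omega

theorem sumT1 (k : ℕ) (A : Finset (Fin 1 →₀ ℕ)) : ∑ α ∈ A, (k - α.degree) ≤ k * (k + 1) := by
  classical
  have h1 : ∑ α ∈ A, (k - α.degree) = ∑ m ∈ A.image (fun α => α 0), (k - m) := by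
    rw [Finset.sum_image]
    · refine Finset.sum_congr rfl (fun α _ => ?_)
      simp [Finsupp.degree_eq_sum]
    · intro a _ b _ h
      exact Finsupp.ext (fun i => by rw [Subsingleton.elim i 0]; exact h)
  rw [h1]
  calc _ ≤ ∑ m ∈ A.image (fun α => α 0) ∪ Finset.range k, (k - m) :=
        Finset.sum_le_sum_of_subset Finset.subset_union_left
    _ = ∑ m ∈ Finset.range k, (k - m) := by
        symm
        refine Finset.sum_subset Finset.subset_union_right (fun x _ hx => ?_)
        simp at hx; omega
    _ ≤ ∑ m ∈ Finset.range k, k := Finset.sum_le_sum (fun i _ => by omega)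
    _ ≤ k * (k + 1) := by simp; nlinarith

theorem sumT2 (k : ℕ) (A : Finset (Fin 2 →₀ ℕ)) :
    ∑ α ∈ A, (k - α.degree) ≤ k * (k + 1) * (k + 2) / 6 := by
  classical
  let e := (Finsupp.equivFunOnFinite.trans (finTwoArrowEquiv ℕ) : (Fin 2 →₀ ℕ) ≃ ℕ × ℕ)
  have h1 : ∑ α ∈ A, (k - α.degree) = ∑ m ∈ A.image e, (k - (m.1 + m.2)) := by
    rw [Finset.sum_image]
    · refine Finset.sum_congr rfl (fun α _ => ?_)
      simp [Finsupp.degree_eq_sum, e, Fin.sum_univ_two]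
    · exact e.injective.injOn
  rw [h1]
  let Q := (Finset.range k).biUnion (fun i => Finset.HasAntidiagonal.antidiagonal i)
  calc _ ≤ ∑ m ∈ A.image e ∪ Q, (k - (m.1 + m.2)) :=
        Finset.sum_le_sum_of_subset Finset.subset_union_left
    _ = ∑ m ∈ Q, (k - (m.1 + m.2)) := by
        symm
        refine Finset.sum_subset Finset.subset_union_right (fun x _ hx => ?_)
        simp [Q] at hx; omega
    _ = ∑ i ∈ Finset.range k, (i + 1) * (k - i) := by
        rw [Finset.sum_biUnion]
        · refine Finset.sum_congr rfl (fun i _ => ?_)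
          rw [Finset.sum_congr rfl (g := fun _ => k - i)]
          · simp
          · intro x hx
            rw [Finset.HasAntidiagonal.mem_antidiagonal.1 hx]
        · intro i _ j _ hij
          simp only [Function.onFun]
          rw [Finset.disjoint_left]
          intro x hx hx'
          have hx1 := Finset.HasAntidiagonal.mem_antidiagonal.1 hx
          have hx2 := Finset.HasAntidiagonal.mem_antidiagonal.1 hx'
          omega
    _ ≤ k * (k + 1) * (k + 2) / 6 := by
        rw [Nat.le_div_iff_mul_le (by norm_num)]
        have : ∀ l ≤ k, (∑ i ∈ Finset.range l, (i + 1) * (k - i)) * 6 + 2 * l * (l+1) * (l+2)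
            = 3 * (k + 2) * l * (l + 1) := by
          intro l
          induction l with
          | zero => simp
          | succ l ih =>
            intro hl
            have := ih (by omega)
            rw [Finset.sum_range_succ]
            obtain ⟨m, rfl⟩ := Nat.exists_eq_add_of_le hl
            rw [show l + 1 + m - l = m + 1 by omega]
            nlinarith
        have := this k le_rfl
        nlinarith
end PartD

section PartF
variable {k : Type*} [Field k]

theorem coeff_fse_top {R : Type*} [CommRing R] {n d : ℕ} {f : MvPolynomial (Fin (n+1)) R}
    (hd : f.totalDegree ≤ d) :
    (finSuccEquiv R n f).coeff d = C (coeff (Finsupp.single 0 d) f) := by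
  ext m
  rw [finSuccEquiv_coeff_coeff]
  by_cases hm : m = 0
  · subst hm
    rw [coeff_C, if_pos rfl]
    congr 1
    exact Finsupp.ext (fun i => by refine Fin.cases ?_ (fun j => ?_) i <;> simp)
  · rw [coeff_C, if_neg (Ne.symm hm)]
    apply coeff_eq_zero_of_totalDegree_lt
    refine lt_of_le_of_lt hd ?_
    have h0 : 0 < m.degree := by
      rw [pos_iff_ne_zero]; intro h; exact hm ((Finsupp.degree_eq_zero_iff m).1 h)
    have : (Finsupp.cons d m).degree = d + m.degree := by
      simp [Finsupp.degree_eq_sum, Fin.sum_univ_succ]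
    change d < (Finsupp.cons d m).degree
    omega

theorem natDegree_fse {R : Type*} [CommRing R] {n : ℕ} (f : MvPolynomial (Fin (n+1)) R) :
    (finSuccEquiv R n f).natDegree ≤ f.totalDegree := by
  rw [natDegree_finSuccEquiv]; exact degreeOf_le_totalDegree _ _

theorem natDegree_fse_eq {R : Type*} [CommRing R] {n d : ℕ} {f : MvPolynomial (Fin (n+1)) R}
    (hd : f.totalDegree ≤ d) (hc : coeff (Finsupp.single 0 d) f ≠ 0) :
    (finSuccEquiv R n f).natDegree = d := by
  refine le_antisymm ((natDegree_fse f).trans hd) (Polynomial.le_natDegree_of_ne_zero ?_)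
  rw [coeff_fse_top hd]
  simpa using hc

theorem totalDegree_coeff_fse {R : Type*} [CommRing R] {n : ℕ} (f : MvPolynomial (Fin (n+1)) R)
    (i : ℕ) : ((finSuccEquiv R n f).coeff i).totalDegree ≤ f.totalDegree := by
  by_cases hi : (finSuccEquiv R n f).coeff i = 0
  · simp [hi]
  · have := totalDegree_coeff_finSuccEquiv_add_le f i hi
    omega

theorem totalDegree_det_le {ι σ R : Type*} [Fintype ι] [DecidableEq ι] [CommRing R]
    (M : Matrix ι ι (MvPolynomial σ R)) (b : ι → ℕ) (h : ∀ i j, (M i j).totalDegree ≤ b j) :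
    M.det.totalDegree ≤ ∑ j, b j := by
  rw [Matrix.det_apply]
  refine (totalDegree_finsetSum _ _).trans (Finset.sup_le (fun τ _ => ?_))
  have h1 : (∏ i, M (τ i) i).totalDegree ≤ ∑ j, b j :=
    (totalDegree_finsetProd _ _).trans (Finset.sum_le_sum (fun i _ => h _ _))
  refine le_trans ?_ h1
  rcases Int.units_eq_one_or (Equiv.Perm.sign τ) with h | h <;> rw [h] <;> simp

theorem totalDegree_resultant {R σ : Type*} [CommRing R] (F G : Polynomial (MvPolynomial σ R))
    (m n a b : ℕ) (hF : ∀ i, (F.coeff i).totalDegree ≤ a) (hG : ∀ i, (G.coeff i).totalDegree ≤ b) :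
    (F.resultant G m n).totalDegree ≤ m * b + n * a := by
  unfold Polynomial.resultant
  refine (totalDegree_det_le _ (fun j => Fin.addCases (fun _ => b) (fun _ => a) j) ?_).trans ?_
  · intro i j
    induction j using Fin.addCases with
    | left j =>
      simp only [Polynomial.sylvester, Matrix.of_apply, Fin.addCases_left]
      split_ifs
      · exact hG _
      · simp
    | right j =>
      simp only [Polynomial.sylvester, Matrix.of_apply, Fin.addCases_right]
      split_ifs
      · exact hF _
      · simp
  · rw [Fin.sum_univ_add]; simp

theorem fse_rename {R : Type*} [CommRing R] {n : ℕ} (r : MvPolynomial (Fin n) R) :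
    finSuccEquiv R n (rename Fin.succ r) = Polynomial.C r := by
  induction r using MvPolynomial.induction_on with
  | C a => simp [finSuccEquiv_apply]
  | add p q hp hq => simp [hp, hq]
  | mul_X p i hp => rw [map_mul, map_mul, hp, rename_X, finSuccEquiv_X_succ, Polynomial.C_mul]

theorem fse_coprime {n d : ℕ} {f g : MvPolynomial (Fin (n+1)) k}
    (hf : Irreducible f) (hd : f.totalDegree ≤ d) (hc : coeff (Finsupp.single 0 d) f ≠ 0)
    (hg : ¬ f ∣ g) : IsCoprime
      ((finSuccEquiv k n f).map (algebraMap _ (FractionRing (MvPolynomial (Fin n) k))))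
      ((finSuccEquiv k n g).map (algebraMap _ (FractionRing (MvPolynomial (Fin n) k)))) := by
  set c := coeff (Finsupp.single 0 d) f with hcdef
  set F := finSuccEquiv k n f with hF
  set G := finSuccEquiv k n g with hG
  have hFd : F.natDegree = d := natDegree_fse_eq hd hc
  have hu : IsUnit (Polynomial.C (C c⁻¹) : Polynomial (MvPolynomial (Fin n) k)) :=
    ((IsUnit.mk0 _ (inv_ne_zero hc)).map (C : k →+* MvPolynomial (Fin n) k)).map Polynomial.C
  obtain ⟨u, hu'⟩ := hu
  have hmon : (↑u * F).Monic := by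
    rw [hu', Polynomial.Monic, Polynomial.leadingCoeff_mul, Polynomial.leadingCoeff_C,
      Polynomial.leadingCoeff, hFd, hF, coeff_fse_top hd, ← C_mul, inv_mul_cancel₀ hc, C_1]
  have hFi : Irreducible (↑u * F) := by
    rw [irreducible_units_mul]
    exact (MulEquiv.irreducible_iff (finSuccEquiv k n)).2 hf
  have hdv : ¬ (↑u * F) ∣ G := by
    rw [Units.mul_left_dvd]
    intro h
    apply hg
    exact (map_dvd_iff (finSuccEquiv k n)).1 h
  have h1 := (Polynomial.Monic.irreducible_iff_irreducible_map_fraction_map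
    (K := FractionRing (MvPolynomial (Fin n) k)) hmon).1 hFi
  have h2 := mt (Polynomial.map_dvd_map (algebraMap _ (FractionRing (MvPolynomial (Fin n) k)))
    (IsFractionRing.injective _ _) (y := G) hmon).1 hdv
  have h3 := (h1.coprime_iff_not_dvd).2 h2
  rw [Polynomial.map_mul] at h3
  exact h3.of_mul_left_right

theorem elim {n d : ℕ} {f g : MvPolynomial (Fin (n+1)) k}
    (hf : Irreducible f) (hd : f.totalDegree ≤ d) (hc : coeff (Finsupp.single 0 d) f ≠ 0)
    (hg : ¬ f ∣ g) : ∃ r : MvPolynomial (Fin n) k, r ≠ 0 ∧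
      r.totalDegree ≤ 2 * d * g.totalDegree ∧ ∃ a b, rename Fin.succ r = a * f + b * g := by
  have hco := fse_coprime hf hd hc hg
  set F := finSuccEquiv k n f with hF
  set G := finSuccEquiv k n g with hG
  have hFd : F.natDegree = d := natDegree_fse_eq hd hc
  have hinj : Function.Injective (algebraMap (MvPolynomial (Fin n) k)
      (FractionRing (MvPolynomial (Fin n) k))) := IsFractionRing.injective _ _
  have hr : F.resultant G ≠ 0 := by
    have := Polynomial.resultant_ne_zero _ _ hco
    rw [Polynomial.natDegree_map_eq_of_injective hinj, Polynomial.natDegree_map_eq_of_injective hinj,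
      Polynomial.resultant_map_map] at this
    intro h; rw [h, map_zero] at this; exact this rfl
  have hd0 : d ≠ 0 := by
    rintro rfl
    have : f = C (coeff 0 f) := totalDegree_eq_zero_iff_eq_C.1 (by omega)
    apply hf.not_isUnit
    rw [this]
    simp only [Finsupp.single_zero] at hc
    exact (IsUnit.mk0 _ hc).map C
  obtain ⟨p, q, -, -, h⟩ := Polynomial.exists_mul_add_mul_eq_C_resultant F G le_rfl le_rfl
    (Or.inl (by rw [hFd]; exact hd0))
  refine ⟨F.resultant G, hr, ?_, (finSuccEquiv k n).symm p, (finSuccEquiv k n).symm q, ?_⟩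
  · refine (totalDegree_resultant F G _ _ _ _ (totalDegree_coeff_fse f)
      (totalDegree_coeff_fse g)).trans ?_
    rw [hFd]
    have := natDegree_fse g
    calc d * g.totalDegree + G.natDegree * f.totalDegree ≤ d * g.totalDegree + g.totalDegree * d :=
          Nat.add_le_add_left (Nat.mul_le_mul this hd) _
      _ = _ := by ring
  · apply (finSuccEquiv k n).injective
    rw [fse_rename, ← h]
    simp [hF, hG]; ring

/-- points with the same tail on a hypersurface monic in the first variable -/
theorem card_fiber {n d : ℕ} {R : Type*} [CommRing R] [IsDomain R] {f : MvPolynomial (Fin (n+1)) R}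
    (hd : f.totalDegree ≤ d) (hc : coeff (Finsupp.single 0 d) f ≠ 0) (u : Fin n → R)
    (s : Finset (Fin (n+1) → R)) (hs : ∀ P ∈ s, eval P f = 0 ∧ Fin.tail P = u) : s.card ≤ d := by
  classical
  let F := (finSuccEquiv R n f).map (eval u)
  have hcf : F.coeff d = coeff (Finsupp.single 0 d) f := by
    simp only [F, Polynomial.coeff_map]
    rw [coeff_fse_top hd, eval_C]
  have hF : F ≠ 0 := by
    intro h; rw [h] at hcf; exact hc (by rw [← hcf]; simp)
  have hFd : F.natDegree ≤ d :=
    (Polynomial.natDegree_map_le).trans ((natDegree_fse f).trans hd)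
  have : s.card ≤ F.roots.toFinset.card := by
    refine Finset.card_le_card_of_injOn (fun P => P 0) ?_ ?_
    · intro P hP
      simp only [Finset.mem_coe, Multiset.mem_toFinset]
      rw [Polynomial.mem_roots hF, Polynomial.IsRoot]
      obtain ⟨h1, h2⟩ := hs P hP
      rw [← h1, ← Fin.cons_self_tail P, h2, eval_eq_eval_mv_eval']
      simp [F]
    · intro P hP Q hQ h
      rw [← Fin.cons_self_tail P, ← Fin.cons_self_tail Q, (hs P hP).2, (hs Q hQ).2]
      simp only at h
      rw [h]
  exact this.trans ((Multiset.toFinset_card_le _).trans ((Polynomial.card_roots' F).trans hFd))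

theorem tdeg_map_le {σ R S : Type*} [CommRing R] [CommRing S] (φ : R →+* S)
    (f : MvPolynomial σ R) : (map φ f).totalDegree ≤ f.totalDegree :=
  Finset.sup_mono (support_map_subset φ f)

theorem zeros_box [DecidableEq k] {r : MvPolynomial (Fin 2) k} (hr : r ≠ 0) (S : Finset k) :
    ((Fintype.piFinset (fun _ : Fin 2 => S)).filter (fun P => eval P r = 0)).card
      ≤ r.totalDegree * S.card := by
  classical
  rcases S.eq_empty_or_nonempty with rfl | hS
  · simp
  have h := schwartz_zippel_totalDegree hr S
  have hp : (0 : ℚ≥0) < (S.card : ℚ≥0) := by exact_mod_cast hS.card_pos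
  rw [div_le_div_iff₀ (by positivity) hp] at h
  have h2 : (((Fintype.piFinset (fun _ : Fin 2 => S)).filter (fun P => eval P r = 0)).card : ℚ≥0)
      ≤ r.totalDegree * S.card := by
    refine le_of_mul_le_mul_right ?_ hp
    calc _ ≤ _ := h
      _ = _ := by ring
  exact_mod_cast h2

theorem triv [CharZero k] {d m B : ℕ} {f : MvPolynomial (Fin 3) ℤ} {g : MvPolynomial (Fin 3) k}
    (hf : Irreducible (map (Int.castRingHom k) f)) (hd : f.totalDegree ≤ d)
    (hc : coeff (Finsupp.single 0 d) f ≠ 0) (hg : ¬ map (Int.castRingHom k) f ∣ g)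
    (hm : g.totalDegree ≤ m) (s : Finset (Fin 3 → ℤ))
    (hs : ∀ P ∈ s, (∀ i, |P i| ≤ B) ∧ eval P f = 0 ∧ eval (fun i => (P i : k)) g = 0) :
    s.card ≤ d * (2 * d * m * (2 * B + 1)) := by
  classical
  have hev : ∀ P : Fin 3 → ℤ, eval P f = 0 → eval (fun i => (P i : k)) (map (Int.castRingHom k) f) = 0 := by
    intro P hP
    rw [eval_map, ← Int.cast_zero, ← hP]
    exact (eval₂_comp_left (Int.castRingHom k) (RingHom.id ℤ) P f).symm
  obtain ⟨r, hr, hrd, a, b, hab⟩ := elim hf ((tdeg_map_le _ _).trans hd)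
    (by rw [coeff_map]; simpa using hc) hg
  let S : Finset k := (Finset.Icc (-(B : ℤ)) B).image (fun z : ℤ => (z : k))
  have hS : S.card ≤ 2 * B + 1 := by
    refine Finset.card_image_le.trans ?_
    rw [Int.card_Icc]; omega
  let T := (Fintype.piFinset (fun _ : Fin 2 => S)).filter (fun P => eval P r = 0)
  have hT : T.card ≤ 2 * d * m * (2 * B + 1) :=
    (zeros_box hr S).trans (Nat.mul_le_mul (hrd.trans (Nat.mul_le_mul_left _ hm)) hS)
  let π : (Fin 3 → ℤ) → (Fin 2 → k) := fun P l => ((Fin.tail P l : ℤ) : k)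
  have hmaps : ∀ P ∈ s, π P ∈ T := by
    intro P hP
    obtain ⟨h1, h2, h3⟩ := hs P hP
    simp only [T, Finset.mem_filter, Fintype.mem_piFinset]
    constructor
    · intro l
      simp only [S, Finset.mem_image, Finset.mem_Icc]
      exact ⟨P l.succ, abs_le.1 (h1 _), rfl⟩
    · have := congrArg (eval (fun i => (P i : k))) hab
      rw [map_add, map_mul, map_mul, h3, hev P h2, eval_rename] at this
      simp only [mul_zero, add_zero] at this
      exact this
  have := Finset.card_le_mul_card_image_of_maps_to (s := s) (t := T) (f := π) hmaps d ?_
  · exact this.trans (Nat.mul_le_mul_left _ hT)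
  · intro u hu
    rcases (s.filter (fun P => π P = u)).eq_empty_or_nonempty with h | ⟨P₀, hP₀⟩
    · rw [h]; simp
    · refine card_fiber hd hc (Fin.tail P₀) _ (fun P hP => ?_)
      simp only [Finset.mem_filter] at hP hP₀
      refine ⟨(hs P hP.1).2.1, ?_⟩
      funext l
      have := congrFun (hP.2.trans hP₀.2.symm) l
      simpa [π] using this
end PartF

section PartB

/-- the Hamiltonian derivation of a plane curve -/
noncomputable def dphi {k : Type*} [CommRing k] (φ : MvPolynomial (Fin 2) k) :
    Derivation k (MvPolynomial (Fin 2) k) (MvPolynomial (Fin 2) k) :=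
  pderiv 0 φ • pderiv 1 - pderiv 1 φ • pderiv 0

theorem dphi_apply {k : Type*} [CommRing k] (φ u : MvPolynomial (Fin 2) k) :
    dphi φ u = pderiv 0 φ * pderiv 1 u - pderiv 1 φ * pderiv 0 u := by
  simp [dphi]

theorem dphi_self {k : Type*} [CommRing k] (φ : MvPolynomial (Fin 2) k) : dphi φ φ = 0 := by
  rw [dphi_apply]; ring

/-- Taylor functionals along the curve -/
noncomputable def dl {k : Type*} [CommRing k]
    (D : Derivation k (MvPolynomial (Fin 2) k) (MvPolynomial (Fin 2) k)) (P : Fin 2 → k) :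
    ℕ → (MvPolynomial (Fin 2) k →ₗ[k] k)
  | 0 => (aeval (R := k) P).toLinearMap
  | j + 1 => (dl D P j).comp D.toLinearMap

section
variable {k : Type*} [CommRing k]
  (D : Derivation k (MvPolynomial (Fin 2) k) (MvPolynomial (Fin 2) k)) (P : Fin 2 → k)

theorem dl_zero (u : MvPolynomial (Fin 2) k) : dl D P 0 u = eval P u := by
  simp [dl, aeval_eq_eval]

theorem dl_succ (j : ℕ) (u : MvPolynomial (Fin 2) k) : dl D P (j+1) u = dl D P j (D u) := rfl

/-- vanishing to order at least `M` -/
def ordGE (M : ℕ) (u : MvPolynomial (Fin 2) k) : Prop := ∀ j < M, dl D P j u = 0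

variable {D P}

theorem ordGE_succ {M : ℕ} {u : MvPolynomial (Fin 2) k} :
    ordGE D P (M+1) u ↔ eval P u = 0 ∧ ordGE D P M (D u) := by
  constructor
  · intro h
    exact ⟨by rw [← dl_zero D]; exact h 0 (by omega), fun j hj => h (j+1) (by omega)⟩
  · rintro ⟨h0, h⟩ j hj
    cases j with
    | zero => rw [dl_zero, h0]
    | succ j => exact h j (by omega)

theorem ordGE.mono {M M' : ℕ} {u : MvPolynomial (Fin 2) k} (h : ordGE D P M u) (hM : M' ≤ M) :
    ordGE D P M' u := fun j hj => h j (by omega)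

theorem ordGE.mul {M : ℕ} {u : MvPolynomial (Fin 2) k} (h : ordGE D P M u)
    (v : MvPolynomial (Fin 2) k) : ordGE D P M (u * v) := by
  induction M generalizing u v with
  | zero => intro j hj; omega
  | succ M ih =>
    have h' := ordGE_succ.1 h
    rw [ordGE_succ]
    refine ⟨by simp [h'.1], fun j hj => ?_⟩
    rw [Derivation.leibniz, map_add, smul_eq_mul, smul_eq_mul, mul_comm v]
    rw [ih (h.mono (Nat.le_succ M)) _ j hj, ih h'.2 _ j hj, add_zero]

theorem dl_mul {M : ℕ} {u : MvPolynomial (Fin 2) k} (h : ordGE D P M u)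
    (v : MvPolynomial (Fin 2) k) : dl D P M (u * v) = dl D P M u * eval P v := by
  induction M generalizing u with
  | zero => simp [dl_zero]
  | succ M ih =>
    have h' := ordGE_succ.1 h
    rw [dl_succ, Derivation.leibniz, map_add, smul_eq_mul, smul_eq_mul, mul_comm v,
      ih h'.2, (h.mul _) M (by omega), zero_add, dl_succ]

theorem ordGE.mul_root {M : ℕ} {u v : MvPolynomial (Fin 2) k} (h : ordGE D P M u)
    (hv : eval P v = 0) : ordGE D P (M+1) (u * v) := by
  intro j hj
  rcases Nat.lt_succ_iff_lt_or_eq.1 hj with hj | rfl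
  · exact h.mul v j hj
  · rw [dl_mul h, hv, mul_zero]

theorem ordGE_pow {M : ℕ} {v : MvPolynomial (Fin 2) k} (hv : eval P v = 0) :
    ordGE D P M (v ^ M) := by
  induction M with
  | zero => intro j hj; omega
  | succ M ih => rw [pow_succ]; exact ih.mul_root hv

theorem ordGE_of_const {M : ℕ} {φ : MvPolynomial (Fin 2) k} (h1 : D φ = 0) (h2 : eval P φ = 0) :
    ordGE D P M φ := by
  intro j _
  cases j with
  | zero => rw [dl_zero, h2]
  | succ j => rw [dl_succ, h1, map_zero]

theorem dl_pow {ξ : MvPolynomial (Fin 2) k} (hξ : eval P ξ = 0) (i : ℕ) :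
    dl D P i (ξ ^ i) = (i.factorial : k) * eval P (D ξ) ^ i := by
  induction i with
  | zero => simp [dl_zero]
  | succ i ih =>
    rw [dl_succ, Derivation.leibniz_pow]
    simp only [Nat.add_sub_cancel]
    rw [map_nsmul, smul_eq_mul, dl_mul (ordGE_pow hξ), ih, Nat.factorial_succ]
    simp; ring
end

section
variable {k : Type*} [Field k]
  {D : Derivation k (MvPolynomial (Fin 2) k) (MvPolynomial (Fin 2) k)}

/-- Bezout with multiplicities -/
theorem bezout_mult {φ G : MvPolynomial (Fin 2) k} (hφ : Irreducible φ) (hDφ : D φ = 0)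
    (hG : ¬ φ ∣ G) (M : ℕ) (hM : ∀ i < M, (i.factorial : k) ≠ 0) (s : Finset (Fin 2 → k))
    (h0 : ∀ P ∈ s, eval P φ = 0) (hx : ∀ P ∈ s, eval P (D (X 1)) ≠ 0)
    (h1 : ∀ P ∈ s, ordGE D P M G) : M * s.card ≤ φ.totalDegree * G.totalDegree := by
  classical
  let Λ : MvPolynomial (Fin 2) k →ₗ[k] (s × Fin M → k) :=
    LinearMap.pi (fun x => dl D (x.1 : Fin 2 → k) x.2)
  have hΛ : ∀ u x, Λ u x = dl D (x.1 : Fin 2 → k) x.2 u := fun u x => rfl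
  have hG0 : G ≠ 0 := by rintro rfl; exact hG (dvd_zero _)
  have := bezout hφ.ne_zero hG0 ((hφ.isRelPrime_iff_not_dvd).2 hG) Λ ?_ ?_ ?_
  · simpa [mul_comm] using this
  · have step : ∀ P : s, ∀ m ≤ M, ∀ w : s × Fin M → k,
        (∀ x, (x.1 ≠ P ∨ (x.2 : ℕ) + m < M) → w x = 0) → w ∈ LinearMap.range Λ := by
      intro P m
      induction m with
      | zero =>
        intro _ w hw
        have : w = 0 := by
          funext x; exact hw x (Or.inr (by have := x.2.2; omega))
        rw [this]; exact Submodule.zero_mem _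
      | succ m ih =>
        intro hm w hw
        obtain ⟨e, he, hes⟩ := exists_sep s (P : Fin 2 → k)
        let i : ℕ := M - (m + 1)
        have hi : i < M := by omega
        let ξ : MvPolynomial (Fin 2) k := X 1 - C ((P : Fin 2 → k) 1)
        have hξ : eval (P : Fin 2 → k) ξ = 0 := by simp [ξ]
        have hDξ : eval (P : Fin 2 → k) (D ξ) ≠ 0 := by
          have : D ξ = D (X 1) := by simp [ξ, ← algebraMap_eq]
          rw [this]; exact hx P P.2
        let u := ξ ^ i * e ^ M
        have hval : dl D (P : Fin 2 → k) i u ≠ 0 := by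
          rw [dl_mul (ordGE_pow hξ), dl_pow hξ]
          refine mul_ne_zero (mul_ne_zero (hM i hi) (pow_ne_zero _ hDξ)) ?_
          rw [map_pow]; exact pow_ne_zero _ he
        let γ := w (P, ⟨i, hi⟩) / dl D (P : Fin 2 → k) i u
        have hmem : w - γ • Λ u ∈ LinearMap.range Λ := by
          refine ih (by omega) _ (fun x hxx => ?_)
          obtain ⟨Q, j⟩ := x
          simp only [Pi.sub_apply, Pi.smul_apply, smul_eq_mul, hΛ]
          by_cases hQ : Q = P
          · subst hQ
            have hj : (j : ℕ) + m < M := by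
              rcases hxx with h | h
              · exact absurd rfl h
              · exact h
            by_cases hji : (j : ℕ) = i
            · have : j = ⟨i, hi⟩ := Fin.ext hji
              subst this
              simp only [γ]
              rw [div_mul_cancel₀ _ hval, sub_self]
            · have hji' : (j : ℕ) < i := by omega
              rw [hw (Q, j) (Or.inr (by simp only; omega)),
                ((ordGE_pow hξ).mul (e ^ M)) j hji']
              simp
          · rw [hw (Q, j) (Or.inl hQ)]
            have : ordGE D (Q : Fin 2 → k) M u := by
              simp only [u]; rw [mul_comm]
              exact (ordGE_pow (hes Q Q.2 (fun h => hQ (Subtype.ext h)))).mul _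
            rw [this j j.2]; simp
        have := Submodule.add_mem _ hmem (Submodule.smul_mem _ γ (LinearMap.mem_range_self Λ u))
        simpa using this
    rw [← LinearMap.range_eq_top, eq_top_iff]
    intro w _
    have : w = ∑ P : s, fun x => if x.1 = P then w x else 0 := by
      funext x
      simp [Finset.sum_apply]
    rw [this]
    refine Submodule.sum_mem _ (fun P _ => step P M le_rfl _ ?_)
    rintro x (h | h)
    · simp [h]
    · omega
  · intro u; funext x; rw [hΛ]
    exact (ordGE_of_const (M := M) hDφ (h0 x.1 x.1.2)).mul u x.2 x.2.2
  · intro u; funext x; rw [hΛ]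
    exact (h1 x.1 x.1.2).mul u x.2 x.2.2
end
end PartB

section PartB2

theorem not_dvd_of_degreeOf_lt {k : Type*} [Field k] {n d : ℕ} {f u : MvPolynomial (Fin (n+1)) k}
    (hd : f.totalDegree ≤ d) (hc : coeff (Finsupp.single 0 d) f ≠ 0) (hu : u ≠ 0)
    (hdu : degreeOf 0 u < d) : ¬ f ∣ u := by
  rintro ⟨v, rfl⟩
  have hf : f ≠ 0 := left_ne_zero_of_mul hu
  have hv : v ≠ 0 := right_ne_zero_of_mul hu
  rw [← natDegree_finSuccEquiv, map_mul, Polynomial.natDegree_mul, natDegree_fse_eq hd hc] at hdu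
  · omega
  · exact (map_ne_zero_iff _ (finSuccEquiv k n).injective).2 hf
  · exact (map_ne_zero_iff _ (finSuccEquiv k n).injective).2 hv

theorem tdeg_eq {k : Type*} [Field k] {n d : ℕ} {f : MvPolynomial (Fin (n+1)) k}
    (hd : f.totalDegree ≤ d) (hc : coeff (Finsupp.single 0 d) f ≠ 0) : f.totalDegree = d := by
  refine le_antisymm hd ?_
  have := le_totalDegree (mem_support_iff.2 hc)
  simpa using this

theorem dl_iter {k : Type*} [CommRing k]
    (D : Derivation k (MvPolynomial (Fin 2) k) (MvPolynomial (Fin 2) k)) (P : Fin 2 → k)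
    (j : ℕ) (u : MvPolynomial (Fin 2) k) : dl D P j u = eval P (D^[j] u) := by
  induction j generalizing u with
  | zero => simp [dl_zero]
  | succ j ih => rw [dl_succ, ih, Function.iterate_succ_apply]

variable {k : Type*} [Field k]
variable {D : Derivation k (MvPolynomial (Fin 2) k) (MvPolynomial (Fin 2) k)}

theorem wronskian {φ : MvPolynomial (Fin 2) k} (hφ : Irreducible φ) {P₀ : Fin 2 → k}
    (h0 : eval P₀ φ = 0) {ι : Type*} [Fintype ι] (u v : ι → MvPolynomial (Fin 2) k) (J : ℕ)
    (hu : ∀ c : ι → k, (∀ j < J, dl D P₀ j (∑ a, c a • u a) = 0) → c = 0)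
    (hv : ∀ j < J, φ ∣ ∑ a, D^[j] (u a) * v a) (a : ι) : φ ∣ v a := by
  classical
  let M : Matrix (Fin J) ι (MvPolynomial (Fin 2) k) := Matrix.of fun j a => D^[j] (u a)
  let M0 : Matrix (Fin J) ι k := M.map (eval P₀)
  have hinj : LinearMap.ker (Matrix.mulVecLin M0) = ⊥ := by
    rw [LinearMap.ker_eq_bot']
    intro c hc
    apply hu
    intro j hj
    have := congrFun hc ⟨j, hj⟩
    simp only [Matrix.mulVecLin_apply, Matrix.mulVec, dotProduct, M0, M, Matrix.map_apply,
      Matrix.of_apply, Pi.zero_apply] at this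
    rw [map_sum, ← this]
    refine Finset.sum_congr rfl (fun a _ => ?_)
    rw [map_smul, dl_iter, smul_eq_mul, mul_comm]
  obtain ⟨L, hL⟩ := LinearMap.exists_leftInverse_of_injective _ hinj
  let L' := LinearMap.toMatrix' L
  have hLM : L' * M0 = 1 := by
    have := congrArg LinearMap.toMatrix' hL
    rw [LinearMap.toMatrix'_comp, LinearMap.toMatrix'_id, ← Matrix.toLin'_apply',
      LinearMap.toMatrix'_toLin'] at this
    exact this
  let LC : Matrix ι (Fin J) (MvPolynomial (Fin 2) k) := Matrix.map L' C
  let MM : Matrix ι ι (MvPolynomial (Fin 2) k) := LC * M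
  have hMM : MM.map (eval P₀) = 1 := by
    simp only [MM]
    rw [Matrix.map_mul]
    rw [← hLM]
    congr 1
    ext i j; simp [LC]
  have hdet : eval P₀ MM.det = 1 := by
    rw [RingHom.map_det, RingHom.mapMatrix_apply, hMM, Matrix.det_one]
  have hvec : ∀ a, φ ∣ MM.mulVec v a := by
    intro a
    simp only [MM]
    rw [← Matrix.mulVec_mulVec]
    rw [Matrix.mulVec, dotProduct]
    refine Finset.dvd_sum (fun j _ => Dvd.dvd.mul_left ?_ _)
    exact hv j j.2
  have h2 : φ ∣ MM.det * v a := by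
    have : MM.det * v a = (MM.adjugate.mulVec (MM.mulVec v)) a := by
      rw [Matrix.mulVec_mulVec, Matrix.adjugate_mul, Matrix.smul_mulVec, Matrix.one_mulVec]
      simp
    rw [this, Matrix.mulVec, dotProduct]
    exact Finset.dvd_sum (fun j _ => Dvd.dvd.mul_left (hvec j) _)
  rcases hφ.prime.dvd_or_dvd h2 with h | h
  · obtain ⟨q, hq⟩ := h
    rw [hq, map_mul, h0, zero_mul] at hdet
    exact absurd hdet zero_ne_one
  · exact h

theorem exists_dvd_all {φ : MvPolynomial (Fin 2) k} {d N M : ℕ} (hφ : φ ≠ 0)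
    (hd : φ.totalDegree = d) (hN : d ≤ N) {ι : Type*} [Fintype ι]
    (H : Fin M → (ι → k) →ₗ[k] MvPolynomial (Fin 2) k)
    (hH : ∀ j c, (H j c).totalDegree ≤ N) (hcard : M * (d * (N + 2)) < Fintype.card ι) :
    ∃ c : ι → k, c ≠ 0 ∧ ∀ j, φ ∣ H j c := by
  let V := restrictTotalDegree (Fin 2) k N
  let S : Submodule k V := (mulV φ (N - d)).comap V.subtype
  have hle : mulV φ (N - d) ≤ V := mulV_le (by omega)
  have hS : Module.finrank k S = Module.finrank k (mulV φ (N-d)) :=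
    (Submodule.comapSubtypeEquivOfLe hle).finrank_eq
  have hq := Submodule.finrank_quotient_add_finrank S
  have hQ : Module.finrank k (V ⧸ S) ≤ d * (N + 2) := by
    have f1 := finrank_restr (k := k) N
    have f2 := finrank_mulV hφ (N - d)
    obtain ⟨m, rfl⟩ := Nat.exists_eq_add_of_le hN
    rw [show d + m - d = m by omega] at *
    change 2 * Module.finrank k V = _ at f1
    rw [← hS] at f2
    nlinarith
  let Ψ : (ι → k) →ₗ[k] (Fin M → V ⧸ S) :=
    LinearMap.pi (fun j => S.mkQ.comp ((H j).codRestrict V (fun c => by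
      rw [mem_restrictTotalDegree]; exact hH j c)))
  have hker : LinearMap.ker Ψ ≠ ⊥ := by
    apply LinearMap.ker_ne_bot_of_finrank_lt
    rw [Module.finrank_pi_fintype, Module.finrank_fintype_fun_eq_card]
    refine lt_of_le_of_lt ?_ hcard
    simp only [Finset.sum_const, Finset.card_univ, Fintype.card_fin, smul_eq_mul]
    exact Nat.mul_le_mul_left _ hQ
  obtain ⟨c, hc, hc0⟩ := (Submodule.ne_bot_iff _).1 hker
  refine ⟨c, hc0, fun j => ?_⟩
  have := congrFun (LinearMap.mem_ker.1 hc) j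
  simp only [Ψ, LinearMap.pi_apply, LinearMap.comp_apply, Submodule.mkQ_apply, Pi.zero_apply,
    Submodule.Quotient.mk_eq_zero] at this
  obtain ⟨w, _, hw⟩ := mem_mulV.1 (show H j c ∈ mulV φ (N-d) from this)
  exact ⟨w, hw.symm⟩

/-- rectangle of monomials -/
noncomputable def mz (k : Type*) [CommRing k] {d m : ℕ} (a : Fin d × Fin m) : MvPolynomial (Fin 2) k :=
  monomial (Finsupp.single 0 (a.1 : ℕ) + Finsupp.single 1 (a.2 : ℕ)) 1

theorem mz_inj {d m : ℕ} : Function.Injective (fun a : Fin d × Fin m =>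
    (Finsupp.single 0 (a.1 : ℕ) + Finsupp.single 1 (a.2 : ℕ) : Fin 2 →₀ ℕ)) := by
  intro a b h
  have h0 := DFunLike.congr_fun h 0
  have h1 := DFunLike.congr_fun h 1
  simp at h0 h1
  exact Prod.ext (Fin.ext h0) (Fin.ext h1)

theorem mz_deg {d m : ℕ} (a : Fin d × Fin m) : (mz k a).totalDegree ≤ d + m := by
  unfold mz
  refine (totalDegree_monomial_le _ _).trans ?_
  have h : (Finsupp.single 0 (a.1 : ℕ) + Finsupp.single 1 (a.2 : ℕ) : Fin 2 →₀ ℕ).sum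
    (fun _ => id) = a.1 + a.2 := by
    rw [Finsupp.sum_fintype _ _ (by simp)]; simp [Fin.sum_univ_two]
  rw [h]
  have := a.1.2; have := a.2.2; omega

theorem coeff_mz_sum {d m : ℕ} (c : Fin d × Fin m → k) (a : Fin d × Fin m) :
    coeff (Finsupp.single 0 (a.1 : ℕ) + Finsupp.single 1 (a.2 : ℕ)) (∑ b, c b • mz k b) = c a := by
  classical
  rw [coeff_sum, Finset.sum_eq_single a]
  · simp [mz]
  · intro b _ hb
    simp only [mz, coeff_smul, coeff_monomial]
    rw [if_neg (fun h => hb (mz_inj h))]; simp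
  · simp

theorem mz_not_dvd {φ : MvPolynomial (Fin 2) k} {d m : ℕ} (hd : φ.totalDegree ≤ d)
    (hc : coeff (Finsupp.single 0 d) φ ≠ 0) (c : Fin d × Fin m → k) (h : φ ∣ ∑ b, c b • mz k b) :
    c = 0 := by
  by_contra hne
  obtain ⟨a, ha⟩ := Function.ne_iff.1 hne
  refine not_dvd_of_degreeOf_lt hd hc ?_ ?_ h
  · intro h0
    have := coeff_mz_sum c a
    rw [h0] at this
    exact ha (by simpa using this.symm)
  · have hdpos : 0 < d := lt_of_le_of_lt (Nat.zero_le _) a.1.2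
    refine lt_of_le_of_lt (degreeOf_sum_le _ _ _) ?_
    rw [Finset.sup_lt_iff (by simpa using hdpos)]
    intro b _
    by_cases hb : c b = 0
    · simpa [hb] using hdpos
    · rw [mz, smul_monomial, degreeOf_monomial_eq _ _ (by simpa using hb)]
      simp
end PartB2

section PartB3

theorem tdeg_pderiv {k σ : Type*} [CommRing k] (i : σ) (u : MvPolynomial σ k) :
    (pderiv i u).totalDegree ≤ u.totalDegree := by
  classical
  conv_lhs => rw [u.as_sum, map_sum]
  refine totalDegree_finsetSum_le (fun v hv => ?_)
  rw [pderiv_monomial]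
  refine (totalDegree_monomial_le _ _).trans (le_trans ?_ (le_totalDegree hv))
  exact Finsupp.degree_mono (tsub_le_self)

theorem tdeg_dphi {k : Type*} [CommRing k] {φ : MvPolynomial (Fin 2) k} {d : ℕ}
    (hd : φ.totalDegree ≤ d) (u : MvPolynomial (Fin 2) k) :
    (dphi φ u).totalDegree ≤ u.totalDegree + d := by
  rw [dphi_apply]
  refine (totalDegree_sub _ _).trans (max_le ?_ ?_)
  all_goals
    refine (totalDegree_mul _ _).trans ?_
    have h1 := tdeg_pderiv 0 φ
    have h2 := tdeg_pderiv 1 φ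
    have h3 := tdeg_pderiv 0 u
    have h4 := tdeg_pderiv 1 u
    omega

theorem tdeg_dphi_iter {k : Type*} [CommRing k] {φ : MvPolynomial (Fin 2) k} {d : ℕ}
    (hd : φ.totalDegree ≤ d) (u : MvPolynomial (Fin 2) k) (j : ℕ) :
    ((dphi φ)^[j] u).totalDegree ≤ u.totalDegree + j * d := by
  induction j with
  | zero => simp
  | succ j ih =>
    rw [Function.iterate_succ_apply']
    refine (tdeg_dphi hd _).trans ?_
    rw [Nat.succ_mul]; omega

theorem iter_mul_const {k : Type*} [CommRing k]
    (D : Derivation k (MvPolynomial (Fin 2) k) (MvPolynomial (Fin 2) k))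
    {c : MvPolynomial (Fin 2) k} (hc : D c = 0) (u : MvPolynomial (Fin 2) k) (j : ℕ) :
    D^[j] (u * c) = D^[j] u * c := by
  induction j generalizing u with
  | zero => simp
  | succ j ih => 
    rw [Function.iterate_succ_apply, Function.iterate_succ_apply, Derivation.leibniz, hc]
    simp only [smul_eq_mul, mul_zero, zero_add]
    rw [mul_comm, ih]

theorem iter_sum {k : Type*} [CommRing k]
    (D : Derivation k (MvPolynomial (Fin 2) k) (MvPolynomial (Fin 2) k)) {ι : Type*} (s : Finset ι)
    (c : ι → k) (u : ι → MvPolynomial (Fin 2) k) (j : ℕ) :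
    D^[j] (∑ a ∈ s, c a • u a) = ∑ a ∈ s, c a • D^[j] (u a) := by
  induction j with
  | zero => simp
  | succ j ih =>
    simp only [Function.iterate_succ_apply', ih, map_sum]
    exact Finset.sum_congr rfl (fun x _ => D.map_smul _ _)

theorem stepanov0 (p : ℕ) [Fact p.Prime] {φ : MvPolynomial (Fin 2) (ZMod p)} (hφ : Irreducible φ)
    {d : ℕ} (hd : φ.totalDegree ≤ d) (hc : coeff (Finsupp.single 0 d) φ ≠ 0)
    {P₀ : Fin 2 → ZMod p} (h0 : eval P₀ φ = 0) (hz : eval P₀ (pderiv 0 φ) ≠ 0) (m1 m2 M : ℕ)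
    (hcond : M * (d * (m1 + m2 + 2 * d + M * d + 2)) < (d * m1) * (d * m2))
    (hJ : d * (d + m1) + 1 ≤ p) (hM : M ≤ p) (s : Finset (Fin 2 → ZMod p))
    (hs : ∀ P ∈ s, eval P φ = 0 ∧ eval P (pderiv 0 φ) ≠ 0) :
    M * s.card ≤ d * (d + m1 + p * (d + m2)) := by
  classical
  have hp : p.Prime := Fact.out
  have hfac : ∀ i < p, (i.factorial : ZMod p) ≠ 0 := by
    intro i hi h
    rw [ZMod.natCast_eq_zero_iff, hp.dvd_factorial] at h
    omega
  set D := dphi φ with hD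
  have hDx : ∀ P, eval P (D (X 1)) = eval P (pderiv 0 φ) := by
    intro P; rw [hD, dphi_apply]; simp
  have hDφ : D φ = 0 := dphi_self φ
  have hDp : ∀ w : MvPolynomial (Fin 2) (ZMod p), D (w ^ p) = 0 := by
    intro w; rw [Derivation.leibniz_pow]; simp
  let ι := (Fin d × Fin m1) × (Fin d × Fin m2)
  let u : Fin d × Fin m1 → MvPolynomial (Fin 2) (ZMod p) := mz _
  let w : Fin d × Fin m2 → MvPolynomial (Fin 2) (ZMod p) := mz _
  let H : Fin M → (ι → ZMod p) →ₗ[ZMod p] MvPolynomial (Fin 2) (ZMod p) := fun j =>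
    Fintype.linearCombination (ZMod p) (fun x : ι => D^[j] (u x.1) * w x.2)
  have hHdef : ∀ j c, H j c = ∑ x : ι, c x • (D^[(j : ℕ)] (u x.1) * w x.2) := fun j c => rfl
  have hH : ∀ j c, (H j c).totalDegree ≤ m1 + m2 + 2 * d + M * d := by
    intro j c
    rw [hHdef]
    refine totalDegree_finsetSum_le (fun x _ => (totalDegree_smul_le _ _).trans ?_)
    refine (totalDegree_mul _ _).trans ?_
    have h1 := tdeg_dphi_iter hd (u x.1) j
    have h2 : (u x.1).totalDegree ≤ d + m1 := mz_deg _
    have h3 : (w x.2).totalDegree ≤ d + m2 := mz_deg _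
    have h4 : (j : ℕ) * d ≤ M * d := Nat.mul_le_mul_right _ j.2.le
    rw [← hD] at h1
    omega
  obtain ⟨c, hc0, hcdvd⟩ := exists_dvd_all hφ.ne_zero (tdeg_eq hd hc) (by omega) H hH
    (by simpa [ι] using hcond)
  let G := ∑ x : ι, c x • (u x.1 * w x.2 ^ p)
  have hDG : ∀ j, D^[j] G = ∑ x : ι, c x • (D^[j] (u x.1) * w x.2 ^ p) := by
    intro j
    simp only [G]
    rw [iter_sum]
    refine Finset.sum_congr rfl (fun x _ => ?_)
    rw [iter_mul_const _ (hDp _)]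
  have hG : ¬ φ ∣ G := by
    intro hdvd
    have hdj : ∀ j, φ ∣ D^[j] G := by
      obtain ⟨q, hq⟩ := hdvd
      intro j
      rw [hq, mul_comm, iter_mul_const _ hDφ]
      exact Dvd.intro_left _ rfl
    apply hc0
    have key := wronskian (D := D) hφ h0 u (fun a => ∑ b, c (a, b) • w b ^ p) (d * (d + m1) + 1)
      ?_ ?_
    · funext x
      obtain ⟨a, b⟩ := x
      have h1 := key a
      have h2 : ∑ b, c (a, b) • w b ^ p = (∑ b, c (a, b) • w b) ^ p := by
        rw [sum_pow_char]
        refine Finset.sum_congr rfl (fun b _ => ?_)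
        rw [smul_pow, ZMod.pow_card]
      rw [h2] at h1
      have h3 := mz_not_dvd hd hc _ (hφ.prime.dvd_of_dvd_pow h1)
      exact congrFun h3 b
    · intro c' hc'
      by_contra hne
      have := bezout_mult hφ hDφ (fun h => hne (mz_not_dvd hd hc c' h)) (d * (d + m1) + 1)
        (fun i hi => hfac i (by omega)) {P₀} (by simpa using h0)
        (by simp only [Finset.mem_singleton, forall_eq]; rw [hDx]; exact hz)
        (by simpa [ordGE] using hc')
      have h2 : (∑ b, c' b • mz (ZMod p) b).totalDegree ≤ d + m1 :=
        totalDegree_finsetSum_le (fun x _ => (totalDegree_smul_le _ _).trans (mz_deg _))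
      have h3 := Nat.mul_le_mul hd h2
      simp only [Finset.card_singleton] at this
      omega
    · intro j _
      have := hdj j
      rw [hDG, Fintype.sum_prod_type] at this
      convert this using 2 with a
      rw [Finset.mul_sum]
      refine Finset.sum_congr rfl (fun b _ => ?_)
      rw [mul_smul_comm]
  have hGdeg : G.totalDegree ≤ d + m1 + p * (d + m2) := by
    refine totalDegree_finsetSum_le (fun x _ => (totalDegree_smul_le _ _).trans ?_)
    refine (totalDegree_mul _ _).trans (add_le_add (mz_deg _) ?_)
    exact (totalDegree_pow _ _).trans (Nat.mul_le_mul_left _ (mz_deg _))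
  refine (bezout_mult hφ hDφ hG M (fun i hi => hfac i (by omega)) s (fun P hP => (hs P hP).1)
    (fun P hP => by rw [hDx]; exact (hs P hP).2) ?_).trans (Nat.mul_le_mul hd hGdeg)
  intro P hP j hj
  rw [dl_iter, hDG]
  have h1 := hcdvd ⟨j, hj⟩
  rw [hHdef] at h1
  obtain ⟨q, hq⟩ := h1
  have h2 := congrArg (eval P) hq
  rw [map_mul, (hs P hP).1, zero_mul] at h2
  rw [← h2]
  simp only [map_sum, smul_eval, map_mul, map_pow, ZMod.pow_card]

/-- Upper bound for the number of points on a plane curve over `F_p`. -/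
theorem stepanov (p : ℕ) [Fact p.Prime] {φ : MvPolynomial (Fin 2) (ZMod p)} (hφ : Irreducible φ)
    {d : ℕ} (hd1 : 1 ≤ d) (hd : φ.totalDegree ≤ d) (hc : coeff (Finsupp.single 0 d) φ ≠ 0)
    {P₀ : Fin 2 → ZMod p} (h0 : eval P₀ φ = 0) (hz : eval P₀ (pderiv 0 φ) ≠ 0)
    (e : ℕ) (he : 2 ≤ e) (hp : d * (d + d * e * (e + 2 * d + d * e * d + 2) + 2) + 1 ≤ p)
    (s : Finset (Fin 2 → ZMod p))
    (hs : ∀ P ∈ s, eval P φ = 0 ∧ eval P (pderiv 0 φ) ≠ 0) :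
    (d * e - 1) * s.card ≤ p * (d * e + 1 + 2 * d ^ 2) := by
  obtain ⟨M, hM⟩ : ∃ M, d * e = M + 1 := ⟨d * e - 1, by
    have : 1 ≤ d * e := Nat.mul_pos hd1 (by omega)
    omega⟩
  rw [hM] at hp ⊢
  have hq := Nat.div_add_mod (p - 1) d
  have hq2 := Nat.mod_lt (p - 1) (show 0 < d by omega)
  set Q := (p - 1) / d
  have hQ1 : d + (M + 1) * (e + 2 * d + (M + 1) * d + 2) + 2 ≤ Q := by
    rw [Nat.le_div_iff_mul_le (by omega)]
    rw [mul_comm]; omega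
  obtain ⟨m1, hm1⟩ : ∃ m1, Q = d + m1 := ⟨Q - d, by omega⟩
  have hMM : M * (e + 2 * d + M * d + 2) + 1 ≤ m1 := by
    have : (M + 1) * (e + 2 * d + (M + 1) * d + 2) + 2 ≤ m1 := by omega
    nlinarith
  have hdQ : d * Q + 1 ≤ p := by omega
  have := stepanov0 p hφ hd hc h0 hz m1 e M ?_ ?_ ?_ s hs
  · rw [← hm1] at this
    simp only [Nat.add_sub_cancel]
    refine this.trans ?_
    have h1 : d * (Q + p * (d + e)) = d * Q + p * (d * d + d * e) := by ring
    rw [h1, hM]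
    nlinarith
  · have h1 : M * (m1 + e + 2 * d + M * d + 2) < m1 * (M + 1) := by nlinarith
    calc M * (d * (m1 + e + 2 * d + M * d + 2)) = d * (M * (m1 + e + 2 * d + M * d + 2)) := by ring
      _ < d * (m1 * (M + 1)) := Nat.mul_lt_mul_of_pos_left h1 (by omega)
      _ = d * m1 * (d * e) := by rw [hM]; ring
  · rw [← hm1]; exact hdQ
  · have : Q ≤ d * Q := Nat.le_mul_of_pos_left _ (by omega)
    have h5 : M ≤ M * (e + 2 * d + M * d + 2) := Nat.le_mul_of_pos_right _ (by omega)
    omega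
end PartB3

section PartS

theorem tdeg_X {R σ : Type*} [CommRing R] (i : σ) : (X i : MvPolynomial σ R).totalDegree ≤ 1 := by
  refine (totalDegree_monomial_le _ _).trans ?_
  simp

theorem one_le_tdeg {k σ : Type*} [Field k] {u : MvPolynomial σ k} (hu : u ≠ 0) (hnu : ¬ IsUnit u) :
    1 ≤ u.totalDegree := by
  by_contra hlt
  have h := totalDegree_eq_zero_iff_eq_C.1 (by omega : u.totalDegree = 0)
  rw [h] at hnu
  apply hnu
  refine IsUnit.map _ (isUnit_iff_ne_zero.2 (fun h0 => hu ?_))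
  rw [h, h0, C_0]

theorem tdeg_aeval {R S σ τ : Type*} [CommRing R] [CommRing S] [Algebra R S]
    (Φ : σ → MvPolynomial τ S) (hΦ : ∀ i, (Φ i).totalDegree ≤ 1) (f : MvPolynomial σ R) :
    (aeval Φ f).totalDegree ≤ f.totalDegree := by
  rw [aeval_def, eval₂_eq]
  refine totalDegree_finsetSum_le (fun v hv => ?_)
  refine (totalDegree_mul _ _).trans ?_
  have h1 : (algebraMap R (MvPolynomial τ S) (coeff v f)).totalDegree = 0 := by
    rw [IsScalarTower.algebraMap_apply R S, algebraMap_eq, totalDegree_C]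
  rw [h1, zero_add]
  refine (totalDegree_finsetProd _ _).trans (le_trans ?_ (le_totalDegree hv))
  refine Finset.sum_le_sum (fun i _ => ?_)
  refine (totalDegree_pow _ _).trans ?_
  calc v i * (Φ i).totalDegree ≤ v i * 1 := Nat.mul_le_mul_left _ (hΦ i)
    _ = v i := mul_one _

theorem coeff_lin {R σ : Type*} [CommRing R] [Fintype σ] (L : σ → Polynomial R)
    (hL : ∀ i, (L i).natDegree ≤ 1) {d : ℕ} {f : MvPolynomial σ R} (hd : f.totalDegree ≤ d) :
    (aeval L f).coeff d = eval (fun i => (L i).coeff 1) (homogeneousComponent d f) := by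
  classical
  have key : ∀ v : σ →₀ ℕ, (∏ i, L i ^ v i).coeff (v.degree) = ∏ i, ((L i).coeff 1) ^ v i := by
    intro v
    have h : ∀ s : Finset σ, (∏ i ∈ s, L i ^ v i).natDegree ≤ ∑ i ∈ s, v i ∧
        (∏ i ∈ s, L i ^ v i).coeff (∑ i ∈ s, v i) = ∏ i ∈ s, ((L i).coeff 1) ^ v i := by
      intro s
      induction s using Finset.induction_on with
      | empty => simp
      | insert a s ha ih =>
        rw [Finset.prod_insert ha, Finset.sum_insert ha, Finset.prod_insert ha]
        have h1 : (L a ^ v a).natDegree ≤ v a := by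
          simpa using Polynomial.natDegree_pow_le_of_le (v a) (hL a)
        refine ⟨Polynomial.natDegree_mul_le_of_le h1 ih.1, ?_⟩
        rw [Polynomial.coeff_mul_add_eq_of_natDegree_le h1 ih.1, ih.2]
        have := Polynomial.coeff_pow_of_natDegree_le (m := v a) (hL a)
        rw [mul_one] at this
        rw [this]
    rw [Finsupp.degree_eq_sum]
    exact (h Finset.univ).2
  have key2 : ∀ v : σ →₀ ℕ, (∏ i, L i ^ v i).natDegree ≤ v.degree := by
    intro v
    rw [Finsupp.degree_eq_sum]
    refine (Polynomial.natDegree_prod_le _ _).trans (Finset.sum_le_sum (fun i _ => ?_))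
    simpa using Polynomial.natDegree_pow_le_of_le (v i) (hL i)
  rw [aeval_def, eval₂_eq', Polynomial.finsetSum_coeff, homogeneousComponent_apply, map_sum,
    Finset.sum_filter]
  refine Finset.sum_congr rfl (fun v hv => ?_)
  rw [Polynomial.algebraMap_eq, Polynomial.coeff_C_mul]
  have hvd : v.degree ≤ d := by
    refine le_trans ?_ hd
    exact le_totalDegree hv
  split_ifs with h
  · rw [eval_monomial, ← h, key, Finsupp.prod_fintype _ _ (by simp)]
  · rw [Polynomial.coeff_eq_zero_of_natDegree_lt, mul_zero]
    exact lt_of_le_of_lt (key2 v) (lt_of_le_of_ne hvd h)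

theorem coeff_top {R : Type*} [CommRing R] {n : ℕ} (d : ℕ) (f : MvPolynomial (Fin (n+1)) R) :
    coeff (Finsupp.single 0 d) f =
      eval (Fin.cons 1 (fun _ => 0)) (homogeneousComponent d f) := by
  classical
  rw [homogeneousComponent_apply, map_sum, Finset.sum_filter]
  have h : ∀ v : Fin (n+1) →₀ ℕ, (if v.degree = d then
      eval (Fin.cons 1 (fun _ => 0) : Fin (n+1) → R) (monomial v (coeff v f)) else 0)
      = if v = Finsupp.single 0 d then coeff v f else 0 := by
    intro v
    by_cases hv : v = Finsupp.single 0 d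
    · subst hv
      rw [if_pos (by simp), if_pos rfl, eval_monomial]
      simp
    · rw [if_neg hv]
      split_ifs with h
      · rw [eval_monomial, Finsupp.prod_fintype _ _ (by simp), Fin.prod_univ_succ]
        have : ∃ i : Fin n, v i.succ ≠ 0 := by
          by_contra hcon
          push Not at hcon
          apply hv
          refine Finsupp.ext (fun i => ?_)
          rw [Finsupp.degree_eq_sum, Fin.sum_univ_succ] at h
          simp only [hcon, Finset.sum_const_zero, add_zero] at h
          refine Fin.cases ?_ (fun i => ?_) i
          · simpa using h
          · simpa using hcon i
        obtain ⟨i, hi⟩ := this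
        rw [Finset.prod_eq_zero (Finset.mem_univ i) (by simp [hi])]
        simp
      · rfl
  rw [Finset.sum_congr rfl (fun v _ => h v), Finset.sum_ite_eq']
  split_ifs with h2
  · rfl
  · exact notMem_support_iff.1 h2

theorem pderiv_aeval {R σ τ : Type*} [CommRing R] [DecidableEq σ] (Φ : σ → MvPolynomial τ R)
    (i₀ : σ) (j : τ) (hΦ : ∀ i, pderiv j (Φ i) = if i = i₀ then 1 else 0) (f : MvPolynomial σ R) :
    pderiv j (aeval Φ f) = aeval Φ (pderiv i₀ f) := by
  induction f using MvPolynomial.induction_on with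
  | C a => simp
  | add p q hp hq => rw [map_add, map_add, map_add, map_add, hp, hq]
  | mul_X p i hp =>
    rw [map_mul, aeval_X, Derivation.leibniz, Derivation.leibniz, hΦ, hp, pderiv_X]
    simp only [smul_eq_mul, map_add, map_mul, aeval_X, Pi.single_apply]
    split_ifs with h1
    · simp
    · simp

theorem exists_minor {K m ι : Type*} [Field K] [Fintype m] [Fintype ι] [DecidableEq ι]
    (M : Matrix m ι K) (hM : ∀ c, M.mulVec c = 0 → c = 0) :
    ∃ e : ι → m, Function.Injective e ∧ (M.submatrix e id).det ≠ 0 := by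
  classical
  obtain ⟨κ, a, ha, hspan, hli⟩ := exists_linearIndependent' K M.row
  have htop : Submodule.span K (Set.range M.row) = ⊤ := by
    by_contra hne
    obtain ⟨φ, hφ0, hφ⟩ := Submodule.exists_le_ker_of_lt_top _ (lt_top_iff_ne_top.2 hne)
    apply hφ0
    have h0 : (fun i => φ (Pi.single i 1)) = 0 := by
      apply hM
      funext r
      have h1 : φ (M.row r) = 0 := hφ (Submodule.subset_span ⟨r, rfl⟩)
      rw [LinearMap.pi_apply_eq_sum_univ φ] at h1
      simp only [Matrix.mulVec, dotProduct, Pi.zero_apply]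
      rw [← h1]
      refine Finset.sum_congr rfl (fun i _ => ?_)
      simp only [smul_eq_mul, Matrix.row]
      congr 2
      funext j
      simp [Pi.single_apply, eq_comm]
    refine LinearMap.ext (fun c => ?_)
    rw [LinearMap.pi_apply_eq_sum_univ φ]
    refine Finset.sum_eq_zero (fun i _ => ?_)
    have := congrFun h0 i
    simp only [Pi.zero_apply] at this
    have h3 : (fun j => if i = j then (1:K) else 0) = Pi.single i 1 := by
      funext j; simp [Pi.single_apply, eq_comm]
    rw [h3, this, smul_zero]
  have : Finite κ := Finite.of_injective a ha
  have := Fintype.ofFinite κ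
  have b : Module.Basis κ K (ι → K) := Module.Basis.mk hli (by rw [hspan, htop])
  have hcard : Fintype.card ι = Fintype.card κ := by
    rw [← Module.finrank_fintype_fun_eq_card K, Module.finrank_eq_card_basis b]
  let ee := Fintype.equivOfCardEq hcard
  refine ⟨a ∘ ee, ha.comp ee.injective, ?_⟩
  have hli2 : LinearIndependent K (M.submatrix (a ∘ ee) id).row := by
    have := hli.comp ee ee.injective
    exact this
  rw [Matrix.linearIndependent_rows_iff_isUnit, Matrix.isUnit_iff_isUnit_det] at hli2
  exact hli2.ne_zero

theorem univ_bound {σ : Type*} (Q : MvPolynomial σ ℤ) : ∃ K : ℕ, ∀ (v : σ → ℤ) (H : ℕ), 1 ≤ H →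
    (∀ i, |v i| ≤ H) → |eval v Q| ≤ (K * H ^ K : ℕ) := by
  induction Q using MvPolynomial.induction_on with
  | C a =>
    refine ⟨a.natAbs, fun v H hH _ => ?_⟩
    rw [eval_C, Int.abs_eq_natAbs]
    exact_mod_cast Nat.le_mul_of_pos_right _ (Nat.pow_pos hH)
  | add p q hp hq =>
    obtain ⟨K1, h1⟩ := hp
    obtain ⟨K2, h2⟩ := hq
    refine ⟨K1 + K2, fun v H hH hv => ?_⟩
    have e1 : H ^ K1 ≤ H ^ (K1 + K2) := Nat.pow_le_pow_right hH (by omega)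
    have e2 : H ^ K2 ≤ H ^ (K1 + K2) := Nat.pow_le_pow_right hH (by omega)
    have e3 : K1 * H ^ K1 + K2 * H ^ K2 ≤ (K1 + K2) * H ^ (K1 + K2) := by
      rw [Nat.add_mul]; gcongr <;> omega
    rw [map_add]
    refine (abs_add_le _ _).trans ((add_le_add (h1 v H hH hv) (h2 v H hH hv)).trans ?_)
    exact_mod_cast e3
  | mul_X p i hp =>
    obtain ⟨K, h1⟩ := hp
    refine ⟨K + 1, fun v H hH hv => ?_⟩
    rw [map_mul, eval_X, abs_mul]
    refine (mul_le_mul (h1 v H hH hv) (hv i) (abs_nonneg _) (by positivity)).trans ?_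
    have : K * H ^ K * H ≤ (K + 1) * H ^ (K + 1) := by
      rw [pow_succ, ← mul_assoc]; gcongr; omega
    exact_mod_cast this
end PartS

section PartC

theorem map_aeval' {R S σ τ : Type*} [CommRing R] [CommRing S] (ρ : R →+* S)
    (Φ : σ → MvPolynomial τ R) (g : MvPolynomial σ R) :
    map ρ (aeval Φ g) = aeval (fun i => map ρ (Φ i)) (map ρ g) := by
  induction g using MvPolynomial.induction_on with
  | C a => simp only [aeval_C, algebraMap_eq, map_C]
  | add p q hp hq => simp only [map_add, hp, hq]
  | mul_X p i hp => simp only [map_mul, hp, aeval_X, map_X]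

/-- restriction to the plane `y = t x` -/
noncomputable def sl {R : Type*} [CommRing R] (t : R) (g : MvPolynomial (Fin 3) R) :
    MvPolynomial (Fin 2) R := aeval ![X 0, X 1, C t * X 1] g

/-- translation -/
noncomputable def tr {R : Type*} [CommRing R] {n : ℕ} (P : Fin n → R) (g : MvPolynomial (Fin n) R) :
    MvPolynomial (Fin n) R := aeval (fun i => X i + C (P i)) g

theorem map_sl {R S : Type*} [CommRing R] [CommRing S] (ρ : R →+* S) (t : R)
    (g : MvPolynomial (Fin 3) R) : map ρ (sl t g) = sl (ρ t) (map ρ g) := by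
  rw [sl, map_aeval', sl]
  congr 2
  funext i; fin_cases i <;> simp

theorem map_tr {R S : Type*} [CommRing R] [CommRing S] {n : ℕ} (ρ : R →+* S) (P : Fin n → R)
    (g : MvPolynomial (Fin n) R) : map ρ (tr P g) = tr (fun i => ρ (P i)) (map ρ g) := by
  rw [tr, map_aeval', tr]
  simp

section
variable {R : Type*} [CommRing R]

theorem eval_tr {n : ℕ} (P Q : Fin n → R) (g : MvPolynomial (Fin n) R) :
    eval Q (tr P g) = eval (fun i => Q i + P i) g := by
  rw [tr, eval_aeval']; simp

theorem eval_sl (t : R) (Q : Fin 2 → R) (g : MvPolynomial (Fin 3) R) :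
    eval Q (sl t g) = eval ![Q 0, Q 1, t * Q 1] g := by
  rw [sl, eval_aeval']
  congr 2
  funext i; fin_cases i <;> simp

theorem tdeg_tr {n : ℕ} (P : Fin n → R) (g : MvPolynomial (Fin n) R) :
    (tr P g).totalDegree ≤ g.totalDegree := by
  refine tdeg_aeval _ (fun i => ?_) g
  refine (totalDegree_add _ _).trans ?_
  rw [totalDegree_C]; simp only [zero_le, sup_of_le_left]
  exact tdeg_X i

theorem tdeg_sl (t : R) (g : MvPolynomial (Fin 3) R) : (sl t g).totalDegree ≤ g.totalDegree := by
  refine tdeg_aeval _ (fun i => ?_) g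
  fin_cases i
  · exact tdeg_X _
  · exact tdeg_X _
  · refine (totalDegree_mul _ _).trans ?_
    simp only [totalDegree_C, zero_add]; exact tdeg_X _

theorem pderiv_tr {n : ℕ} (P : Fin n → R) (g : MvPolynomial (Fin n) R) (i : Fin n) :
    pderiv i (tr P g) = tr P (pderiv i g) := by
  classical
  refine pderiv_aeval _ i i (fun j => ?_) g
  simp [pderiv_X, Pi.single_apply, eq_comm]

theorem pderiv_sl (t : R) (g : MvPolynomial (Fin 3) R) :
    pderiv 0 (sl t g) = sl t (pderiv 0 g) := by
  classical
  refine pderiv_aeval _ 0 0 (fun j => ?_) g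
  fin_cases j <;> simp [pderiv_X, Derivation.leibniz]

theorem aeval_aeval_poly {σ τ : Type*} (L : τ → Polynomial R) (Φ : σ → MvPolynomial τ R)
    (g : MvPolynomial σ R) : aeval L (aeval Φ g) = aeval (fun i => aeval L (Φ i)) g := by
  rw [← AlgHom.comp_apply, comp_aeval]

/-- top coefficient after an affine substitution -/
theorem coeff_top_subst {n m d : ℕ} (Φ : Fin (n+1) → MvPolynomial (Fin (m+1)) R)
    (hΦ : ∀ i, (Φ i).totalDegree ≤ 1) {g : MvPolynomial (Fin (n+1)) R} (hd : g.totalDegree ≤ d) :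
    coeff (Finsupp.single 0 d) (aeval Φ g) =
      eval (fun i => coeff (Finsupp.single 0 1) (Φ i)) (homogeneousComponent d g) := by
  have hL : ∀ i : Fin (m+1), ((Fin.cons Polynomial.X (fun _ => 0) : Fin (m+1) → Polynomial R) i).natDegree ≤ 1 := by
    intro i; refine Fin.cases ?_ (fun i => ?_) i
    · simpa using Polynomial.natDegree_X_le
    · simp
  have hc : (fun i : Fin (m+1) => ((Fin.cons Polynomial.X (fun _ => 0) : Fin (m+1) → Polynomial R) i).coeff 1)
      = Fin.cons 1 (fun _ => 0) := by
    funext i; refine Fin.cases ?_ (fun i => ?_) i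
    · simp
    · simp
  have h1 : ∀ e, ∀ F : MvPolynomial (Fin (m+1)) R, F.totalDegree ≤ e → coeff (Finsupp.single 0 e) F
      = (aeval (Fin.cons Polynomial.X (fun _ => 0) : Fin (m+1) → Polynomial R) F).coeff e := by
    intro e F hF
    rw [coeff_top, coeff_lin _ hL hF, hc]
  rw [h1 d _ ((tdeg_aeval _ hΦ g).trans hd), aeval_aeval_poly, coeff_lin _ _ hd]
  · congr 2; funext i
    rw [h1 1 _ (hΦ i)]
  · intro i
    have := aeval_natDegree_le (Φ i) (hΦ i) _ hL
    simpa using this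

theorem coeff_top_tr {n d : ℕ} (P : Fin (n+1) → R) {g : MvPolynomial (Fin (n+1)) R}
    (hd : g.totalDegree ≤ d) :
    coeff (Finsupp.single 0 d) (tr P g) = coeff (Finsupp.single 0 d) g := by
  classical
  rw [tr, coeff_top_subst _ _ hd, coeff_top]
  · congr 2; funext i
    rw [coeff_add, coeff_X', coeff_C]
    have hne : (0 : Fin (n+1) →₀ ℕ) ≠ Finsupp.single 0 1 := by
      intro h; simpa using DFunLike.congr_fun h 0
    rw [if_neg hne, add_zero]
    refine Fin.cases ?_ (fun i => ?_) i
    · simp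
    · simp [Finsupp.single_eq_single_iff]
  · intro i
    refine (totalDegree_add _ _).trans ?_
    rw [totalDegree_C]; simp only [zero_le, sup_of_le_left]
    exact tdeg_X i

theorem coeff_top_sl {d : ℕ} (t : R) {g : MvPolynomial (Fin 3) R} (hd : g.totalDegree ≤ d) :
    coeff (Finsupp.single 0 d) (sl t g) = coeff (Finsupp.single 0 d) g := by
  classical
  rw [sl, coeff_top_subst _ _ hd, coeff_top]
  · congr 2; funext i
    fin_cases i
    · simp
    · simp [coeff_X', Finsupp.single_eq_single_iff]
    · simp [coeff_C_mul, coeff_X', Finsupp.single_eq_single_iff]; rfl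
  · intro i
    fin_cases i
    · exact tdeg_X _
    · exact tdeg_X _
    · refine (totalDegree_mul _ _).trans ?_
      simp only [totalDegree_C, zero_add]; exact tdeg_X _

/-- matrix of Taylor functionals at the origin -/
noncomputable def Mt (d : ℕ) (g : MvPolynomial (Fin 3) R) (t : R) :
    Matrix (Fin (2 * d * d + 1)) (Fin d × Fin d) R :=
  Matrix.of fun k a => dl (dphi (sl t g)) 0 k (mz R a)

theorem Mt_mulVec (d : ℕ) (g : MvPolynomial (Fin 3) R) (t : R) (c : Fin d × Fin d → R)
    (k : Fin (2 * d * d + 1)) :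
    (Mt d g t).mulVec c k = dl (dphi (sl t g)) 0 k (∑ a, c a • mz R a) := by
  simp only [Matrix.mulVec, dotProduct, Mt, Matrix.of_apply, map_sum, map_smul, smul_eq_mul]
  exact Finset.sum_congr rfl (fun a _ => mul_comm _ _)
end

theorem map_dl {R S : Type*} [CommRing R] [CommRing S] (ρ : R →+* S) (φ u : MvPolynomial (Fin 2) R)
    (P : Fin 2 → R) (j : ℕ) :
    dl (dphi (map ρ φ)) (ρ ∘ P) j (map ρ u) = ρ (dl (dphi φ) P j u) := by
  induction j generalizing u with
  | zero => rw [dl_zero, dl_zero, eval_map, eval₂_comp]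
  | succ j ih =>
    rw [dl_succ, dl_succ, ← ih]
    congr 1
    rw [dphi_apply, dphi_apply]
    simp only [map_sub, map_mul, pderiv_map]

theorem map_Mt {R S : Type*} [CommRing R] [CommRing S] (ρ : R →+* S) (d : ℕ)
    (g : MvPolynomial (Fin 3) R) (t : R) : (Mt d g t).map ρ = Mt d (map ρ g) (ρ t) := by
  ext k a
  simp only [Mt, Matrix.map_apply, Matrix.of_apply]
  rw [← map_dl, map_sl]
  congr 2
  · funext i; simp
  · simp [mz]

theorem expand_mz {k : Type*} [CommRing k] {d m : ℕ} {u : MvPolynomial (Fin 2) k}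
    (h : ∀ v ∈ u.support, v 0 < d ∧ v 1 < m) :
    ∑ a : Fin d × Fin m, coeff (Finsupp.single 0 (a.1 : ℕ) + Finsupp.single 1 (a.2 : ℕ)) u • mz k a
      = u := by
  classical
  conv_rhs => rw [u.as_sum]
  simp only [mz, smul_monomial, smul_eq_mul, mul_one]
  symm
  rw [← Finset.sum_image (f := fun v => monomial v (coeff v u)) (s := Finset.univ)
    (g := fun a : Fin d × Fin m => (Finsupp.single 0 (a.1 : ℕ) + Finsupp.single 1 (a.2 : ℕ) : Fin 2 →₀ ℕ))
    (fun a _ b _ hab => mz_inj hab)]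
  refine Finset.sum_subset (fun v hv => ?_) (fun v _ hv => ?_)
  · rw [Finset.mem_image]
    refine ⟨(⟨v 0, (h v hv).1⟩, ⟨v 1, (h v hv).2⟩), Finset.mem_univ _, ?_⟩
    refine Finsupp.ext (fun i => ?_)
    fin_cases i <;> simp
  · rw [notMem_support_iff.1 hv, monomial_zero]

theorem slice_irred {k : Type*} [Field k] {d : ℕ} {g : MvPolynomial (Fin 3) k} (hd1 : 1 ≤ d)
    (hd : g.totalDegree ≤ d) (hc : coeff (Finsupp.single 0 d) g ≠ 0) (h0 : eval 0 g = 0)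
    (hz : eval 0 (pderiv 0 g) ≠ 0) (t : k) (hM : ∀ c, (Mt d g t).mulVec c = 0 → c = 0) :
    Irreducible (sl t g) := by
  have hd' := (tdeg_sl t g).trans hd
  have hc' : coeff (Finsupp.single 0 d) (sl t g) ≠ 0 := by rwa [coeff_top_sl t hd]
  have hv0 : (![(0 : Fin 2 → k) 0, (0 : Fin 2 → k) 1, t * (0 : Fin 2 → k) 1] : Fin 3 → k) = 0 := by
    funext i; fin_cases i <;> simp
  have h0' : eval 0 (sl t g) = 0 := by rw [eval_sl, hv0, h0]
  have hz' : eval 0 (pderiv 0 (sl t g)) ≠ 0 := by rw [pderiv_sl, eval_sl, hv0]; exact hz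
  have hdeg := tdeg_eq hd' hc'
  set F := sl t g with hF
  have hF0 : F ≠ 0 := by intro h; rw [h] at hc'; simp at hc'
  have main : ∀ a b : MvPolynomial (Fin 2) k, F = a * b → ¬ IsUnit a → ¬ IsUnit b →
      eval 0 a = 0 → False := by
    intro a b hab ha hb ha0
    have ha' : a ≠ 0 := by rintro rfl; exact hF0 (by rw [hab, zero_mul])
    have hb' : b ≠ 0 := by rintro rfl; exact hF0 (by rw [hab, mul_zero])
    have hb0 : eval 0 b ≠ 0 := by
      intro hb0
      apply hz'
      rw [hab, Derivation.leibniz, smul_eq_mul, smul_eq_mul, map_add, map_mul, map_mul, ha0, hb0]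
      ring
    have hadeg : a.totalDegree < d := by
      have h1 := totalDegree_mul_of_isDomain ha' hb'
      rw [← hab, hdeg] at h1
      have := one_le_tdeg hb' hb
      omega
    have hord : ∀ M, ordGE (dphi F) 0 M a := by
      intro M
      induction M with
      | zero => intro j hj; omega
      | succ M ih =>
        intro j hj
        rcases Nat.lt_succ_iff_lt_or_eq.1 hj with hj | rfl
        · exact ih j hj
        · have h1 := dl_mul ih b
          rw [← hab, (ordGE_of_const (dphi_self F) h0' : ordGE (dphi F) 0 (j+1) F) j (by omega)] at h1
          exact (mul_eq_zero.1 h1.symm).resolve_right hb0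
    have hex := expand_mz (d := d) (m := d) (u := a) (by
      intro v hv
      have h1 := le_totalDegree hv
      rw [Finsupp.sum_fintype _ _ (by simp), Fin.sum_univ_two] at h1
      omega)
    have := hM _ (by
      funext j
      rw [Mt_mulVec, hex]
      exact hord _ j j.2)
    apply ha'
    rw [← hex]
    refine Finset.sum_eq_zero (fun x _ => ?_)
    have h2 := congrFun this x
    simp only [Pi.zero_apply] at h2
    rw [h2, zero_smul]
  refine ⟨fun hu => ?_, fun a b hab => ?_⟩
  · have h1 := hu.map (eval (0 : Fin 2 → k))
    rw [h0'] at h1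
    exact not_isUnit_zero h1
  · by_contra hcon
    push Not at hcon
    have h1 : eval 0 a * eval 0 b = 0 := by rw [← map_mul, ← hab, h0']
    rcases mul_eq_zero.1 h1 with h | h
    · exact main a b hab hcon.1 hcon.2 h
    · exact main b a (by rw [hab, mul_comm]) hcon.2 hcon.1 h
end PartC

section PartC2

theorem subst_ne_zero {K : Type*} [Field K] [Algebra (Polynomial ℚ) K] [Algebra ℚ K]
    [IsScalarTower ℚ (Polynomial ℚ) K] [IsFractionRing (Polynomial ℚ) K]
    {r : MvPolynomial (Fin 2) ℚ} (hr : r ≠ 0) :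
    aeval (![X 0, C (algebraMap (Polynomial ℚ) K Polynomial.X) * X 0] :
      Fin 2 → MvPolynomial (Fin 1) K) r ≠ 0 := by
  intro h
  obtain ⟨v, hv⟩ : ∃ v : Fin 2 → ℚ, eval v (r * X 0) ≠ 0 := by
    by_contra hcon
    push Not at hcon
    have : r * X 0 = 0 := funext (by simpa using hcon)
    exact (mul_ne_zero hr (X_ne_zero 0)) this
  rw [map_mul, eval_X] at hv
  have hv0 := right_ne_zero_of_mul hv
  have hvr := left_ne_zero_of_mul hv
  let q : Polynomial ℚ := aeval ![Polynomial.C (v 0), Polynomial.X * Polynomial.C (v 0)] r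
  have hq : q ≠ 0 := by
    intro hq
    have h1 := congrArg (Polynomial.aeval (v 1 / v 0)) hq
    simp only [q] at h1
    rw [← AlgHom.comp_apply, comp_aeval, map_zero] at h1
    apply hvr
    rw [← h1, ← aeval_eq_eval]
    congr 2
    funext i
    fin_cases i
    · simp
    · simp; field_simp
  apply hq
  apply IsFractionRing.injective (Polynomial ℚ) K
  have h2 := congrArg (aeval (fun _ : Fin 1 => algebraMap ℚ K (v 0))) h
  rw [map_zero] at h2
  rw [map_zero, ← h2]
  change (IsScalarTower.toAlgHom ℚ (Polynomial ℚ) K) q =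
    ((aeval (fun _ : Fin 1 => algebraMap ℚ K (v 0)) : MvPolynomial (Fin 1) K →ₐ[K] K).restrictScalars ℚ) _
  simp only [q]
  rw [← AlgHom.comp_apply, comp_aeval, ← AlgHom.comp_apply, comp_aeval]
  congr 2
  funext i
  have hC : ∀ x : ℚ, algebraMap (Polynomial ℚ) K (Polynomial.C x) = algebraMap ℚ K x := by
    intro x; rw [IsScalarTower.algebraMap_apply ℚ (Polynomial ℚ) K]; rfl
  fin_cases i
  · simp [hC]
  · simp [hC]; exact mul_comm _ _

theorem unit_of_dvd_tail {K : Type*} [Field K] {n d : ℕ} {F w : MvPolynomial (Fin (n+1)) K}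
    {N : MvPolynomial (Fin n) K} (hd : F.totalDegree ≤ d) (hc : coeff (Finsupp.single 0 d) F ≠ 0)
    (hw1 : w ∣ F) (hN : N ≠ 0) (hwN : w ∣ rename Fin.succ N) : IsUnit w := by
  have h1 := map_dvd (finSuccEquiv K n) hwN
  rw [fse_rename] at h1
  have h2 : (finSuccEquiv K n w).natDegree = 0 := by
    have := Polynomial.natDegree_le_of_dvd h1 (Polynomial.C_ne_zero.2 hN)
    simpa using this
  rw [Polynomial.natDegree_eq_zero] at h2
  obtain ⟨w0, hw0⟩ := h2
  have h3 := map_dvd (finSuccEquiv K n) hw1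
  rw [← hw0, Polynomial.C_dvd_iff_dvd_coeff] at h3
  have h4 := h3 d
  rw [coeff_fse_top hd] at h4
  have h5 : IsUnit w0 := isUnit_of_dvd_unit h4 (IsUnit.map _ (isUnit_iff_ne_zero.2 hc))
  have h6 : IsUnit (finSuccEquiv K n w) := by rw [← hw0]; exact h5.map Polynomial.C
  exact (MulEquiv.isUnit_map (finSuccEquiv K n)).1 h6

section
variable {K : Type*} [Field K] [Algebra (Polynomial ℚ) K] [Algebra ℚ K]
    [IsScalarTower ℚ (Polynomial ℚ) K] [IsFractionRing (Polynomial ℚ) K]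

theorem aeval_sl {g : MvPolynomial (Fin 3) ℚ} (T : K) :
    aeval (![X 0, X 1, C T * X 1] : Fin 3 → MvPolynomial (Fin 2) K) g
      = sl T (map (algebraMap ℚ K) g) := by
  rw [sl, aeval_map_algebraMap]

theorem generic_relprime {d m : ℕ} {g : MvPolynomial (Fin 3) ℚ} (hg : Irreducible g)
    (hd : g.totalDegree ≤ d) (hc : coeff (Finsupp.single 0 d) g ≠ 0)
    (c : Fin d × Fin m → K) (hc0 : c ≠ 0) {w : MvPolynomial (Fin 2) K}
    (hw1 : w ∣ sl (algebraMap (Polynomial ℚ) K Polynomial.X) (map (algebraMap ℚ K) g))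
    (hw2 : w ∣ ∑ a, c a • mz K a) : IsUnit w := by
  classical
  set T := algebraMap (Polynomial ℚ) K Polynomial.X with hT
  have hC : ∀ x : ℚ, algebraMap (Polynomial ℚ) K (Polynomial.C x) = algebraMap ℚ K x := by
    intro x; rw [IsScalarTower.algebraMap_apply ℚ (Polynomial ℚ) K]; rfl
  obtain ⟨b, hb⟩ := IsLocalization.exist_integer_multiples_of_finite
    (nonZeroDivisors (Polynomial ℚ)) c
  choose q hq using hb
  let e := Finset.univ.sup (fun a => (q a).natDegree)
  let ψ : MvPolynomial (Fin 3) ℚ →ₐ[ℚ] MvPolynomial (Fin 2) K := aeval ![X 0, X 1, C T * X 1]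
  let U : MvPolynomial (Fin 3) ℚ := ∑ a : Fin d × Fin m, ∑ l ∈ Finset.range (e + 1),
    monomial (Finsupp.single 0 (a.1 : ℕ) + Finsupp.single 1 (a.2 + (e - l)) + Finsupp.single 2 l)
      ((q a).coeff l)
  set u := ∑ a, c a • mz K a with hu
  have hψU : ψ U = C (algebraMap _ K (b : Polynomial ℚ)) * X 1 ^ e * u := by
    simp only [U, map_sum, hu, Finset.mul_sum]
    refine Finset.sum_congr rfl (fun a _ => ?_)
    have h1 : ∀ l ∈ Finset.range (e + 1), ψ (monomial (Finsupp.single 0 (a.1 : ℕ) +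
        Finsupp.single 1 (a.2 + (e - l)) + Finsupp.single 2 l) ((q a).coeff l)) =
        C (algebraMap ℚ K ((q a).coeff l) * T ^ l) * (X 1 ^ e * mz K a) := by
      intro l hl
      have hl' : l ≤ e := by simpa [Nat.lt_succ_iff] using hl
      have h2 : (X 1 : MvPolynomial (Fin 2) K) ^ e = X 1 ^ (e - l) * X 1 ^ l := by
        rw [← pow_add]; congr 1; omega
      simp only [ψ, aeval_monomial]
      rw [Finsupp.prod_fintype _ _ (by simp), Fin.prod_univ_three]
      have h3 : mz K a = X 0 ^ (a.1 : ℕ) * X 1 ^ (a.2 : ℕ) := by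
        rw [mz, monomial_eq, Finsupp.prod_fintype _ _ (by simp), Fin.prod_univ_two]
        simp
      rw [h2, h3, IsScalarTower.algebraMap_apply ℚ K (MvPolynomial (Fin 2) K), algebraMap_eq]
      simp [pow_add, mul_pow]
      ring
    rw [Finset.sum_congr rfl h1, ← Finset.sum_mul, ← map_sum]
    have h4 : ∑ l ∈ Finset.range (e + 1), algebraMap ℚ K ((q a).coeff l) * T ^ l
        = algebraMap _ K (b : Polynomial ℚ) * c a := by
      have h5 := hq a
      rw [Algebra.smul_def] at h5
      rw [← h5]
      conv_rhs => rw [(q a).as_sum_range_C_mul_X_pow' (n := e + 1)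
        (Nat.lt_succ_iff.2 (Finset.le_sup (f := fun a => (q a).natDegree) (Finset.mem_univ a))), map_sum]
      refine Finset.sum_congr rfl (fun l _ => ?_)
      rw [map_mul, map_pow, hC]
    rw [h4, smul_eq_C_mul, C_mul]; ring
  have hb0 : algebraMap _ K (b : Polynomial ℚ) ≠ 0 :=
    (map_ne_zero_iff _ (IsFractionRing.injective (Polynomial ℚ) K)).2 (nonZeroDivisors.ne_zero b.2)
  have hu0 : u ≠ 0 := by
    intro h
    apply hc0
    funext a
    rw [← coeff_mz_sum c a, ← hu, h]; simp
  have hU0 : U ≠ 0 := by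
    intro h
    rw [h, map_zero] at hψU
    exact mul_ne_zero (mul_ne_zero ((C_ne_zero).2 hb0) (pow_ne_zero _ (X_ne_zero 1))) hu0 hψU.symm
  obtain ⟨a0, _⟩ := Function.ne_iff.1 hc0
  have hdpos : 0 < d := lt_of_le_of_lt (Nat.zero_le _) a0.1.2
  have hUd : degreeOf 0 U < d := by
    refine lt_of_le_of_lt (degreeOf_sum_le _ _ _) ?_
    rw [Finset.sup_lt_iff (by simpa using hdpos)]
    intro a _
    refine lt_of_le_of_lt (degreeOf_sum_le _ _ _) ?_
    rw [Finset.sup_lt_iff (by simpa using hdpos)]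
    intro l _
    by_cases h : (q a).coeff l = 0
    · simpa [h] using hdpos
    · rw [degreeOf_monomial_eq _ _ h]; simp
  obtain ⟨r, hr0, -, A, B, hAB⟩ := elim hg hd hc (not_dvd_of_degreeOf_lt hd hc hU0 hUd)
  have hN : ψ (rename Fin.succ r) = rename Fin.succ (aeval (![X 0, C T * X 0] :
      Fin 2 → MvPolynomial (Fin 1) K) r) := by
    simp only [ψ]
    rw [aeval_rename]
    change _ = ((rename Fin.succ : MvPolynomial (Fin 1) K →ₐ[K] MvPolynomial (Fin 2) K).restrictScalars ℚ) _
    rw [← AlgHom.comp_apply, comp_aeval]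
    congr 2
    funext i
    fin_cases i <;> simp
  have hψg : ψ g = sl T (map (algebraMap ℚ K) g) := aeval_sl T
  clear_value ψ U e
  have hwN : w ∣ ψ (rename Fin.succ r) := by
    rw [hAB, map_add, map_mul, map_mul, hψU, hψg]
    exact dvd_add (hw1.mul_left _) ((hw2.mul_left _).mul_left _)
  have hF := subst_ne_zero (K := K) hr0
  rw [hN] at hwN
  refine unit_of_dvd_tail ((tdeg_sl _ _).trans ((tdeg_map_le _ _).trans hd)) ?_ hw1 hF hwN
  rw [coeff_top_sl _ ((tdeg_map_le _ _).trans hd), coeff_map]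
  exact (map_ne_zero _).2 hc

theorem generic_inj {d : ℕ} (hd1 : 1 ≤ d) {g : MvPolynomial (Fin 3) ℚ} (hg : Irreducible g)
    (hd : g.totalDegree ≤ d) (hc : coeff (Finsupp.single 0 d) g ≠ 0) (h0 : eval 0 g = 0)
    (hz : eval 0 (pderiv 0 g) ≠ 0) (c : Fin d × Fin d → K)
    (h : (Mt d (map (algebraMap ℚ K) g) (algebraMap (Polynomial ℚ) K Polynomial.X)).mulVec c = 0) :
    c = 0 := by
  by_contra hc0
  set T := algebraMap (Polynomial ℚ) K Polynomial.X with hT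
  set F := sl T (map (algebraMap ℚ K) g) with hF
  have hdm : (map (algebraMap ℚ K) g).totalDegree ≤ d := (tdeg_map_le _ _).trans hd
  have hcm : coeff (Finsupp.single 0 d) F ≠ 0 := by
    rw [hF, coeff_top_sl _ hdm, coeff_map]; exact (map_ne_zero _).2 hc
  have hFd : F.totalDegree ≤ d := (tdeg_sl _ _).trans hdm
  have hF0 : F ≠ 0 := by intro h; rw [h] at hcm; simp at hcm
  have hv0 : (![(0 : Fin 2 → K) 0, (0 : Fin 2 → K) 1, T * (0 : Fin 2 → K) 1] : Fin 3 → K)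
      = algebraMap ℚ K ∘ (0 : Fin 3 → ℚ) := by
    funext i; fin_cases i <;> simp
  have h0' : eval 0 F = 0 := by
    rw [hF, eval_sl, hv0, eval_map, ← eval₂_comp, h0, map_zero]
  have hz' : eval 0 (pderiv 0 F) ≠ 0 := by
    rw [hF, pderiv_sl, eval_sl, hv0, pderiv_map, eval_map, ← eval₂_comp]
    exact (map_ne_zero _).2 hz
  have hdeg0 : ∀ a b, F = a * b → degreeOf 0 a < d → IsUnit a := by
    intro a b hab ha
    have ha0 : a ≠ 0 := by rintro rfl; exact hF0 (by rw [hab, zero_mul])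
    have hex := expand_mz (d := d) (m := degreeOf 1 a + 1) (u := a) (by
      intro v hv
      exact ⟨lt_of_le_of_lt (monomial_le_degreeOf 0 hv) ha,
        Nat.lt_succ_iff.2 (monomial_le_degreeOf 1 hv)⟩)
    refine generic_relprime hg hd hc _ ?_ (w := a) (K := K) ?_ (dvd_of_eq hex.symm)
    · intro h0
      apply ha0
      rw [← hex]
      refine Finset.sum_eq_zero (fun x _ => ?_)
      have h2 := congrFun h0 x
      simp only [Pi.zero_apply] at h2
      rw [h2, zero_smul]
    · rw [← hT, ← hF, hab]; exact dvd_mul_right _ _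
  have hirr : Irreducible F := by
    refine ⟨fun hu => ?_, fun a b hab => ?_⟩
    · have h1 := hu.map (eval (0 : Fin 2 → K))
      rw [h0'] at h1
      exact not_isUnit_zero h1
    · by_cases ha : degreeOf 0 a < d
      · exact Or.inl (hdeg0 a b hab ha)
      · right
        refine hdeg0 b a (by rw [hab, mul_comm]) ?_
        have ha0 : a ≠ 0 := by rintro rfl; exact hF0 (by rw [hab, zero_mul])
        have hb0 : b ≠ 0 := by rintro rfl; exact hF0 (by rw [hab, mul_zero])
        have h1 := natDegree_fse_eq hFd hcm
        rw [hab, map_mul, Polynomial.natDegree_mul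
          ((map_ne_zero_iff _ (finSuccEquiv K 1).injective).2 ha0)
          ((map_ne_zero_iff _ (finSuccEquiv K 1).injective).2 hb0), natDegree_finSuccEquiv,
          natDegree_finSuccEquiv] at h1
        omega
  have : CharZero K := algebraRat.charZero K
  have := bezout_mult hirr (dphi_self F) (fun h => hc0 (mz_not_dvd hFd hcm c h)) (2 * d * d + 1)
    (fun i _ => by exact_mod_cast Nat.factorial_ne_zero i) {0} (by simpa using h0')
    (by
      simp only [Finset.mem_singleton, forall_eq]
      rw [dphi_apply]
      simpa only [pderiv_X_self, mul_one, pderiv_X_of_ne (show (1 : Fin 2) ≠ 0 by decide),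
        mul_zero, sub_zero] using hz')
    (by
      simp only [Finset.mem_singleton, forall_eq]
      intro j hj
      have := congrFun h ⟨j, hj⟩
      rwa [Mt_mulVec] at this)
  have h2 : (∑ b, c b • mz K b).totalDegree ≤ d + d :=
    totalDegree_finsetSum_le (fun x _ => (totalDegree_smul_le _ _).trans (mz_deg _))
  have h3 := Nat.mul_le_mul hFd h2
  simp only [Finset.card_singleton] at this
  nlinarith
end
end PartC2

section PartC3

/-- generic polynomial -/
noncomputable def fU (d : ℕ) : MvPolynomial (Fin 3) (MvPolynomial ((Fin 3 →₀ ℕ) ⊕ Fin 4) ℤ) :=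
  ∑ α ∈ Finset.Iic (Finsupp.equivFunOnFinite.symm fun _ => d), monomial α (X (Sum.inl α))

/-- specialization -/
noncomputable def vU {R : Type*} [CommRing R] (f : MvPolynomial (Fin 3) ℤ) (P : Fin 3 → ℤ) (t : R) :
    (Fin 3 →₀ ℕ) ⊕ Fin 4 → R :=
  Sum.elim (fun α => ((coeff α f : ℤ) : R)) (Fin.snoc (fun i => (P i : R)) t)

noncomputable def eU {R : Type*} [CommRing R] (f : MvPolynomial (Fin 3) ℤ) (P : Fin 3 → ℤ) (t : R) :
    MvPolynomial ((Fin 3 →₀ ℕ) ⊕ Fin 4) ℤ →+* R := eval₂Hom (Int.castRingHom R) (vU f P t)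

theorem map_eU {R S : Type*} [CommRing R] [CommRing S] (φ : R →+* S) (f : MvPolynomial (Fin 3) ℤ)
    (P : Fin 3 → ℤ) (t : R) (Q : MvPolynomial ((Fin 3 →₀ ℕ) ⊕ Fin 4) ℤ) :
    φ (eU f P t Q) = eU f P (φ t) Q := by
  rw [← RingHom.comp_apply]
  congr 1
  refine ringHom_ext (fun r => by simp) (fun i => ?_)
  simp only [RingHom.comp_apply, eU, coe_eval₂Hom, eval₂_X]
  rcases i with α | i
  · simp [vU]
  · simp only [vU, Sum.elim_inr]
    refine Fin.lastCases ?_ (fun i => ?_) i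
    · rw [Fin.snoc_last, Fin.snoc_last]
    · rw [Fin.snoc_castSucc, Fin.snoc_castSucc]; simp

theorem deg_eU (Q : MvPolynomial ((Fin 3 →₀ ℕ) ⊕ Fin 4) ℤ) : ∃ N : ℕ, ∀ (f : MvPolynomial (Fin 3) ℤ)
    (P : Fin 3 → ℤ), (eU f P (Polynomial.X : Polynomial ℤ) Q).natDegree ≤ N := by
  induction Q using MvPolynomial.induction_on with
  | C a => exact ⟨0, fun f P => by simp [eU]⟩
  | add p q hp hq =>
    obtain ⟨N, hN⟩ := hp
    obtain ⟨N', hN'⟩ := hq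
    exact ⟨max N N', fun f P => by
      rw [map_add]; exact (Polynomial.natDegree_add_le _ _).trans (max_le_max (hN f P) (hN' f P))⟩
  | mul_X p i hp =>
    obtain ⟨N, hN⟩ := hp
    refine ⟨N + 1, fun f P => ?_⟩
    rw [map_mul]
    refine Polynomial.natDegree_mul_le.trans (Nat.add_le_add (hN f P) ?_)
    simp only [eU, coe_eval₂Hom, eval₂_X]
    rcases i with α | i
    · simp [vU]
    · simp only [vU, Sum.elim_inr]
      refine Fin.lastCases ?_ (fun i => ?_) i
      · rw [Fin.snoc_last]; exact Polynomial.natDegree_X_le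
      · rw [Fin.snoc_castSucc]; simp

theorem bd_eU (Q : MvPolynomial ((Fin 3 →₀ ℕ) ⊕ Fin 4) ℤ) : ∃ K : ℕ, ∀ (f : MvPolynomial (Fin 3) ℤ)
    (P : Fin 3 → ℤ) (t : ℤ) (H : ℕ), 1 ≤ H → (∀ α, |coeff α f| ≤ H) → (∀ i, |P i| ≤ H) → |t| ≤ H →
    |eU f P t Q| ≤ (K * H ^ K : ℕ) := by
  obtain ⟨K, hK⟩ := univ_bound Q
  refine ⟨K, fun f P t H hH h1 h2 h3 => ?_⟩
  have : eU f P t Q = eval (vU f P t) Q := by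
    rw [eU, eval, coe_eval₂Hom, coe_eval₂Hom]; congr 1
  rw [this]
  refine hK _ H hH (fun i => ?_)
  rcases i with α | i
  · simpa [vU] using h1 α
  · simp only [vU, Sum.elim_inr]
    refine Fin.lastCases ?_ (fun i => ?_) i
    · rw [Fin.snoc_last]; exact h3
    · rw [Fin.snoc_castSucc]; simpa using h2 i

noncomputable def AU (d : ℕ) (e : Fin d × Fin d → Fin (2 * d * d + 1)) :
    MvPolynomial ((Fin 3 →₀ ℕ) ⊕ Fin 4) ℤ :=
  X (Sum.inl (Finsupp.single 0 d)) *
    eval (fun i : Fin 3 => X (Sum.inr i.castSucc)) (pderiv 0 (fU d)) *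
    ((Mt d (tr (fun i : Fin 3 => X (Sum.inr i.castSucc)) (fU d)) (X (Sum.inr 3))).submatrix e id).det

theorem map_fU {R : Type*} [CommRing R] {d : ℕ} {f : MvPolynomial (Fin 3) ℤ}
    (hd : f.totalDegree ≤ d) (P : Fin 3 → ℤ) (t : R) :
    map (eU f P t) (fU d) = map (Int.castRingHom R) f := by
  classical
  conv_rhs => rw [f.as_sum]
  rw [fU, map_sum, map_sum]
  symm
  simp only [map_monomial]
  refine (Finset.sum_subset (fun v hv => ?_) (fun v _ hv => ?_)).trans (Finset.sum_congr rfl (fun v _ => ?_))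
  · rw [Finset.mem_Iic]
    intro i
    have h1 := monomial_le_degreeOf i hv
    exact h1.trans ((degreeOf_le_totalDegree _ _).trans hd)
  · rw [notMem_support_iff.1 hv]; simp
  · congr 1
    simp [vU, eU]

theorem aeval_AU {R : Type*} [CommRing R] {d : ℕ} {f : MvPolynomial (Fin 3) ℤ}
    (hd : f.totalDegree ≤ d) (P : Fin 3 → ℤ) (t : R) (e : Fin d × Fin d → Fin (2 * d * d + 1)) :
    eU f P t (AU d e) = ((coeff (Finsupp.single 0 d) f : ℤ) : R) * (eval P (pderiv 0 f) : ℤ) *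
      ((Mt d (tr (fun i => (P i : R)) (map (Int.castRingHom R) f)) t).submatrix e id).det := by
  have hm := map_fU hd P t
  set ρ := (eU f P t) with hρ
  have hρX : ∀ i, ρ (X i) = vU f P t i := fun i => by simp [hρ, eU]
  have hP : ∀ i : Fin 3, vU f P t (Sum.inr i.castSucc) = P i := by
    intro i; simp only [vU, Sum.elim_inr, Fin.snoc_castSucc]
  have ht : vU f P t (Sum.inr 3) = t := by
    simp only [vU, Sum.elim_inr]; exact Fin.snoc_last (α := fun _ => R) t (fun i => (P i : R))
  change ρ (AU d e) = _
  rw [AU, map_mul, map_mul, hρX, RingHom.map_det, RingHom.mapMatrix_apply, ← Matrix.submatrix_map,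
    map_Mt, map_tr, hm, hρX, ht]
  simp only [hρX, hP]
  congr 2
  rw [eval₂_comp, ← eval_map, ← pderiv_map, hm]
  have h3 : (⇑ρ ∘ fun i : Fin 3 => X (Sum.inr i.castSucc)) = Int.castRingHom R ∘ P := by
    funext i; simp only [Function.comp_apply, hρX, hP]; rfl
  rw [h3, pderiv_map, eval_map, ← eval₂_comp]; rfl

theorem AU_poly_ne {d : ℕ} (hd1 : 1 ≤ d) {f : MvPolynomial (Fin 3) ℤ}
    (hf : Irreducible (map (Int.castRingHom ℚ) f))
    (hd : f.totalDegree ≤ d) (hc : coeff (Finsupp.single 0 d) f ≠ 0) {P : Fin 3 → ℤ}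
    (h0 : eval P f = 0) (hz : eval P (pderiv 0 f) ≠ 0) :
    ∃ e, eU f P (Polynomial.X : Polynomial ℤ) (AU d e) ≠ 0 := by
  let K := FractionRing (Polynomial ℚ)
  let T := algebraMap (Polynomial ℚ) K Polynomial.X
  let g : MvPolynomial (Fin 3) ℚ := tr (fun i => (P i : ℚ)) (map (Int.castRingHom ℚ) f)
  have hdm : (map (Int.castRingHom ℚ) f).totalDegree ≤ d := (tdeg_map_le _ _).trans hd
  have hgd : g.totalDegree ≤ d := (tdeg_tr _ _).trans hdm
  have hgc : coeff (Finsupp.single 0 d) g ≠ 0 := by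
    simp only [g]; rw [coeff_top_tr _ hdm, coeff_map]; simpa using hc
  have hev : ∀ u : MvPolynomial (Fin 3) ℤ,
      eval 0 (tr (fun i => (P i : ℚ)) (map (Int.castRingHom ℚ) u)) = (eval P u : ℤ) := by
    intro u
    rw [eval_tr]
    have : (fun i => (0 : Fin 3 → ℚ) i + (P i : ℚ)) = Int.castRingHom ℚ ∘ P := by funext i; simp
    rw [this, eval_map, ← eval₂_comp]; rfl
  have hg0 : eval 0 g = 0 := by simp only [g]; rw [hev, h0]; simp
  have hgz : eval 0 (pderiv 0 g) ≠ 0 := by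
    simp only [g]; rw [pderiv_tr, pderiv_map, hev]; exact_mod_cast hz
  have hgi : Irreducible g := by
    let E : MvPolynomial (Fin 3) ℚ ≃ₐ[ℚ] MvPolynomial (Fin 3) ℚ := AlgEquiv.ofAlgHom
      (aeval (fun i => X i + C (P i : ℚ))) (aeval (fun i => X i - C (P i : ℚ)))
      (by ext i; simp) (by ext i; simp)
    exact (MulEquiv.irreducible_iff E).2 hf
  obtain ⟨e, -, he⟩ := exists_minor (Mt d (map (algebraMap ℚ K) g) T)
    (fun c h => generic_inj hd1 hgi hgd hgc hg0 hgz c h)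
  refine ⟨e, fun hcon => ?_⟩
  let σ : Polynomial ℤ →+* K := (algebraMap (Polynomial ℚ) K).comp (Polynomial.mapRingHom (Int.castRingHom ℚ))
  rw [aeval_AU hd] at hcon
  have h1 := congrArg σ hcon
  rw [map_mul, map_mul, map_zero, RingHom.map_det, RingHom.mapMatrix_apply, ← Matrix.submatrix_map,
    map_Mt, map_tr, map_map] at h1
  have h2 : σ Polynomial.X = T := by simp [σ, T]
  have h3 : map (algebraMap ℚ K) g = tr (fun i => σ ((P i : ℤ) : Polynomial ℤ))
      (map (σ.comp (Int.castRingHom (Polynomial ℤ))) f) := by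
    simp only [g]
    rw [map_tr, map_map]
    congr 1
    · funext i; simp
    · congr 1; congr 1; exact RingHom.ext_int _ _
  rw [h2, ← h3] at h1
  have : CharZero K := algebraRat.charZero K
  rcases mul_eq_zero.1 h1 with h | h
  · rcases mul_eq_zero.1 h with h | h
    · rw [map_intCast] at h; exact hc (by exact_mod_cast h)
    · rw [map_intCast] at h; exact hz (by exact_mod_cast h)
  · exact he h

theorem card_tails {n d : ℕ} {R : Type*} [CommRing R] [IsDomain R] {f : MvPolynomial (Fin (n+1)) R}
    (hd : f.totalDegree ≤ d) (hc : coeff (Finsupp.single 0 d) f ≠ 0) (W : Finset (Fin n → R))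
    (s : Finset (Fin (n+1) → R)) (hs : ∀ P ∈ s, eval P f = 0 ∧ Fin.tail P ∈ W) :
    s.card ≤ d * W.card := by
  classical
  refine Finset.card_le_mul_card_image_of_maps_to (f := Fin.tail) (fun P hP => (hs P hP).2) d ?_
  intro b _
  refine card_fiber hd hc b _ (fun P hP => ?_)
  rw [Finset.mem_filter] at hP
  exact ⟨(hs P hP.1).1, hP.2⟩

/-- counting on the good slices -/
theorem slice_count (p : ℕ) [Fact p.Prime] {d e N : ℕ} (hd1 : 1 ≤ d) (he : 2 ≤ e)
    (hp : d * (d + d * e * (e + 2 * d + d * e * d + 2) + 2) + 1 ≤ p)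
    {f : MvPolynomial (Fin 3) (ZMod p)} (hd : f.totalDegree ≤ d)
    (hc : coeff (Finsupp.single 0 d) f ≠ 0) (P : Fin 3 → ZMod p) (h0 : eval P f = 0)
    (hz : eval P (pderiv 0 f) ≠ 0) (bad : Finset (ZMod p)) (hb : bad.card ≤ N)
    (hM : ∀ t, t ∉ bad → ∀ c, (Mt d (tr P f) t).mulVec c = 0 → c = 0)
    (s : Finset (Fin 3 → ZMod p)) (hs : ∀ Q ∈ s, eval Q f = 0 ∧ eval Q (pderiv 0 f) ≠ 0) :
    (d * e - 1) * s.card ≤ p ^ 2 * (d * e + 1 + 2 * d ^ 2) + (d * e - 1) * (d + d * N) * p := by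
  classical
  let τ : (Fin 3 → ZMod p) → ZMod p := fun Q => (Q 2 - P 2) / (Q 1 - P 1)
  let s1 := s.filter (fun Q => Q 1 = P 1)
  let s2 := s.filter (fun Q => Q 1 ≠ P 1 ∧ τ Q ∈ bad)
  let s3 := s.filter (fun Q => Q 1 ≠ P 1 ∧ τ Q ∉ bad)
  have hcard : s.card ≤ s1.card + s2.card + s3.card := by
    have : s ⊆ (s1 ∪ s2) ∪ s3 := by
      intro Q hQ
      simp only [s1, s2, s3, Finset.mem_union, Finset.mem_filter]
      tauto
    exact (Finset.card_le_card this).trans ((Finset.card_union_le _ _).trans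
      (Nat.add_le_add_right (Finset.card_union_le _ _) _))
  have h1 : s1.card ≤ d * p := by
    let W : Finset (Fin 2 → ZMod p) := Finset.univ.image (fun y : ZMod p => ![P 1, y])
    have hW : W.card ≤ p := Finset.card_image_le.trans (by simp [ZMod.card])
    refine (card_tails hd hc W s1 (fun Q hQ => ?_)).trans (Nat.mul_le_mul_left _ hW)
    rw [Finset.mem_filter] at hQ
    refine ⟨(hs Q hQ.1).1, Finset.mem_image.2 ⟨Q 2, Finset.mem_univ _, ?_⟩⟩
    funext i; fin_cases i
    · simp [Fin.tail, hQ.2]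
    · simp [Fin.tail]
  have h2 : s2.card ≤ d * (N * p) := by
    let W : Finset (Fin 2 → ZMod p) := (bad ×ˢ Finset.univ).image
      (fun a : ZMod p × ZMod p => ![a.2, P 2 + a.1 * (a.2 - P 1)])
    have hW : W.card ≤ N * p := Finset.card_image_le.trans (by
      rw [Finset.card_product, Finset.card_univ, ZMod.card]; exact Nat.mul_le_mul_right _ hb)
    refine (card_tails hd hc W s2 (fun Q hQ => ?_)).trans (Nat.mul_le_mul_left _ hW)
    rw [Finset.mem_filter] at hQ
    refine ⟨(hs Q hQ.1).1, Finset.mem_image.2 ⟨(τ Q, Q 1), ?_, ?_⟩⟩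
    · simp [hQ.2.2]
    · have : Q 1 - P 1 ≠ 0 := sub_ne_zero.2 hQ.2.1
      funext i; fin_cases i
      · simp [Fin.tail]
      · simp only [Fin.tail, τ]; simp only [Fin.mk_one, Matrix.cons_val_one, Matrix.cons_val_fin_one]
        rw [div_mul_cancel₀ _ this, add_sub_cancel]; rfl
  have h3 : (d * e - 1) * s3.card ≤ p * (p * (d * e + 1 + 2 * d ^ 2)) := by
    rw [Finset.card_eq_sum_card_fiberwise (f := τ) (t := Finset.univ) (fun _ _ => Finset.mem_coe.2 (Finset.mem_univ _)),
      Finset.mul_sum]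
    refine (Finset.sum_le_card_nsmul _ _ (p * (d * e + 1 + 2 * d ^ 2)) (fun t _ => ?_)).trans_eq
      (by rw [Finset.card_univ, ZMod.card, smul_eq_mul])
    by_cases ht : t ∈ bad
    · have : s3.filter (fun Q => τ Q = t) = ∅ := by
        rw [Finset.filter_eq_empty_iff]
        intro Q hQ h
        rw [Finset.mem_filter] at hQ
        exact hQ.2.2 (h ▸ ht)
      rw [this]; simp
    have hgd := (tdeg_tr P f).trans hd
    have hgc : coeff (Finsupp.single 0 d) (tr P f) ≠ 0 := by rwa [coeff_top_tr _ hd]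
    have hev : ∀ u : MvPolynomial (Fin 3) (ZMod p), eval 0 (tr P u) = eval P u := by
      intro u; rw [eval_tr]; simp
    have hg0 : eval 0 (tr P f) = 0 := by rw [hev, h0]
    have hgz : eval 0 (pderiv 0 (tr P f)) ≠ 0 := by rwa [pderiv_tr, hev]
    have hirr := slice_irred hd1 hgd hgc hg0 hgz t (hM t ht)
    have hv0 : (![(0 : Fin 2 → ZMod p) 0, (0 : Fin 2 → ZMod p) 1, t * (0 : Fin 2 → ZMod p) 1] : Fin 3 → ZMod p) = 0 := by
      funext i; fin_cases i <;> simp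
    let π : (Fin 3 → ZMod p) → Fin 2 → ZMod p := fun Q => ![Q 0 - P 0, Q 1 - P 1]
    have hQf : ∀ Q ∈ s3.filter (fun Q => τ Q = t), Q 2 - P 2 = t * (Q 1 - P 1) := by
      intro Q hQ
      rw [Finset.mem_filter, Finset.mem_filter] at hQ
      have : Q 1 - P 1 ≠ 0 := sub_ne_zero.2 hQ.1.2.1
      rw [← hQ.2]; simp only [τ]; rw [div_mul_cancel₀ _ this]
    have hpt : ∀ Q ∈ s3.filter (fun Q => τ Q = t), ∀ u, eval (π Q) (sl t (tr P u)) = eval Q u := by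
      intro Q hQ u
      rw [eval_sl, eval_tr]
      congr 2
      funext i; fin_cases i
      · simp [π]
      · simp [π]
      · have := hQf Q hQ
        simp only [π]; simp [← this]
    have hinj : Set.InjOn π (s3.filter (fun Q => τ Q = t)) := by
      intro Q hQ Q' hQ' h
      have a0 := congrFun h 0
      have a1 := congrFun h 1
      simp [π] at a0 a1
      have a2 : Q 2 = Q' 2 := by linear_combination hQf Q hQ - hQf Q' hQ' + t * a1
      funext i; fin_cases i
      · exact a0
      · exact a1
      · exact a2
    rw [← Finset.card_image_of_injOn hinj]
    refine stepanov p hirr hd1 ((tdeg_sl t _).trans hgd) (by rwa [coeff_top_sl t hgd]) (P₀ := 0)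
      (by rw [eval_sl, hv0, hg0]) (by rw [pderiv_sl, eval_sl, hv0]; exact hgz) e he hp _ ?_
    intro R hR
    obtain ⟨Q, hQ, rfl⟩ := Finset.mem_image.1 hR
    rw [pderiv_sl, pderiv_tr, hpt Q hQ, hpt Q hQ]
    exact hs Q (Finset.filter_subset _ _ (Finset.filter_subset _ _ hQ))
  calc _ ≤ (d * e - 1) * (s1.card + s2.card) + (d * e - 1) * s3.card := by
        rw [← mul_add]; exact Nat.mul_le_mul_left _ hcard
    _ ≤ (d * e - 1) * (d * p + d * (N * p)) + p * (p * (d * e + 1 + 2 * d ^ 2)) :=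
        Nat.add_le_add (Nat.mul_le_mul_left _ (Nat.add_le_add h1 h2)) h3
    _ = _ := by ring

theorem goodprimes (d e : ℕ) (hd1 : 1 ≤ d) (he : 2 ≤ e) : ∃ K : ℕ, ∀ f : MvPolynomial (Fin 3) ℤ,
    f.totalDegree ≤ d → coeff (Finsupp.single 0 d) f ≠ 0 → Irreducible (map (Int.castRingHom ℚ) f) →
    ∀ P : Fin 3 → ℤ, eval P f = 0 → eval P (pderiv 0 f) ≠ 0 → ∀ H : ℕ, 1 ≤ H →
    (∀ α, |coeff α f| ≤ H) → (∀ i, |P i| ≤ H) → ∃ A : ℤ, A ≠ 0 ∧ |A| ≤ (K * H ^ K : ℕ) ∧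
    eval P (pderiv 0 f) ∣ A ∧
    ∀ p : ℕ, ∀ [Fact p.Prime], K ≤ p → ¬ (p : ℤ) ∣ A → ∀ s : Finset (Fin 3 → ZMod p),
    (∀ Q ∈ s, eval Q (map (Int.castRingHom (ZMod p)) f) = 0 ∧
      eval Q (pderiv 0 (map (Int.castRingHom (ZMod p)) f)) ≠ 0) →
    (d * e - 1) * s.card ≤ p ^ 2 * (d * e + 1 + 2 * d ^ 2) + K * p := by
  classical
  choose N hN using fun e' => deg_eU (AU d e')
  choose K1 hK1 using fun e' => bd_eU (AU d e')
  let J := ∑ e', (K1 e' + K1 e' * (N e' + 1) ^ (K1 e') + (d * e - 1) * (d + d * N e'))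
  refine ⟨J + (d * (d + d * e * (e + 2 * d + d * e * d + 2) + 2) + 1), ?_⟩
  intro f hd hc hirr P h0 hz H hH hfH hPH
  obtain ⟨e', he'⟩ := AU_poly_ne hd1 hirr hd hc h0 hz
  have hJ : K1 e' + K1 e' * (N e' + 1) ^ (K1 e') + (d * e - 1) * (d + d * N e') ≤ J :=
    Finset.single_le_sum (f := fun e' => K1 e' + K1 e' * (N e' + 1) ^ (K1 e') + (d * e - 1) * (d + d * N e'))
      (fun _ _ => Nat.zero_le _) (Finset.mem_univ e')
  obtain ⟨K, hK⟩ : ∃ K, K = J + (d * (d + d * e * (e + 2 * d + d * e * d + 2) + 2) + 1) := ⟨_, rfl⟩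
  rw [← hK]
  set Q := eU f P (Polynomial.X : Polynomial ℤ) (AU d e') with hQ
  have hQd : Q.natDegree ≤ N e' := hN e' f P
  obtain ⟨t0, ht0, ht0'⟩ : ∃ t0 ∈ (Finset.range (N e' + 1)).image (fun n : ℕ => (n : ℤ)), Q.eval t0 ≠ 0 := by
    by_contra hcon
    push Not at hcon
    refine he' (Polynomial.eq_zero_of_natDegree_lt_card_of_eval_eq_zero' Q _ hcon ?_)
    rw [Finset.card_image_of_injective _ Nat.cast_injective, Finset.card_range]; omega
  obtain ⟨n0, hn0, rfl⟩ := Finset.mem_image.1 ht0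
  rw [Finset.mem_range] at hn0
  have hev : ∀ {R : Type} [CommRing R] (t : R), (Q.map (Int.castRingHom R)).eval t = eU f P t (AU d e') := by
    intro R _ t
    rw [Polynomial.eval_map, ← Polynomial.coe_eval₂RingHom, hQ, map_eU]
    simp
  refine ⟨Q.eval (n0 : ℤ), ht0', ?_, ?_, ?_⟩
  · have h1 := hev (n0 : ℤ)
    rw [show Int.castRingHom ℤ = RingHom.id ℤ from rfl, Polynomial.map_id] at h1
    rw [h1]
    have hle : H ≤ (N e' + 1) * H := Nat.le_mul_of_pos_left _ (by omega)
    have hle' : (H : ℤ) ≤ ((N e' + 1) * H : ℕ) := by exact_mod_cast hle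
    refine (hK1 e' f P n0 ((N e' + 1) * H) (by omega) (fun α => (hfH α).trans hle')
      (fun i => (hPH i).trans hle') ?_).trans ?_
    · rw [Nat.abs_cast]; exact_mod_cast (show n0 ≤ (N e' + 1) * H by nlinarith)
    · rw [mul_pow, ← mul_assoc]
      have a1 : K1 e' * (N e' + 1) ^ K1 e' ≤ K := by rw [hK]; omega
      have a2 : H ^ K1 e' ≤ H ^ K := Nat.pow_le_pow_right hH (by rw [hK]; omega)
      exact_mod_cast Nat.mul_le_mul a1 a2
  · have h1 := hev (n0 : ℤ)
    rw [show Int.castRingHom ℤ = RingHom.id ℤ from rfl, Polynomial.map_id, aeval_AU hd] at h1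
    rw [h1]
    exact Dvd.dvd.mul_right (Dvd.intro_left _ rfl) _
  · intro p _ hKp hpA s hs
    have hpA' : (Q.map (Int.castRingHom (ZMod p))).eval ((n0 : ℤ) : ZMod p) ≠ 0 := by
      have h2 := (Polynomial.eval_map_apply (f := Int.castRingHom (ZMod p)) (p := Q) (n0 : ℤ))
      simp only [eq_intCast] at h2
      rw [h2]
      rwa [Ne, ZMod.intCast_zmod_eq_zero_iff_dvd]
    have hQ0 : Q.map (Int.castRingHom (ZMod p)) ≠ 0 := fun h => hpA' (by rw [h]; simp)
    have hP : (fun i => ((P i : ℤ) : ZMod p)) = Int.castRingHom (ZMod p) ∘ P := rfl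
    have hev2 : ∀ u : MvPolynomial (Fin 3) ℤ, eval (fun i => ((P i : ℤ) : ZMod p))
        (map (Int.castRingHom (ZMod p)) u) = (eval P u : ℤ) := by
      intro u; rw [hP, eval_map, ← eval₂_comp]; rfl
    have hA1 := hpA'
    rw [hev, aeval_AU hd] at hA1
    have hc' := left_ne_zero_of_mul (left_ne_zero_of_mul hA1)
    have hz' := right_ne_zero_of_mul (left_ne_zero_of_mul hA1)
    have hmain := slice_count p (N := N e') hd1 he (by omega) (f := map (Int.castRingHom (ZMod p)) f)
      ((tdeg_map_le _ _).trans hd) (by rw [coeff_map]; exact hc') (fun i => ((P i : ℤ) : ZMod p))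
      (by rw [hev2, h0]; simp) (by rw [pderiv_map, hev2]; exact hz')
      (Q.map (Int.castRingHom (ZMod p))).roots.toFinset
      ((Multiset.toFinset_card_le _).trans ((Polynomial.card_roots' _).trans
        (Polynomial.natDegree_map_le.trans hQd))) ?_ s hs
    · refine hmain.trans (Nat.add_le_add_left (Nat.mul_le_mul_right _ ?_) _)
      rw [hK]; omega
    · intro t ht c hcM
      have ht2 : (Q.map (Int.castRingHom (ZMod p))).eval t ≠ 0 := by
        intro h; exact ht (Multiset.mem_toFinset.2 ((Polynomial.mem_roots hQ0).2 h))
      rw [hev, aeval_AU hd] at ht2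
      refine Matrix.eq_zero_of_mulVec_eq_zero (right_ne_zero_of_mul ht2) ?_
      funext k
      exact congrFun hcM (e' k)

end PartC3

section PartE

theorem sum_log_le (W : Finset ℕ) (hW : ∀ p ∈ W, p.Prime) (E : ℕ → ℕ) (Δ : ℤ) (hΔ : Δ ≠ 0)
    (h : ∀ p ∈ W, (p : ℤ) ^ E p ∣ Δ) : ∑ p ∈ W, (E p : ℝ) * Real.log p ≤ Real.log |(Δ : ℝ)| := by
  have h1 : (∏ p ∈ W, p ^ E p) ∣ Δ.natAbs := by
    refine Finset.prod_dvd_of_isRelPrime (fun p hp q hq hpq => ?_) (fun p hp => ?_)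
    · rw [Function.onFun, ← Nat.coprime_iff_isRelPrime]
      exact Nat.Coprime.pow _ _ ((Nat.coprime_primes (hW p hp) (hW q hq)).2 hpq)
    · have := Int.natAbs_dvd_natAbs.2 (h p hp)
      rwa [Int.natAbs_pow, Int.natAbs_natCast] at this
  have h2 := Nat.le_of_dvd (Int.natAbs_pos.2 hΔ) h1
  have h3 : ((∏ p ∈ W, p ^ E p : ℕ) : ℝ) ≤ |(Δ : ℝ)| := by
    rw [← Int.cast_abs, Int.abs_eq_natAbs]; exact_mod_cast h2
  have hpos : (0 : ℝ) < ((∏ p ∈ W, p ^ E p : ℕ) : ℝ) := by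
    exact_mod_cast Finset.prod_pos (fun p hp => pow_pos (hW p hp).pos _)
  refine le_trans (le_of_eq ?_) (Real.log_le_log hpos h3)
  push_cast
  rw [Real.log_prod (fun p hp => pow_ne_zero _ (by exact_mod_cast (hW p hp).ne_zero))]
  exact Finset.sum_congr rfl (fun p _ => by rw [Real.log_pow])

theorem sum_div_le (W : Finset ℕ) (hW : ∀ p ∈ W, p.Prime) (Y : ℝ) (hY : 0 < Y) (hWY : ∀ p ∈ W, Y ≤ p)
    (Δ : ℤ) (hΔ : Δ ≠ 0) (h : ∀ p ∈ W, (p : ℤ) ∣ Δ) :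
    ∑ p ∈ W, Real.log p / p ≤ Real.log |(Δ : ℝ)| / Y := by
  have h1 := sum_log_le W hW (fun _ => 1) Δ hΔ (by simpa using h)
  simp only [Nat.cast_one, one_mul] at h1
  refine le_trans ?_ (div_le_div_of_nonneg_right h1 hY.le)
  rw [Finset.sum_div]
  refine Finset.sum_le_sum (fun p hp => ?_)
  exact div_le_div_of_nonneg_left (Real.log_natCast_nonneg p) hY (hWY p hp)

theorem mertens : ∃ C : ℝ, 0 ≤ C ∧ ∀ n : ℕ, 1 ≤ n →
    Real.log n - C ≤ ∑ p ∈ n.primesLE, Real.log p / p := by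
  have hsum : Summable (fun n : ℕ => 4 * (1 / (n : ℝ) ^ (3 / 2 : ℝ))) :=
    (Real.summable_one_div_nat_rpow.2 (by norm_num)).mul_left 4
  refine ⟨1 + ∑' n : ℕ, 4 * (1 / (n : ℝ) ^ (3 / 2 : ℝ)), ?_, ?_⟩
  · have : 0 ≤ ∑' n : ℕ, 4 * (1 / (n : ℝ) ^ (3 / 2 : ℝ)) := tsum_nonneg (fun n => by positivity)
    linarith
  intro n hn
  have hn0 : (0 : ℝ) < n := by exact_mod_cast hn
  have hfac : Real.log (n.factorial) ≤ ∑ p ∈ n.primesLE, (n : ℝ) * (Real.log p / p + 4 * (1 / (p : ℝ) ^ (3 / 2 : ℝ))) := by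
    have h1 : (n.factorial : ℝ) = ∏ p ∈ n.primesLE, (p : ℝ) ^ (n.factorial.factorization p) := by
      have h2 := Nat.prod_factorization_pow_eq_self (Nat.factorial_ne_zero n)
      rw [Finsupp.prod_of_support_subset (s := n.primesLE) _ _ _ (by simp)] at h2
      · conv_lhs => rw [← h2]
        push_cast; rfl
      · intro p hp
        rw [Nat.support_factorization, Nat.mem_primeFactors] at hp
        rw [Nat.mem_primesLE]
        exact ⟨(hp.1.dvd_factorial).1 hp.2.1, hp.1⟩
    rw [h1, Real.log_prod]
    · refine Finset.sum_le_sum (fun p hp => ?_)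
      rw [Nat.mem_primesLE] at hp
      have : Fact p.Prime := ⟨hp.2⟩
      have hp2 : (2 : ℝ) ≤ p := by exact_mod_cast hp.2.two_le
      have h3 := sub_one_mul_padicValNat_factorial (p := p) n
      have h4 : ((p : ℝ) - 1) * (n.factorial.factorization p) ≤ n := by
        rw [Nat.factorization_def _ hp.2]
        have h5 : (p - 1) * padicValNat p n.factorial ≤ n := by rw [h3]; exact Nat.sub_le _ _
        have h6 : (((p - 1 : ℕ) : ℝ)) * padicValNat p n.factorial ≤ n := by exact_mod_cast h5
        rwa [Nat.cast_sub hp.2.one_le, Nat.cast_one] at h6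
      rw [Real.log_pow]
      have hlog : Real.log p ≤ 2 * (p : ℝ) ^ (1 / 2 : ℝ) := by
        have := Real.log_le_rpow_div (x := p) (by positivity) (ε := 1 / 2) (by norm_num)
        linarith
      have hl0 : 0 ≤ Real.log p := Real.log_natCast_nonneg p
      have e1 : (p : ℝ) ^ (3 / 2 : ℝ) = p * (p : ℝ) ^ (1 / 2 : ℝ) := by
        rw [show (3 / 2 : ℝ) = 1 + 1 / 2 by norm_num, Real.rpow_add (by positivity), Real.rpow_one]
      have e2 : (p : ℝ) ^ (1 / 2 : ℝ) * (p : ℝ) ^ (1 / 2 : ℝ) = p := by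
        rw [← Real.rpow_add (by positivity)]; norm_num
      set r := (p : ℝ) ^ (1 / 2 : ℝ)
      have hr : 0 < r := by positivity
      have hv : (n.factorial.factorization p : ℝ) ≤ n / ((p : ℝ) - 1) := by
        rw [le_div_iff₀ (by linarith)]; linarith
      have key : Real.log p / ((p : ℝ) - 1) ≤ Real.log p / p + 4 * (1 / (p * r)) := by
        have e3 : Real.log p / ((p : ℝ) - 1) - Real.log p / p = Real.log p / (p * (p - 1)) := by
          have : (p : ℝ) - 1 ≠ 0 := by linarith
          field_simp; ring
        have e4 : Real.log p / (p * (p - 1)) ≤ 4 * (1 / (p * r)) := by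
          rw [mul_one_div, div_le_div_iff₀ (by nlinarith) (by positivity)]
          nlinarith [mul_le_mul_of_nonneg_right hlog (show 0 ≤ (p : ℝ) * r by positivity)]
        linarith
      rw [e1]
      calc _ ≤ n / ((p : ℝ) - 1) * Real.log p := mul_le_mul_of_nonneg_right hv hl0
        _ = n * (Real.log p / ((p : ℝ) - 1)) := by ring
        _ ≤ _ := mul_le_mul_of_nonneg_left key hn0.le
    · intro p hp
      rw [Nat.mem_primesLE] at hp
      exact pow_ne_zero _ (by exact_mod_cast hp.2.ne_zero)
  have hst : n * Real.log n - n ≤ Real.log n.factorial := by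
    have h1 := Real.pow_div_factorial_le_exp (n : ℝ) hn0.le n
    have h2 := Real.log_le_log (by positivity) h1
    rw [Real.log_exp, Real.log_div (by positivity) (by positivity), Real.log_pow] at h2
    linarith
  have h3 := hst.trans hfac
  rw [← Finset.mul_sum, Finset.sum_add_distrib] at h3
  have h4 : ∑ p ∈ n.primesLE, 4 * (1 / (p : ℝ) ^ (3 / 2 : ℝ)) ≤ ∑' n : ℕ, 4 * (1 / (n : ℝ) ^ (3 / 2 : ℝ)) :=
    hsum.sum_le_tsum _ (fun n _ => by positivity)
  have h5 : n * (Real.log n - 1) ≤ n * (∑ p ∈ n.primesLE, Real.log p / p + ∑ p ∈ n.primesLE, 4 * (1 / (p : ℝ) ^ (3 / 2 : ℝ))) := by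
    linarith
  have h6 := le_of_mul_le_mul_left h5 hn0
  linarith

theorem abs_eval_monomial_le {n : ℕ} (α : Fin n →₀ ℕ) (P : Fin n → ℤ) (B : ℕ) (hP : ∀ i, |P i| ≤ B) :
    |eval P (monomial α (1 : ℤ))| ≤ (B : ℤ) ^ α.degree := by
  rw [eval_monomial, one_mul, Finsupp.prod_fintype _ _ (by simp), Finset.abs_prod,
    Finsupp.degree_eq_sum, ← Finset.prod_pow_eq_pow_sum]
  refine Finset.prod_le_prod (fun _ _ => abs_nonneg _) (fun i _ => ?_)
  rw [abs_pow]
  exact pow_le_pow_left₀ (abs_nonneg _) (hP i) _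

theorem det_le {n : ℕ} {ι : Type*} [Fintype ι] [DecidableEq ι] (ε : ι → (Fin n →₀ ℕ))
    (pts : ι → Fin n → ℤ) (B : ℕ) (hP : ∀ j i, |pts j i| ≤ B) :
    |(Matrix.of fun i j => eval (pts i) (monomial (ε j) (1 : ℤ))).det| ≤
      ((Fintype.card ι).factorial * B ^ (∑ j, (ε j).degree) : ℕ) := by
  rw [Matrix.det_apply]
  refine (Finset.abs_sum_le_sum_abs _ _).trans ?_
  have : ∀ σ ∈ (Finset.univ : Finset (Equiv.Perm ι)), |Equiv.Perm.sign σ • ∏ i, (Matrix.of fun i j => eval (pts i) (monomial (ε j) (1 : ℤ))) (σ i) i| ≤ (B : ℤ) ^ (∑ j, (ε j).degree) := by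
    intro σ _
    have : |Equiv.Perm.sign σ • ∏ i, (Matrix.of fun i j => eval (pts i) (monomial (ε j) (1 : ℤ))) (σ i) i|
        = |∏ i, (Matrix.of fun i j => eval (pts i) (monomial (ε j) (1 : ℤ))) (σ i) i| := by
      rcases Int.units_eq_one_or (Equiv.Perm.sign σ) with h | h <;> simp [h]
    rw [this, Finset.abs_prod, ← Finset.prod_pow_eq_pow_sum]
    refine Finset.prod_le_prod (fun _ _ => abs_nonneg _) (fun i _ => ?_)
    exact abs_eval_monomial_le _ _ B (hP _)
  refine (Finset.sum_le_card_nsmul _ _ _ this).trans_eq ?_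
  rw [Finset.card_univ, Fintype.card_perm]; simp

/-- either a polynomial with prescribed monomials vanishes on `S` or there is a nonzero determinant -/
theorem interp {n : ℕ} {ι : Type*} [Fintype ι] [DecidableEq ι] (ε : ι → (Fin n →₀ ℕ))
    (hε : Function.Injective ε) (S : Finset (Fin n → ℤ)) :
    (∃ c : ι → ℚ, c ≠ 0 ∧ ∀ P ∈ S, eval (fun i => (P i : ℚ)) (∑ j, monomial (ε j) (c j)) = 0) ∨
    ∃ pts : ι → Fin n → ℤ, Function.Injective pts ∧ (∀ i, pts i ∈ S) ∧
      (Matrix.of fun i j => eval (pts i) (monomial (ε j) (1 : ℤ))).det ≠ 0 := by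
  classical
  have hcast : ∀ (P : Fin n → ℤ) α, eval (fun i => (P i : ℚ)) (monomial α (1 : ℚ)) = (eval P (monomial α (1 : ℤ)) : ℤ) := by
    intro P α
    rw [eval_monomial, eval_monomial]
    simp [Finsupp.prod]
  let M : Matrix S ι ℚ := Matrix.of fun P j => eval (fun i => ((P : Fin n → ℤ) i : ℚ)) (monomial (ε j) (1 : ℚ))
  by_cases hM : ∀ c, M.mulVec c = 0 → c = 0
  · right
    obtain ⟨e, he, hdet⟩ := exists_minor M hM
    refine ⟨fun i => e i, fun i j h => he (Subtype.ext h), fun i => (e i).2, fun h => hdet ?_⟩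
    have := congrArg (Int.castRingHom ℚ) h
    rw [RingHom.map_det, map_zero] at this
    rw [← this]
    congr 1
    ext i j
    simp [M, hcast]
  · left
    push Not at hM
    obtain ⟨c, hc, hc0⟩ := hM
    refine ⟨c, hc0, fun P hP => ?_⟩
    have := congrFun hc ⟨P, hP⟩
    simp only [Matrix.mulVec, dotProduct, M, Matrix.of_apply, Pi.zero_apply] at this
    rw [map_sum, ← this]
    refine Finset.sum_congr rfl (fun j _ => ?_)
    rw [eval_monomial, eval_monomial]; ring

end PartE

section PartE2

/-- index type of the monomials `z^i x^a y^b` with `i < d`, `a + b ≤ D` -/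
abbrev IX (d D : ℕ) := Fin d × (Σ m : Fin (D + 1), Fin ((m : ℕ) + 1))

noncomputable def eps {d D : ℕ} (j : IX d D) : Fin 3 →₀ ℕ :=
  Finsupp.equivFunOnFinite.symm ![(j.1 : ℕ), (j.2.2 : ℕ), (j.2.1 : ℕ) - (j.2.2 : ℕ)]

theorem eps_inj {d D : ℕ} : Function.Injective (eps (d := d) (D := D)) := by
  rintro ⟨i, m, a⟩ ⟨i', m', a'⟩ h
  have h0 := DFunLike.congr_fun h 0
  have h1 := DFunLike.congr_fun h 1
  have h2 := DFunLike.congr_fun h 2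
  simp [eps] at h0 h1 h2
  have ha := a.2
  have ha' := a'.2
  have hm : m = m' := Fin.ext (by omega)
  subst hm
  have hi : i = i' := Fin.ext h0
  have haa : a = a' := Fin.ext h1
  rw [hi, haa]

theorem eps_deg {d D : ℕ} (j : IX d D) : (eps j).degree = j.1 + j.2.1 := by
  have := j.2.2.2
  rw [Finsupp.degree_eq_sum, Fin.sum_univ_three]
  simp [eps]; omega

theorem card_IX (d D : ℕ) : 2 * Fintype.card (IX d D) = d * ((D + 1) * (D + 2)) := by
  rw [Fintype.card_prod, Fintype.card_fin, Fintype.card_sigma]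
  simp only [Fintype.card_fin]
  rw [Fin.sum_univ_eq_sum_range (fun m => m + 1) (D + 1), Finset.sum_range_succ_comm]
  have : ∀ D : ℕ, 2 * (D + 1 + ∑ m ∈ Finset.range D, (m + 1)) = (D + 1) * (D + 2) := by
    intro D
    induction D with
    | zero => simp
    | succ D ih => rw [Finset.sum_range_succ]; linarith
  rw [← this]; ring

theorem sum_eps (d D : ℕ) : 6 * ∑ j : IX d D, (eps j).degree ≤
    2 * d * (D * (D + 1) * (D + 2)) + 3 * d ^ 2 * ((D + 1) * (D + 2)) := by
  have h1 : ∑ j : IX d D, (eps j).degree ≤ ∑ j : IX d D, (d + j.2.1) :=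
    Finset.sum_le_sum (fun j _ => by rw [eps_deg]; have := j.1.2; omega)
  have h2 : ∑ j : IX d D, (d + (j.2.1 : ℕ)) = d * ∑ m ∈ Finset.range (D + 1), (m + 1) * (d + m) := by
    rw [Fintype.sum_prod_type]
    simp only [Finset.sum_const, Finset.card_univ, Fintype.card_fin, smul_eq_mul]
    rw [Fintype.sum_sigma, ← Fin.sum_univ_eq_sum_range (fun m => (m + 1) * (d + m)) (D + 1)]
    simp
  have h3 : ∀ D : ℕ, 6 * ∑ m ∈ Finset.range (D + 1), (m + 1) * (d + m) =
      2 * (D * (D + 1) * (D + 2)) + 3 * d * ((D + 1) * (D + 2)) := by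
    intro D
    induction D with
    | zero => simp; ring
    | succ D ih => rw [Finset.sum_range_succ, mul_add, ih]; ring
  rw [h2] at h1
  calc _ ≤ 6 * (d * ∑ m ∈ Finset.range (D + 1), (m + 1) * (d + m)) := Nat.mul_le_mul_left _ h1
    _ = d * (6 * ∑ m ∈ Finset.range (D + 1), (m + 1) * (d + m)) := by ring
    _ = _ := by rw [h3]; ring

theorem poly_eps {d D : ℕ} (c : IX d D → ℚ) (hc : c ≠ 0) :
    (∑ j, monomial (eps j) (c j)) ≠ 0 ∧ (∑ j, monomial (eps j) (c j)).totalDegree ≤ D + d ∧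
    degreeOf 0 (∑ j, monomial (eps j) (c j)) < d := by
  classical
  obtain ⟨j0, hj0⟩ := Function.ne_iff.1 hc
  have hsup : ∀ v ∈ (∑ j, monomial (eps j) (c j)).support, ∃ j : IX d D, v = eps j := by
    intro v hv
    rw [mem_support_iff, coeff_sum] at hv
    obtain ⟨j, _, hj⟩ := Finset.exists_ne_zero_of_sum_ne_zero hv
    rw [coeff_monomial] at hj
    by_contra hcon
    push Not at hcon
    rw [if_neg (fun h => hcon j h.symm)] at hj
    exact hj rfl
  refine ⟨fun h => hj0 ?_, ?_, ?_⟩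
  · have h1 := congrArg (coeff (eps j0)) h
    rw [coeff_sum, Finset.sum_eq_single j0] at h1
    · simpa using h1
    · intro j _ hj
      rw [coeff_monomial, if_neg (fun h => hj (eps_inj h))]
    · simp
  · refine Finset.sup_le (fun v hv => ?_)
    obtain ⟨j, rfl⟩ := hsup v hv
    change (eps j).degree ≤ _
    rw [eps_deg]
    have := j.1.2; have := j.2.1.2; omega
  · have hd0 : 0 < d := by have := j0.1.2; omega
    rw [degreeOf_lt_iff hd0]
    intro v hv
    obtain ⟨j, rfl⟩ := hsup v hv
    simp [eps]

/-- real estimate for primes not dividing q -/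
theorem est_P {d D p s N k T sing η : ℝ} (hd : 0 ≤ d) (hD : 1 ≤ D) (hp : 1 ≤ p) (hpD : p ≤ 2 * D) (hη : 0 ≤ η) (hη2 : η ≤ 1 / 2)
    (hs : 2 * s = d * ((D + 1) * (D + 2))) (hN0 : 0 ≤ N) (hN : N ≤ (1 + 2 * η) * p ^ 2) (hk0 : 0 ≤ k)
    (hk : k * p ≤ 2 * D) (hk' : 2 * D ≤ (k + 1) * p) (hT : 6 * T ≤ k * (k + 1) * (k + 2)) (hsing : 0 ≤ sing) :
    (d - 4 / 3 - 3 * η) * D ^ 3 / p - (3 * d + 8) * D ^ 2 - 2 * D * (sing / p) ≤ (s - sing) * k - N * T := by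
  set u := 2 * D / p with hu
  have hp0 : 0 < p := by linarith
  have hup : u * p = 2 * D := by rw [hu]; field_simp
  have hku : k ≤ u := by rw [hu, le_div_iff₀ hp0]; exact hk
  have huk : u ≤ k + 1 := by rw [hu, div_le_iff₀ hp0]; exact hk'
  have hu1 : 1 ≤ u := by rw [hu, le_div_iff₀ hp0]; linarith
  have hs0 : 0 ≤ s := by nlinarith [mul_nonneg hd (show 0 ≤ (D+1)*(D+2) by positivity)]
  have hT2 : 6 * T ≤ u ^ 3 + 5 * u ^ 2 := by
    have h1 : k * (k + 1) * (k + 2) ≤ u * (u + 1) * (u + 2) := by gcongr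
    nlinarith
  have hNT : N * T ≤ (1 + 2 * η) * p ^ 2 * ((u ^ 3 + 5 * u ^ 2) / 6) := by
    have h0 : N * T ≤ N * ((u ^ 3 + 5 * u ^ 2) / 6) := mul_le_mul_of_nonneg_left (by linarith) hN0
    exact h0.trans (mul_le_mul_of_nonneg_right hN (by positivity))
  have e1 : p ^ 2 * ((u ^ 3 + 5 * u ^ 2) / 6) = 4 / 3 * (D ^ 3 / p) + 10 / 3 * D ^ 2 := by
    rw [hu]; field_simp; ring
  have hsk : d * (D ^ 3 / p) - 3 * d * D ^ 2 ≤ s * k := by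
    have h1 : s * (u - 1) ≤ s * k := mul_le_mul_of_nonneg_left (by linarith) hs0
    have h2 : d * D ^ 2 ≤ 2 * s := by rw [hs]; exact mul_le_mul_of_nonneg_left (by nlinarith) hd
    have h3 : s ≤ 3 * d * D ^ 2 := by
      have : d * ((D + 1) * (D + 2)) ≤ d * (6 * D ^ 2) := mul_le_mul_of_nonneg_left (by nlinarith) hd
      linarith
    have h4 : d * (D ^ 3 / p) ≤ s * u := by
      have : d * (D ^ 3 / p) = d * D ^ 2 * (D / p) := by field_simp
      rw [this]
      have e5 : s * u = 2 * s * (D / p) := by rw [hu]; ring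
      rw [e5]
      exact mul_le_mul_of_nonneg_right h2 (by positivity)
    nlinarith
  have hsingk : sing * k ≤ 2 * D * (sing / p) := by
    have : sing * k ≤ sing * u := mul_le_mul_of_nonneg_left hku hsing
    rw [hu] at this
    calc _ ≤ _ := this
      _ = _ := by ring
  have hX : 0 ≤ D ^ 3 / p := by positivity
  have e6 : (d - 4 / 3 - 3 * η) * D ^ 3 / p = (d - 4 / 3 - 3 * η) * (D ^ 3 / p) := by ring
  rw [e6]
  set W := D ^ 3 / p
  have h7 : N * T ≤ (1 + 2 * η) * (4 / 3 * W + 10 / 3 * D ^ 2) := by rw [← e1]; linarith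
  have h8 : η * D ^ 2 ≤ 1 / 2 * D ^ 2 := mul_le_mul_of_nonneg_right hη2 (by positivity)
  have h9 : 0 ≤ η * W := by positivity
  have e7 : (1 + 2 * η) * (4 / 3 * W + 10 / 3 * D ^ 2) = 4 / 3 * W + 10 / 3 * D ^ 2 + 8 / 3 * (η * W) + 20 / 3 * (η * D ^ 2) := by ring
  have e8 : (d - 4 / 3 - 3 * η) * W = d * W - 4 / 3 * W - 3 * (η * W) := by ring
  have e9 : (s - sing) * k = s * k - sing * k := by ring
  rw [e7] at h7
  rw [e8, e9]
  have : 0 ≤ D ^ 2 := by positivity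
  linarith

theorem est_Q {d D s T η : ℝ} (hd : 0 ≤ d) (hD : 1 ≤ D) (hη : 0 ≤ η) (hDη : 1 ≤ η * D)
    (hs : 2 * s = d * ((D + 1) * (D + 2))) (hT : 6 * T ≤ 2 * D * (2 * D + 1) * (2 * D + 2)) :
    (d - 4 / 3 - 3 * η) * D ^ 3 ≤ s * (2 * D) - T := by
  have h1 : d * D ^ 2 ≤ 2 * s := by rw [hs]; exact mul_le_mul_of_nonneg_left (by nlinarith) hd
  have h2 : d * D ^ 3 ≤ s * (2 * D) := by nlinarith
  have h3 : D ^ 2 ≤ η * D ^ 3 := by nlinarith [sq_nonneg D]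
  nlinarith

end PartE2

section PartE3

theorem theta_bound (D : ℕ) (W : Finset ℕ) (hW : ∀ p ∈ W, p.Prime ∧ p ≤ 2 * D) :
    ∑ p ∈ W, Real.log p ≤ 3 * D := by
  have h1 : ∑ p ∈ W, Real.log p ≤ Chebyshev.theta ((2 * D : ℕ) : ℝ) := by
    rw [Chebyshev.theta_eq_sum_primesLE_log]
    refine Finset.sum_le_sum_of_subset_of_nonneg (fun p hp => ?_) (fun p _ _ => Real.log_natCast_nonneg p)
    rw [Nat.mem_primesLE]; exact ⟨(hW p hp).2, (hW p hp).1⟩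
  have h2 := Chebyshev.theta_le_log4_mul_x (x := ((2 * D : ℕ) : ℝ)) (by positivity)
  have h3 : Real.log 4 ≤ 3 / 2 := by
    rw [show (4 : ℝ) = 2 ^ 2 by norm_num, Real.log_pow]
    have := Real.log_two_lt_d9
    push_cast; linarith
  have h4 : Real.log 4 * ((2 * D : ℕ) : ℝ) ≤ 3 / 2 * ((2 * D : ℕ) : ℝ) :=
    mul_le_mul_of_nonneg_right h3 (by positivity)
  push_cast at *; linarith

theorem log_det_le {d D B : ℕ} (hd1 : 1 ≤ d) (hD : 1 ≤ D) (hB : 1 ≤ B) {η : ℝ} (hη : 0 < η) (hDη : 6 + 9 * d ≤ η * D)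
    (Δ : ℤ) (hΔ0 : Δ ≠ 0)
    (hΔ : |Δ| ≤ ((Fintype.card (IX d D)).factorial * B ^ (∑ j : IX d D, (eps j).degree) : ℕ)) :
    Real.log |(Δ : ℝ)| ≤ D ^ 3 * (3 * d * (3 * d + 2) + d / 3 * (1 + η) * Real.log B) := by
  set s := Fintype.card (IX d D) with hs
  set m := ∑ j : IX d D, (eps j).degree with hm
  have hs2 := card_IX d D
  have hm2 := sum_eps d D
  rw [← hs] at hs2
  rw [← hm] at hm2
  have hD' : (1 : ℝ) ≤ D := by exact_mod_cast hD
  have hd' : (1 : ℝ) ≤ d := by exact_mod_cast hd1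
  have hs2' : (2 : ℝ) * s = d * ((D + 1) * (D + 2)) := by exact_mod_cast hs2
  have hm2' : (6 : ℝ) * m ≤ 2 * d * (D * (D + 1) * (D + 2)) + 3 * d ^ 2 * ((D + 1) * (D + 2)) := by
    exact_mod_cast hm2
  have hs0 : (0 : ℝ) < s := by
    have : (0 : ℝ) < d * ((D + 1) * (D + 2)) := by positivity
    linarith
  have hs3 : (s : ℝ) ≤ 3 * d * D ^ 2 := by
    have : (d : ℝ) * ((D + 1) * (D + 2)) ≤ d * (6 * D ^ 2) := mul_le_mul_of_nonneg_left (by nlinarith) (by linarith)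
    linarith
  have hlB : 0 ≤ Real.log B := Real.log_natCast_nonneg B
  have h1 : |(Δ : ℝ)| ≤ (s : ℝ) ^ s * (B : ℝ) ^ m := by
    rw [← Int.cast_abs]
    have h2 : s.factorial * B ^ m ≤ s ^ s * B ^ m := Nat.mul_le_mul_right _ (Nat.factorial_le_pow s)
    have h3 : ((|Δ| : ℤ) : ℝ) ≤ ((s.factorial * B ^ m : ℕ) : ℝ) := by exact_mod_cast hΔ
    exact h3.trans (by exact_mod_cast h2)
  have hpos : 0 < |(Δ : ℝ)| := abs_pos.2 (by exact_mod_cast hΔ0)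
  have hB0 : (0 : ℝ) < B := by exact_mod_cast hB
  have h2 := Real.log_le_log hpos h1
  rw [Real.log_mul (by positivity) (by positivity), Real.log_pow, Real.log_pow] at h2
  have hls : Real.log s ≤ (3 * d + 2) * D := by
    have a1 := Real.log_le_log hs0 hs3
    rw [Real.log_mul (by positivity) (by positivity), Real.log_pow] at a1
    have a2 := Real.log_le_sub_one_of_pos (show (0 : ℝ) < 3 * d by positivity)
    have a3 := Real.log_le_sub_one_of_pos (show (0 : ℝ) < D by positivity)
    push_cast at a1
    nlinarith
  have hls0 : 0 ≤ Real.log s := Real.log_natCast_nonneg s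
  have h3 : s * Real.log s ≤ 3 * d * D ^ 2 * ((3 * d + 2) * D) :=
    mul_le_mul hs3 hls hls0 (by positivity)
  have h4 : (m : ℝ) ≤ D ^ 3 * (d / 3 * (1 + η)) := by
    have b1 : (D : ℝ) * (D + 1) * (D + 2) ≤ D ^ 3 + 6 * D ^ 2 := by nlinarith
    have b2 : ((D : ℝ) + 1) * (D + 2) ≤ 6 * D ^ 2 := by nlinarith
    have b3 : (6 : ℝ) * m ≤ 2 * d * (D ^ 3 + 6 * D ^ 2) + 3 * d ^ 2 * (6 * D ^ 2) :=
      hm2'.trans (add_le_add (mul_le_mul_of_nonneg_left b1 (by positivity)) (mul_le_mul_of_nonneg_left b2 (by positivity)))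
    have b4 : (6 + 9 * d) * (d * D ^ 2) ≤ η * D * (d * D ^ 2 : ℝ) := mul_le_mul_of_nonneg_right hDη (by positivity)
    nlinarith
  have h5 : (m : ℝ) * Real.log B ≤ D ^ 3 * (d / 3 * (1 + η)) * Real.log B :=
    mul_le_mul_of_nonneg_right h4 hlB
  nlinarith

theorem aux_core {d D B : ℕ} (hd : 4 ≤ d) (hD : 1 ≤ D) (hB : 1 ≤ B) {η a Y : ℝ} (hη : 0 < η) (hη2 : η ≤ 1 / 2)
    (hDη : 6 + 9 * d ≤ η * D) (hY : 0 < Y) (ha : 0 ≤ a) (f : MvPolynomial (Fin 3) ℤ)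
    (pts : IX d D → Fin 3 → ℤ) (hf : ∀ i, eval (pts i) f = 0) (hbox : ∀ j i, |pts j i| ≤ B)
    (hdet : (Matrix.of fun i j => eval (pts i) (monomial (eps j) (1 : ℤ))).det ≠ 0)
    (Qs Ps : Finset ℕ) (hdisj : Disjoint Qs Ps) (hQp : ∀ p ∈ Qs, p.Prime) (hPp : ∀ p ∈ Ps, p.Prime)
    (hQ1 : ∀ p ∈ Qs, ∀ i j l, (p : ℤ) ∣ pts i l - pts j l)
    (hQ2 : ∀ p ∈ Qs, ∀ i, ¬ (p : ℤ) ∣ eval (pts i) (pderiv 0 f))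
    (hP1 : ∀ p ∈ Ps, Y ≤ p ∧ p ≤ 2 * D)
    (hP2 : ∀ p ∈ Ps, ∀ s : Finset (Fin 3 → ZMod p), (∀ R ∈ s, eval R (map (Int.castRingHom (ZMod p)) f) = 0 ∧
      eval R (pderiv 0 (map (Int.castRingHom (ZMod p)) f)) ≠ 0) → (s.card : ℝ) ≤ (1 + 2 * η) * p ^ 2)
    (hz0 : ∀ i, eval (pts i) (pderiv 0 f) ≠ 0)
    (hz : ∀ i, Real.log |((eval (pts i) (pderiv 0 f) : ℤ) : ℝ)| ≤ a * Y) :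
    (d - 4 / 3 - 3 * η) * (∑ p ∈ Qs, Real.log p + ∑ p ∈ Ps, Real.log p / p) ≤
      d / 3 * (1 + η) * Real.log B + (3 * d * (3 * d + 2) + 3 * (3 * d + 8) + 6 * d * a) := by
  classical
  set Δ := (Matrix.of fun i j => eval (pts i) (monomial (eps j) (1 : ℤ))).det with hΔdef
  set s := Fintype.card (IX d D) with hs
  have hs2 := card_IX d D
  rw [← hs] at hs2
  have hD' : (1 : ℝ) ≤ D := by exact_mod_cast hD
  have hd' : (4 : ℝ) ≤ d := by exact_mod_cast hd
  have hs2' : (2 : ℝ) * s = d * ((D + 1) * (D + 2)) := by exact_mod_cast hs2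
  have hs3 : (s : ℝ) ≤ 3 * d * D ^ 2 := by
    have : (d : ℝ) * ((D + 1) * (D + 2)) ≤ d * (6 * D ^ 2) := mul_le_mul_of_nonneg_left (by nlinarith) (by linarith)
    linarith
  have hup := log_det_le (by omega) hD hB hη hDη Δ hdet (det_le eps pts B hbox)
  let sing : ℕ → Finset (IX d D) := fun p => Finset.univ.filter (fun i => (p : ℤ) ∣ eval (pts i) (pderiv 0 f))
  let T : ℕ → ℕ := fun k => k * (k + 1) * (k + 2) / 6
  have hTr : ∀ k : ℕ, (6 : ℝ) * T k ≤ k * (k + 1) * (k + 2) := by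
    intro k
    have : 6 * T k ≤ k * (k + 1) * (k + 2) := Nat.mul_div_le _ _
    exact_mod_cast this
  -- exponent at primes of Qs
  have hEQ : ∀ p ∈ Qs, ∃ E : ℕ, (p : ℤ) ^ E ∣ Δ ∧ (d - 4 / 3 - 3 * η) * D ^ 3 ≤ E := by
    intro p hp
    have : Fact p.Prime := ⟨hQp p hp⟩
    refine ⟨s * (2 * D) - T (2 * D), ?_, ?_⟩
    · by_cases hle : T (2 * D) ≤ s * (2 * D)
      · refine det_dvd p f pts (fun j => monomial (eps j) 1) hf Finset.univ (fun i _ => hQ2 p hp i) 1 ?_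
          (2 * D) (T (2 * D)) _ (sumT2 _) ?_
        · rw [Finset.card_le_one]
          intro x hx y hy
          obtain ⟨i, _, rfl⟩ := Finset.mem_image.1 hx
          obtain ⟨j, _, rfl⟩ := Finset.mem_image.1 hy
          funext l
          exact ((ZMod.intCast_eq_intCast_iff_dvd_sub _ _ _).2 (hQ1 p hp j i l))
        · rw [Finset.card_univ, ← hs]; omega
      · rw [Nat.sub_eq_zero_of_le (by omega)]; simp
    · have h1 := est_Q (d := d) (D := D) (s := s) (T := T (2 * D)) (η := η) (by linarith) hD' hη.le (by linarith) hs2' (by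
        have := hTr (2 * D); push_cast at this; exact this)
      refine h1.trans ?_
      have : (s * (2 * D) : ℕ) ≤ (s * (2 * D) - T (2 * D)) + T (2 * D) := by omega
      have h2 : ((s * (2 * D) : ℕ) : ℝ) ≤ ((s * (2 * D) - T (2 * D) : ℕ) : ℝ) + T (2 * D) := by exact_mod_cast this
      push_cast at h2 ⊢; linarith
  have hEP : ∀ p ∈ Ps, ∃ E : ℕ, (p : ℤ) ^ E ∣ Δ ∧
      (d - 4 / 3 - 3 * η) * D ^ 3 / p - (3 * d + 8) * D ^ 2 - 2 * D * ((sing p).card / p) ≤ (E : ℝ) := by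
    intro p hp
    have : Fact p.Prime := ⟨hPp p hp⟩
    let R : Finset (IX d D) := (sing p)ᶜ
    let N := (R.image (fun i => fun l => ((pts i l : ℤ) : ZMod p))).card
    let k := 2 * D / p
    have hRc : (R.card : ℝ) = s - (sing p).card := by
      rw [Finset.card_compl, Nat.cast_sub (Finset.card_le_univ _)]
    have hN : (N : ℝ) ≤ (1 + 2 * η) * p ^ 2 := by
      refine hP2 p hp _ (fun Q hQ => ?_)
      obtain ⟨i, hi, rfl⟩ := Finset.mem_image.1 hQ
      have hev2 : ∀ u : MvPolynomial (Fin 3) ℤ, eval (fun l => ((pts i l : ℤ) : ZMod p))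
          (map (Int.castRingHom (ZMod p)) u) = (eval (pts i) u : ℤ) := by
        intro u
        have : (fun l => ((pts i l : ℤ) : ZMod p)) = Int.castRingHom (ZMod p) ∘ pts i := rfl
        rw [this, eval_map, ← eval₂_comp]; rfl
      rw [pderiv_map, hev2, hev2, hf]
      refine ⟨by simp, fun h => ?_⟩
      rw [Finset.mem_compl, Finset.mem_filter] at hi
      exact hi ⟨Finset.mem_univ _, (ZMod.intCast_zmod_eq_zero_iff_dvd _ _).1 h⟩
    have hp0 : 0 < p := (hPp p hp).pos
    refine ⟨R.card * k - N * T k, ?_, ?_⟩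
    · by_cases hle : N * T k ≤ R.card * k
      · refine det_dvd p f pts (fun j => monomial (eps j) 1) hf R (fun i hi => ?_) N le_rfl
          k (T k) _ (sumT2 _) (by omega)
        simpa [R, sing] using hi
      · rw [Nat.sub_eq_zero_of_le (by omega)]; simp
    · have hk1 : k * p ≤ 2 * D := Nat.div_mul_le_self _ _
      have hk2 : 2 * D ≤ (k + 1) * p := by
        have := Nat.lt_div_mul_add (a := 2 * D) hp0
        change 2 * D < k * p + p at this
        rw [add_mul, one_mul]; exact this.le
      have h1 := est_P (d := d) (D := D) (p := p) (s := s) (N := N) (k := k) (T := T k) (sing := (sing p).card)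
        (η := η) (by linarith) hD' (by exact_mod_cast hp0) (by exact_mod_cast (hP1 p hp).2) hη.le hη2 hs2' (by positivity) hN
        (by positivity) (by exact_mod_cast hk1) (by exact_mod_cast hk2) (hTr k) (by positivity)
      refine h1.trans ?_
      rw [← hRc]
      have : (R.card * k : ℕ) ≤ (R.card * k - N * T k) + N * T k := by omega
      have h2 : ((R.card * k : ℕ) : ℝ) ≤ ((R.card * k - N * T k : ℕ) : ℝ) + ((N * T k : ℕ) : ℝ) := by exact_mod_cast this
      push_cast at h2 ⊢; linarith
  choose! EQ hEQ1 hEQ2 using hEQ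
  choose! EP hEP1 hEP2 using hEP
  have hlow := sum_log_le (Qs ∪ Ps) (fun p hp => by
    rcases Finset.mem_union.1 hp with h | h
    exacts [hQp p h, hPp p h]) (fun p => if p ∈ Qs then EQ p else EP p) Δ hdet (fun p hp => by
      by_cases h : p ∈ Qs
      · simp only [if_pos h]; exact hEQ1 p h
      · simp only [if_neg h]; exact hEP1 p ((Finset.mem_union.1 hp).resolve_left h))
  rw [Finset.sum_union hdisj] at hlow
  have hq : ∑ p ∈ Qs, (d - 4 / 3 - 3 * η) * D ^ 3 * Real.log p ≤
      ∑ p ∈ Qs, ((if p ∈ Qs then EQ p else EP p : ℕ) : ℝ) * Real.log p :=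
    Finset.sum_le_sum (fun p hp => by
      rw [if_pos hp]; exact mul_le_mul_of_nonneg_right (hEQ2 p hp) (Real.log_natCast_nonneg p))
  have hp : ∑ p ∈ Ps, ((d - 4 / 3 - 3 * η) * D ^ 3 / p - (3 * d + 8) * D ^ 2 - 2 * D * ((sing p).card / p)) * Real.log p ≤
      ∑ p ∈ Ps, ((if p ∈ Qs then EQ p else EP p : ℕ) : ℝ) * Real.log p :=
    Finset.sum_le_sum (fun p hp => by
      rw [if_neg (Finset.disjoint_right.1 hdisj hp)]
      exact mul_le_mul_of_nonneg_right (hEP2 p hp) (Real.log_natCast_nonneg p))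
  have hp' : ∑ p ∈ Ps, ((d - 4 / 3 - 3 * η) * D ^ 3 / p - (3 * d + 8) * D ^ 2 - 2 * D * ((sing p).card / p)) * Real.log p
      = (d - 4 / 3 - 3 * η) * D ^ 3 * ∑ p ∈ Ps, Real.log p / p - (3 * d + 8) * D ^ 2 * ∑ p ∈ Ps, Real.log p
        - 2 * D * ∑ p ∈ Ps, (sing p).card * (Real.log p / p) := by
    rw [Finset.mul_sum, Finset.mul_sum, Finset.mul_sum, ← Finset.sum_sub_distrib, ← Finset.sum_sub_distrib]
    exact Finset.sum_congr rfl (fun p _ => by ring)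
  have hth := theta_bound D Ps (fun p hp => ⟨hPp p hp, (hP1 p hp).2⟩)
  have hsg : ∑ p ∈ Ps, ((sing p).card : ℝ) * (Real.log p / p) ≤ s * a := by
    have e1 : ∀ p ∈ Ps, ((sing p).card : ℝ) * (Real.log p / p) =
        ∑ i : IX d D, if (p : ℤ) ∣ eval (pts i) (pderiv 0 f) then Real.log p / p else 0 := by
      intro p _
      rw [← Finset.sum_filter, Finset.sum_const, nsmul_eq_mul]
    rw [Finset.sum_congr rfl e1, Finset.sum_comm]
    have e2 : ∀ i ∈ (Finset.univ : Finset (IX d D)),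
        (∑ p ∈ Ps, if (p : ℤ) ∣ eval (pts i) (pderiv 0 f) then Real.log p / p else 0) ≤ a := by
      intro i _
      rw [← Finset.sum_filter]
      refine (sum_div_le _ (fun p hp => hPp p (Finset.filter_subset _ _ hp)) Y hY
        (fun p hp => (hP1 p (Finset.filter_subset _ _ hp)).1) _ (hz0 i)
        (fun p hp => (Finset.mem_filter.1 hp).2)).trans ?_
      rw [div_le_iff₀ hY]; exact hz i
    refine (Finset.sum_le_card_nsmul _ _ _ e2).trans_eq ?_
    rw [Finset.card_univ, nsmul_eq_mul]
  rw [← Finset.mul_sum] at hq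
  rw [hp'] at hp
  have hD3 : (0 : ℝ) < (D : ℝ) ^ 3 := by positivity
  have g1 : (3 * d + 8) * (D : ℝ) ^ 2 * ∑ p ∈ Ps, Real.log p ≤ (3 * d + 8) * (D : ℝ) ^ 2 * (3 * D) :=
    mul_le_mul_of_nonneg_left hth (by positivity)
  have g2 : 2 * (D : ℝ) * ∑ p ∈ Ps, (sing p).card * (Real.log p / p) ≤ 2 * D * (3 * d * D ^ 2 * a) :=
    mul_le_mul_of_nonneg_left (hsg.trans (mul_le_mul_of_nonneg_right hs3 ha)) (by positivity)
  refine le_of_mul_le_mul_left ?_ hD3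
  set c := (d - 4 / 3 - 3 * η)
  set X1 := ∑ p ∈ Qs, Real.log p
  set X2 := ∑ p ∈ Ps, Real.log p / p
  have : c * D ^ 3 * X1 + (c * D ^ 3 * X2 - (3 * d + 8) * D ^ 2 * (3 * D) - 2 * D * (3 * d * D ^ 2 * a)) ≤
     D ^ 3 * (3 * d * (3 * d + 2) + d / 3 * (1 + η) * Real.log B) := by linarith
  linarith

end PartE3

section PartE4

theorem log_div_le_one (p : ℕ) : Real.log p / p ≤ 1 := by
  rcases Nat.eq_zero_or_pos p with rfl | h
  · simp
  · have hp : (0 : ℝ) < p := by exact_mod_cast h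
    rw [div_le_one hp]
    linarith [Real.log_le_sub_one_of_pos hp]

theorem sum_Ps_ge {n : ℕ} {M Y b : ℝ} (hY : 0 < Y) (Qs : Finset ℕ) (A : ℤ) (hA : A ≠ 0)
    (hM : Real.log n - M ≤ ∑ p ∈ n.primesLE, Real.log p / p) (hb : Real.log |(A : ℝ)| ≤ b * Y) :
    Real.log n - M - (Y + 1) - Qs.card - b ≤
      ∑ p ∈ n.primesLE.filter (fun p : ℕ => Y ≤ (p : ℝ) ∧ p ∉ Qs ∧ ¬ (p : ℤ) ∣ A), Real.log p / p := by
  classical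
  have hnn : ∀ p : ℕ, 0 ≤ Real.log p / p := fun p => div_nonneg (Real.log_natCast_nonneg p) (Nat.cast_nonneg p)
  have h1 : ∑ p ∈ n.primesLE, Real.log p / p ≤
      ∑ p ∈ n.primesLE.filter (fun p : ℕ => Y ≤ (p : ℝ) ∧ p ∉ Qs ∧ ¬ (p : ℤ) ∣ A), Real.log p / p +
      (∑ p ∈ Finset.range ⌈Y⌉₊, Real.log p / p + (∑ p ∈ Qs, Real.log p / p +
      ∑ p ∈ n.primesLE.filter (fun p : ℕ => Y ≤ (p : ℝ) ∧ (p : ℤ) ∣ A), Real.log p / p)) := by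
    refine le_trans (Finset.sum_le_sum_of_subset_of_nonneg (t := n.primesLE.filter (fun p : ℕ => Y ≤ (p : ℝ) ∧ p ∉ Qs ∧ ¬ (p : ℤ) ∣ A) ∪
      (Finset.range ⌈Y⌉₊ ∪ (Qs ∪ n.primesLE.filter (fun p : ℕ => Y ≤ (p : ℝ) ∧ (p : ℤ) ∣ A)))) ?_ (fun _ _ _ => hnn _)) ?_
    · intro p hp
      simp only [Finset.mem_union, Finset.mem_filter, Finset.mem_range, Nat.lt_ceil]
      by_cases h : Y ≤ p
      · tauto
      · push Not at h
        tauto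
    · have hU : ∀ s t : Finset ℕ, ∑ p ∈ s ∪ t, Real.log p / p ≤ ∑ p ∈ s, Real.log p / p + ∑ p ∈ t, Real.log p / p := by
        intro s t
        rw [← Finset.sum_union_inter]
        linarith [Finset.sum_nonneg (fun p (_ : p ∈ s ∩ t) => hnn p)]
      refine (hU _ _).trans (by gcongr; refine (hU _ _).trans (by gcongr; exact hU _ _))
  have hc : ∀ s : Finset ℕ, ∑ p ∈ s, Real.log p / p ≤ s.card := by
    intro s
    refine (Finset.sum_le_sum (fun p _ => log_div_le_one p)).trans ?_
    simp
  have h2 := hc (Finset.range ⌈Y⌉₊)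
  rw [Finset.card_range] at h2
  have h3 := Nat.ceil_lt_add_one hY.le
  have h4 := hc Qs
  have h5 := sum_div_le (n.primesLE.filter (fun p : ℕ => Y ≤ (p : ℝ) ∧ (p : ℤ) ∣ A))
    (fun p hp => (Nat.mem_primesLE.1 (Finset.mem_filter.1 hp).1).2) Y hY
    (fun p hp => (Finset.mem_filter.1 hp).2.1) A hA (fun p hp => (Finset.mem_filter.1 hp).2.2)
  have h6 : Real.log |(A : ℝ)| / Y ≤ b := by rwa [div_le_iff₀ hY]
  linarith

set_option maxHeartbeats 1600000 in
theorem aux (d T c : ℕ) (hd : 4 ≤ d) (hT : 1 ≤ T) : ∃ D0 : ℕ, 1 ≤ D0 ∧ ∀ f : MvPolynomial (Fin 3) ℤ,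
    f.totalDegree ≤ d → coeff (Finsupp.single 0 d) f ≠ 0 → Irreducible (map (Int.castRingHom ℚ) f) →
    ∀ L : ℕ, 2 ≤ L → (∀ α, |coeff α f| ≤ (L ^ c : ℕ)) → ∀ S : Finset (Fin 3 → ℤ),
    (∀ P ∈ S, eval P f = 0 ∧ eval P (pderiv 0 f) ≠ 0 ∧ ∀ i, |P i| ≤ (L ^ (2 * T) : ℕ)) →
    ∀ j ≤ T + 1, ∀ Qs : Finset ℕ, Qs.card ≤ T + 1 → (∀ p ∈ Qs, p.Prime) → L ^ j ≤ ∏ p ∈ Qs, p →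
    (∀ p ∈ Qs, ∀ P ∈ S, ∀ Q ∈ S, ∀ l, (p : ℤ) ∣ P l - Q l) →
    (∀ p ∈ Qs, ∀ P ∈ S, ¬ (p : ℤ) ∣ eval P (pderiv 0 f)) →
    ∃ g : MvPolynomial (Fin 3) ℚ, g ≠ 0 ∧ degreeOf 0 g < d ∧ g.totalDegree ≤ D0 * L ^ (T + 1 - j) + d ∧
      ∀ P ∈ S, eval (fun i => (P i : ℚ)) g = 0 := by
  classical
  obtain ⟨M, hM0, hM⟩ := mertens
  set η : ℝ := 1 / (16 * (T + 1)) with hηdef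
  have hT0 : (0 : ℝ) < T + 1 := by positivity
  have hηT : η * (T + 1) = 1 / 16 := by rw [hηdef]; field_simp
  have hη : 0 < η := by positivity
  have hT' : (1 : ℝ) ≤ T := by exact_mod_cast hT
  have hd' : (4 : ℝ) ≤ d := by exact_mod_cast hd
  have hη2 : η ≤ 1 / 32 := by nlinarith
  obtain ⟨e, he⟩ := exists_nat_ge ((3 + 2 * (d : ℝ) ^ 2) / η)
  rw [div_le_iff₀ hη] at he
  clear_value η
  obtain ⟨K, hK⟩ := goodprimes d (e + 2) (by omega) (by omega)
  set p0 : ℝ := K / η + 1 with hp0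
  have hKη : 0 ≤ K / η := by positivity
  have hKη2 : (K : ℝ) / η * η = K := by field_simp
  set a : ℝ := K + K * (c + 2 * T) / η with ha
  have ha0 : 0 ≤ a := by positivity
  have haK : (K : ℝ) ≤ a := by rw [ha]; linarith [show (0 : ℝ) ≤ K * (c + 2 * T) / η by positivity]
  have haη : (K : ℝ) * (c + 2 * T) ≤ a * η := by
    rw [ha, add_mul, div_mul_cancel₀ _ hη.ne']
    linarith [show (0 : ℝ) ≤ K * η by positivity]
  set K' : ℝ := 3 * d * (3 * d + 2) + 3 * (3 * d + 8) + 6 * d * a with hK'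
  have hK'0 : 0 ≤ K' := by positivity
  set C2 : ℝ := M + p0 + 1 + (T + 1) + a with hC2
  have hC20 : 0 ≤ C2 := by rw [hC2, hp0]; linarith
  obtain ⟨D0, hD0⟩ := exists_nat_ge (Real.exp (C2 + 2 * K' + 1) + (6 + 9 * d) / η)
  have hD0a : Real.exp (C2 + 2 * K' + 1) ≤ D0 := by
    linarith [show (0 : ℝ) ≤ (6 + 9 * d) / η by positivity]
  have hD0b : (6 + 9 * d) / η ≤ (D0 : ℝ) := by
    linarith [Real.exp_pos (C2 + 2 * K' + 1)]
  have hD0pos : (0 : ℝ) < D0 := (Real.exp_pos _).trans_le hD0a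
  have hD0l : C2 + 2 * K' + 1 ≤ Real.log D0 := by
    rw [Real.le_log_iff_exp_le hD0pos]; exact hD0a
  have hD01 : 1 ≤ D0 := by exact_mod_cast hD0pos
  rw [div_le_iff₀ hη] at hD0b
  refine ⟨D0, hD01, ?_⟩
  intro f hfd hfc hirr L hL hfH S hS j hj Qs hQc hQp hQL hQ1 hQ2
  set D := D0 * L ^ (T + 1 - j) with hDdef
  have hDD : D0 ≤ D := Nat.le_mul_of_pos_right _ (by positivity)
  have hDD' : (D0 : ℝ) ≤ D := by exact_mod_cast hDD
  rcases interp (eps (d := d) (D := D)) eps_inj S with ⟨c', hc', hg⟩ | ⟨pts, -, hptS, hdet⟩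
  · obtain ⟨h1, h2, h3⟩ := poly_eps c' hc'
    exact ⟨_, h1, h3, h2, hg⟩
  exfalso
  set l := Real.log L with hl
  have hl0 : 0 < l := Real.log_pos (by exact_mod_cast (show 1 < L by omega))
  set H := L ^ (c + 2 * T) with hH
  have hH1 : 1 ≤ H := Nat.one_le_pow _ _ (by omega)
  have hBH : L ^ (2 * T) ≤ H := Nat.pow_le_pow_right (by omega) (by omega)
  have hcH : L ^ c ≤ H := Nat.pow_le_pow_right (by omega) (by omega)
  set Y : ℝ := p0 + η * (2 * T * l) with hYdef
  have hYp : p0 ≤ Y := by rw [hYdef]; linarith [show 0 ≤ η * (2 * T * l) by positivity]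
  have hY : 0 < Y := by linarith [hp0]
  -- the goodprimes data at each point
  have key : ∀ P ∈ S, ∃ A : ℤ, A ≠ 0 ∧ Real.log |(A : ℝ)| ≤ a * Y ∧ eval P (pderiv 0 f) ∣ A ∧
      ∀ p : ℕ, ∀ [Fact p.Prime], K ≤ p → ¬ (p : ℤ) ∣ A → ∀ s : Finset (Fin 3 → ZMod p),
      (∀ Q ∈ s, eval Q (map (Int.castRingHom (ZMod p)) f) = 0 ∧
      eval Q (pderiv 0 (map (Int.castRingHom (ZMod p)) f)) ≠ 0) →
      (d * (e + 2) - 1) * s.card ≤ p ^ 2 * (d * (e + 2) + 1 + 2 * d ^ 2) + K * p := by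
    intro P hP
    obtain ⟨h0, hz, hb⟩ := hS P hP
    obtain ⟨A, hA0, hAb, hAd, hAp⟩ := hK f hfd hfc hirr P h0 hz H hH1
      (fun α => (hfH α).trans (by exact_mod_cast hcH)) (fun i => (hb i).trans (by exact_mod_cast hBH))
    refine ⟨A, hA0, ?_, hAd, hAp⟩
    have hAr : |(A : ℝ)| ≤ K * (H : ℝ) ^ K := by exact_mod_cast hAb
    have hApos : 0 < |(A : ℝ)| := abs_pos.2 (by exact_mod_cast hA0)
    have hK0 : (0 : ℝ) < K := by
      rcases Nat.eq_zero_or_pos K with h | h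
      · rw [h] at hAr; simp at hAr; exact absurd hAr hA0
      · exact_mod_cast h
    have hH0 : (0 : ℝ) < H := by exact_mod_cast hH1
    have h1 := Real.log_le_log hApos hAr
    rw [Real.log_mul hK0.ne' (by positivity), Real.log_pow, hH, Nat.cast_pow, Real.log_pow, ← hl] at h1
    have h2 := Real.log_le_sub_one_of_pos hK0
    push_cast at h1
    have h3 : a * Y = a * p0 + (a * η) * (2 * T * l) := by rw [hYdef]; ring
    have h4 : a ≤ a * p0 := le_mul_of_one_le_right ha0 (by linarith)
    have h5 : (K : ℝ) * (c + 2 * T) * l ≤ (a * η) * (2 * T * l) := by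
      have : l ≤ 2 * T * l := le_mul_of_one_le_left hl0.le (by linarith)
      exact mul_le_mul haη this hl0.le (by positivity)
    have h6 : (K : ℝ) * ((c + 2 * T) * l) = K * (c + 2 * T) * l := by ring
    linarith
  have hne : Nonempty (IX d D) := ⟨(⟨0, by omega⟩, ⟨⟨0, by omega⟩, ⟨0, by simp⟩⟩)⟩
  obtain ⟨A, hA0, hAl, -, hAp⟩ := key _ (hptS (Classical.choice hne))
  have hcore := aux_core (B := L ^ (2 * T)) hd (hD01.trans hDD) (Nat.one_le_pow _ _ (by omega)) hη (by linarith)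
    (hD0b.trans (by rw [mul_comm]; exact mul_le_mul_of_nonneg_left hDD' hη.le)) hY ha0 f pts (fun i => (hS _ (hptS i)).1) (fun i => (hS _ (hptS i)).2.2) hdet Qs
    ((2 * D).primesLE.filter (fun p : ℕ => Y ≤ (p : ℝ) ∧ p ∉ Qs ∧ ¬ (p : ℤ) ∣ A))
    (Finset.disjoint_right.2 (fun p hp => (Finset.mem_filter.1 hp).2.2.1)) hQp
    (fun p hp => (Nat.mem_primesLE.1 (Finset.mem_filter.1 hp).1).2)
    (fun p hp i j l => hQ1 p hp _ (hptS i) _ (hptS j) l) (fun p hp i => hQ2 p hp _ (hptS i))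
    (fun p hp => ⟨(Finset.mem_filter.1 hp).2.1, (Nat.mem_primesLE.1 (Finset.mem_filter.1 hp).1).1⟩)
    ?_ (fun i => (hS _ (hptS i)).2.1) ?_
  rotate_left
  · intro p hp s hs
    obtain ⟨hp1, hpY, -, hpA⟩ := Finset.mem_filter.1 hp
    have : Fact p.Prime := ⟨(Nat.mem_primesLE.1 hp1).2⟩
    have hpp : p0 ≤ p := hYp.trans hpY
    have hKp : (K : ℝ) ≤ η * p := by
      have : (K : ℝ) / η ≤ p := by linarith
      rw [div_le_iff₀ hη] at this; linarith
    have hp0' : (0 : ℝ) < p := by linarith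
    have hKp' : K ≤ p := by
      have : (K : ℝ) ≤ p := hKp.trans (mul_le_of_le_one_left hp0'.le (by linarith))
      exact_mod_cast this
    have h1 := hAp p hKp' hpA s hs
    have hde : 1 ≤ d * (e + 2) := Nat.mul_pos (by omega) (by omega)
    zify [hde] at h1
    have h2 : ((d : ℝ) * (e + 2) - 1) * s.card ≤ p ^ 2 * (d * (e + 2) + 1 + 2 * d ^ 2) + K * p := by exact_mod_cast h1
    have h3 : (e : ℝ) + 1 ≤ d * (e + 2) - 1 := by
      have he0 : (0 : ℝ) ≤ e := Nat.cast_nonneg e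
      have := mul_le_mul_of_nonneg_right hd' (show (0 : ℝ) ≤ e + 2 by linarith)
      linarith
    set w : ℝ := d * (e + 2) - 1 with hw
    have hw1 : 1 ≤ w := by linarith [show (0 : ℝ) ≤ e from Nat.cast_nonneg e]
    have h4 : 2 + 2 * (d : ℝ) ^ 2 ≤ η * w := by
      have := mul_le_mul_of_nonneg_left h3 hη.le
      linarith
    have h5 : (p : ℝ) ^ 2 * (d * (e + 2) + 1 + 2 * d ^ 2) ≤ p ^ 2 * (w + η * w) :=
      mul_le_mul_of_nonneg_left (by linarith) (by positivity)
    have h6 : (K : ℝ) * p ≤ η * p ^ 2 * w := by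
      have : (K : ℝ) * p ≤ η * p * p := mul_le_mul_of_nonneg_right hKp hp0'.le
      have h7 : η * p ^ 2 * 1 ≤ η * p ^ 2 * w := mul_le_mul_of_nonneg_left hw1 (by positivity)
      linarith
    have h8 : w * s.card ≤ w * ((1 + 2 * η) * p ^ 2) := by linarith
    exact le_of_mul_le_mul_left h8 (by linarith)
  · intro i
    obtain ⟨A', hA'0, hA'l, hA'd, -⟩ := key _ (hptS i)
    refine le_trans (Real.log_le_log (abs_pos.2 (by exact_mod_cast (hS _ (hptS i)).2.1)) ?_) hA'l
    have : |eval (pts i) (pderiv 0 f)| ≤ |A'| :=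
      Int.le_of_dvd (abs_pos.2 hA'0) ((abs_dvd_abs _ _).2 hA'd)
    exact_mod_cast this
  -- final contradiction
  have hPs := sum_Ps_ge (n := 2 * D) hY Qs A hA0 (hM _ (by omega)) hAl
  set SP := ∑ p ∈ (2 * D).primesLE.filter (fun p : ℕ => Y ≤ (p : ℝ) ∧ p ∉ Qs ∧ ¬ (p : ℤ) ∣ A), Real.log p / p
  have hSQ : j * l ≤ ∑ p ∈ Qs, Real.log p := by
    rw [hl, ← Real.log_pow, ← Real.log_prod (fun p hp => by exact_mod_cast (hQp p hp).ne_zero)]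
    refine Real.log_le_log (by positivity) ?_
    rw [← Nat.cast_prod, ← Nat.cast_pow]
    exact Nat.cast_le.2 hQL
  set SQ := ∑ p ∈ Qs, Real.log p
  have hlogD : Real.log D0 + (T + 1 - j) * l ≤ Real.log (2 * D : ℕ) := by
    have hLp : (0 : ℝ) < (L : ℝ) := by exact_mod_cast (show 0 < L by omega)
    have : Real.log D = Real.log D0 + (T + 1 - j) * l := by
      rw [hDdef, Nat.cast_mul, Nat.cast_pow, Real.log_mul hD0pos.ne' (by positivity), Real.log_pow, Nat.cast_sub hj]
      push_cast; rfl
    rw [← this]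
    exact Real.log_le_log (by linarith) (by push_cast; linarith)
  have hQc' : (Qs.card : ℝ) ≤ T + 1 := by exact_mod_cast hQc
  have hB : Real.log (L ^ (2 * T) : ℕ) = 2 * T * l := by
    rw [Nat.cast_pow, Real.log_pow]; push_cast; rfl
  rw [hB] at hcore
  set X := SQ + SP with hX
  set Tl := (T : ℝ) * l with hTl
  have hTl0 : 0 < Tl := by positivity
  have hXge : Tl + l - 2 * η * Tl + 2 * K' + 1 ≤ X := by
    have e1 : Y = p0 + 2 * η * Tl := by rw [hYdef, hTl]; ring
    have e2 : (T + 1 - j) * l = Tl + l - j * l := by rw [hTl]; ring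
    linarith
  have hηTl : η * Tl + η * l = l / 16 := by
    rw [hTl]; linear_combination l * hηT
  have hηl : 0 < η * l := by positivity
  have hX0 : 0 ≤ X := by linarith
  have h1 : (2 * d / 3) * (1 - 2 * η) * X ≤ (d - 4 / 3 - 3 * η) * X :=
    mul_le_mul_of_nonneg_right (by linarith [mul_le_mul_of_nonneg_left hd' hη.le]) hX0
  have h2 : (1 - 2 * η) * (Tl + l - 2 * η * Tl + 2 * K' + 1) ≤ (1 - 2 * η) * X :=
    mul_le_mul_of_nonneg_left hXge (by linarith)
  have h3 : (1 - 2 * η) * X ≤ (1 + η) * Tl + K' := by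
    have : (2 * d / 3) * ((1 - 2 * η) * X) ≤ (2 * d / 3) * ((1 + η) * Tl + K') := by
      have h4 : K' ≤ (2 * d / 3) * K' := le_mul_of_one_le_left hK'0 (by linarith)
      have e1 : d / 3 * (1 + η) * (2 * T * l) = (2 * d / 3) * ((1 + η) * Tl) := by rw [hTl]; ring
      rw [mul_add]
      linarith
    exact le_of_mul_le_mul_left this (by linarith)
  have h4 : (1 - 2 * η) * (Tl + l - 2 * η * Tl + 2 * K' + 1) = Tl + l - 2 * (η * Tl) - 2 * (η * Tl + η * l) 
    + 4 * (η * (η * Tl)) + (1 - 2 * η) * (2 * K' + 1) := by ring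
  have h5 : K' ≤ (1 - 2 * η) * (2 * K' + 1) := by
    have := mul_le_mul_of_nonneg_right (show (1 : ℝ) / 2 ≤ 1 - 2 * η by linarith) (show 0 ≤ 2 * K' + 1 by linarith)
    linarith
  have h6 : 0 ≤ η * (η * Tl) := by positivity
  linarith

end PartE4

section PartH1

theorem sumT1' (k : ℕ) (A : Finset (Fin 1 →₀ ℕ)) : ∑ α ∈ A, (k - α.degree) ≤ k * (k + 1) / 2 := by
  classical
  have h1 : ∑ α ∈ A, (k - α.degree) = ∑ m ∈ A.image (fun α => α 0), (k - m) := by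
    rw [Finset.sum_image]
    · refine Finset.sum_congr rfl (fun α _ => ?_)
      simp [Finsupp.degree_eq_sum]
    · intro a _ b _ h
      exact Finsupp.ext (fun i => by rw [Subsingleton.elim i 0]; exact h)
  rw [h1]
  calc _ ≤ ∑ m ∈ A.image (fun α => α 0) ∪ Finset.range (k + 1), (k - m) :=
        Finset.sum_le_sum_of_subset Finset.subset_union_left
    _ = ∑ m ∈ Finset.range (k + 1), (k - m) := by
        symm
        refine Finset.sum_subset Finset.subset_union_right (fun x _ hx => ?_)
        simp at hx; omega
    _ = ∑ m ∈ Finset.range (k + 1), m := by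
        rw [← Finset.sum_range_reflect (fun m => m) (k + 1)]
        exact Finset.sum_congr rfl (fun i _ => by omega)
    _ ≤ _ := by rw [Finset.sum_range_id]; simp [mul_comm]

/-- the shear substitution -/
noncomputable def shr {R : Type*} [CommRing R] {n : ℕ} (v : Fin n → ℤ) : Fin (n+1) → MvPolynomial (Fin (n+1)) R :=
  Fin.cons (X 0) (fun i => X i.succ + C ((v i : ℤ) : R) * X 0)

/-- action of the shear on points -/
def shp {R : Type*} [CommRing R] {n : ℕ} (v : Fin n → ℤ) (P : Fin (n+1) → R) : Fin (n+1) → R :=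
  Fin.cons (P 0) (fun i => P i.succ + (v i : R) * P 0)

theorem eval_shr {R : Type*} [CommRing R] {n : ℕ} (v : Fin n → ℤ) (P : Fin (n+1) → R) (f : MvPolynomial (Fin (n+1)) R) :
    eval P (aeval (shr v) f) = eval (shp v P) f := by
  rw [eval_aeval']
  congr 2
  funext i
  refine Fin.cases ?_ (fun i => ?_) i <;> simp [shr, shp]

theorem shp_neg {R : Type*} [CommRing R] {n : ℕ} (v : Fin n → ℤ) (P : Fin (n+1) → R) :
    shp v (shp (-v) P) = P := by
  funext i
  refine Fin.cases ?_ (fun i => ?_) i <;> simp [shp]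

theorem tdeg_shr_le {R : Type*} [CommRing R] {n : ℕ} (v : Fin n → ℤ) (i : Fin (n+1)) :
    (shr v i : MvPolynomial (Fin (n+1)) R).totalDegree ≤ 1 := by
  refine Fin.cases ?_ (fun i => ?_) i
  · simpa [shr] using tdeg_X _
  · simp only [shr, Fin.cons_succ]
    refine (totalDegree_add _ _).trans (max_le (tdeg_X _) ((totalDegree_mul _ _).trans ?_))
    rw [totalDegree_C, zero_add]; exact tdeg_X _

theorem tdeg_shr {R : Type*} [CommRing R] {n : ℕ} (v : Fin n → ℤ) (f : MvPolynomial (Fin (n+1)) R) :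
    (aeval (shr (R := R) v) f).totalDegree ≤ f.totalDegree := tdeg_aeval _ (tdeg_shr_le v) f

theorem map_shr {R S : Type*} [CommRing R] [CommRing S] (ρ : R →+* S) {n : ℕ} (v : Fin n → ℤ)
    (f : MvPolynomial (Fin (n+1)) R) :
    map ρ (aeval (shr v) f) = aeval (shr v) (map ρ f) := by
  rw [map_aeval']
  congr 2
  funext i
  refine Fin.cases ?_ (fun i => ?_) i <;> simp [shr]

theorem shr_shr {R : Type*} [CommRing R] {n : ℕ} (v : Fin n → ℤ) (f : MvPolynomial (Fin (n+1)) R) :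
    aeval (shr (R := R) v) (aeval (shr (R := R) (-v)) f) = f := by
  rw [← AlgHom.comp_apply, comp_aeval]
  conv_rhs => rw [← aeval_X_left_apply f]
  congr 2
  funext i
  refine Fin.cases ?_ (fun i => ?_) i
  · simp [shr]
  · simp only [shr, Fin.cons_succ, map_add, map_mul, aeval_X, Fin.cons_zero]
    simp

/-- the shear as an algebra automorphism -/
noncomputable def shE {R : Type*} [CommRing R] {n : ℕ} (v : Fin n → ℤ) :
    MvPolynomial (Fin (n+1)) R ≃ₐ[R] MvPolynomial (Fin (n+1)) R :=
  AlgEquiv.ofAlgHom (aeval (shr v)) (aeval (shr (-v)))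
    (AlgHom.ext (fun f => shr_shr v f)) (AlgHom.ext (fun f => by
      have := shr_shr (-v) f
      rw [neg_neg] at this
      exact this))

theorem shE_apply {R : Type*} [CommRing R] {n : ℕ} (v : Fin n → ℤ) (f : MvPolynomial (Fin (n+1)) R) :
    shE v f = aeval (shr v) f := rfl

theorem irr_shr {R : Type*} [CommRing R] {n : ℕ} (v : Fin n → ℤ) {f : MvPolynomial (Fin (n+1)) R}
    (hf : Irreducible f) : Irreducible (aeval (shr (R := R) v) f) := by
  rw [← shE_apply]
  exact (MulEquiv.irreducible_iff (shE v : _ ≃ₐ[R] _)).2 hf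

theorem tdeg_shr_eq {R : Type*} [CommRing R] {n : ℕ} (v : Fin n → ℤ) (f : MvPolynomial (Fin (n+1)) R) :
    (aeval (shr (R := R) v) f).totalDegree = f.totalDegree := by
  refine le_antisymm (tdeg_shr v f) ?_
  have h := shr_shr (-v) f
  rw [neg_neg] at h
  conv_lhs => rw [← h]
  exact tdeg_shr _ _

theorem eval_homog {K : Type*} [CommRing K] {n δ : ℕ} {h : MvPolynomial (Fin n) K} (hh : h.IsHomogeneous δ)
    (w : K) (u : Fin n → K) : eval (fun i => w * u i) h = w ^ δ * eval u h := by
  rw [eval_eq', eval_eq', Finset.mul_sum]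
  refine Finset.sum_congr rfl (fun α hα => ?_)
  have : α.degree = δ := by
    by_contra hne
    exact (mem_support_iff.1 hα) (hh.coeff_eq_zero hne)
  simp_rw [mul_pow]
  rw [Finset.prod_mul_distrib, Finset.prod_pow_eq_pow_sum, ← Finsupp.degree_eq_sum, this]
  ring

theorem exists_top {R : Type*} [CommRing R] {σ : Type*} {f : MvPolynomial σ R} (hf : f ≠ 0) :
    homogeneousComponent f.totalDegree f ≠ 0 := by
  classical
  obtain ⟨α, hα, h⟩ := Finset.exists_mem_eq_sup f.support (by simpa using hf) (fun s => s.sum fun _ e => e)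
  intro h0
  have := congrArg (coeff α) h0
  rw [coeff_homogeneousComponent, if_pos (by unfold totalDegree; rw [h]; rfl)] at this
  exact (mem_support_iff.1 hα) (by simpa using this)

theorem shear_exists {n : ℕ} {f : MvPolynomial (Fin (n+1)) ℤ} (hf : f ≠ 0) : ∃ v : Fin n → ℤ,
    (∀ i, |v i| ≤ f.totalDegree) ∧ coeff (Finsupp.single 0 f.totalDegree) (aeval (shr (R := ℤ) v) f) ≠ 0 := by
  classical
  set δ := f.totalDegree with hδ
  set h := map (Int.castRingHom ℚ) (homogeneousComponent δ f) with hh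
  have hh0 : h ≠ 0 := by
    rw [hh, Ne, map_eq_zero_iff _ (map_injective _ (RingHom.injective_int _))]
    exact exists_top hf
  have hhom : h.IsHomogeneous δ := (homogeneousComponent_isHomogeneous δ f).map _
  -- a point with nonzero first coordinate
  obtain ⟨u, hu⟩ : ∃ u : Fin (n+1) → ℚ, eval u (X 0 * h) ≠ 0 := by
    by_contra hcon
    push Not at hcon
    exact mul_ne_zero (X_ne_zero 0) hh0 (MvPolynomial.funext (fun u => by rw [hcon u, map_zero]))
  rw [map_mul, eval_X] at hu
  have hu0 := left_ne_zero_of_mul hu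
  let q : MvPolynomial (Fin n) ℚ := aeval (Fin.cons 1 (fun i => X i) : Fin (n+1) → MvPolynomial (Fin n) ℚ) h
  have hq : ∀ y, eval y q = eval (Fin.cons 1 y) h := by
    intro y
    rw [eval_aeval']
    congr 2
    funext i
    refine Fin.cases ?_ (fun i => ?_) i <;> simp
  have hq0 : q ≠ 0 := by
    intro h0
    have h1 := hq (fun i => u i.succ / u 0)
    rw [h0, map_zero] at h1
    have h2 := eval_homog hhom (u 0) (Fin.cons 1 (fun i => u i.succ / u 0))
    rw [← h1, mul_zero] at h2
    apply right_ne_zero_of_mul hu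
    rw [← h2]
    congr 2
    funext i
    refine Fin.cases ?_ (fun i => ?_) i
    · simp
    · simp [mul_div_cancel₀ _ hu0]
  have hqd : q.totalDegree ≤ δ := by
    refine (tdeg_aeval _ ?_ _).trans hhom.totalDegree_le
    intro i
    refine Fin.cases ?_ (fun i => ?_) i
    · simp
    · simpa using tdeg_X _
  obtain ⟨y, hy, hyq⟩ : ∃ y : Fin n → ℚ, (∀ i, y i ∈ (Finset.range (δ + 1)).image (fun m : ℕ => (m : ℚ))) ∧ eval y q ≠ 0 := by
    by_contra hcon
    push Not at hcon
    refine hq0 (eq_zero_of_eval_zero_at_prod_finset q (fun _ => (Finset.range (δ + 1)).image (fun m : ℕ => (m : ℚ))) (fun i => ?_) hcon)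
    rw [Finset.card_image_of_injective _ Nat.cast_injective, Finset.card_range]
    exact Nat.lt_succ_of_le ((degreeOf_le_totalDegree _ _).trans hqd)
  choose m hm hmy using fun i => Finset.mem_image.1 (hy i)
  refine ⟨fun i => m i, fun i => ?_, ?_⟩
  · have := Finset.mem_range.1 (hm i)
    change |((m i : ℕ) : ℤ)| ≤ _
    rw [Nat.abs_cast]
    exact_mod_cast Nat.le_of_lt_succ this
  · rw [coeff_top_subst _ (tdeg_shr_le _) le_rfl, ← hδ]
    intro h0
    apply hyq
    rw [hq, hh]
    have h3 := congrArg (Int.castRingHom ℚ) h0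
    rw [map_zero, eval₂_comp, ← eval_map] at h3
    rw [← h3]
    congr 2
    funext i
    refine Fin.cases ?_ (fun i => ?_) i
    · simp [shr]
    · simp only [Fin.cons_succ, shr, Function.comp]
      rw [← hmy i, coeff_add, coeff_C_mul, coeff_X, coeff_X, if_neg, if_pos rfl]
      · simp
      · rw [Finsupp.single_left_inj one_ne_zero]; exact Fin.succ_ne_zero i

end PartH1

section PartH2

attribute [local instance] Matrix.seminormedAddCommGroup

theorem card_support_le {n d : ℕ} {R : Type*} [CommRing R] {f : MvPolynomial (Fin n) R} (hd : f.totalDegree ≤ d) :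
    f.support.card ≤ (d + 1) ^ n := by
  classical
  have : f.support.card ≤ (Finset.univ : Finset (Fin n → Fin (d + 1))).card := by
    refine Finset.card_le_card_of_injOn (fun α i => Fin.ofNat (d + 1) (α i)) (fun _ _ => Finset.mem_univ _) ?_
    intro α hα β hβ h
    refine Finsupp.ext (fun i => ?_)
    have h1 : ∀ γ ∈ f.support, γ i < d + 1 := fun γ hγ =>
      Nat.lt_succ_of_le (((Finsupp.le_degree i γ)).trans ((le_totalDegree hγ).trans hd))
    have h2 := congrArg Fin.val (congrFun h i)
    simp only [Fin.val_ofNat] at h2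
    rwa [Nat.mod_eq_of_lt (h1 α hα), Nat.mod_eq_of_lt (h1 β hβ)] at h2
  simpa using this

theorem height_red {n d B : ℕ} {f : MvPolynomial (Fin n) ℤ} (hf : f ≠ 0) (hd : f.totalDegree ≤ d) (hB : 1 ≤ B)
    (S : Finset (Fin n → ℤ)) (hS : ∀ P ∈ S, eval P f = 0 ∧ ∀ i, |P i| ≤ B) :
    ∃ f' : MvPolynomial (Fin n) ℤ, f' ≠ 0 ∧ f'.totalDegree ≤ f.totalDegree ∧ (∀ P ∈ S, eval P f' = 0) ∧
      ∀ α, |coeff α f'| ≤ (((d + 1) ^ n * B ^ d) ^ ((d + 1) ^ n) : ℕ) := by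
  classical
  let M : Matrix S f.support ℤ := Matrix.of fun P j => eval (P : Fin n → ℤ) (monomial (j : Fin n →₀ ℕ) (1 : ℤ))
  let MQ : Matrix S f.support ℚ := M.map (Int.castRingHom ℚ)
  have hevs : ∀ (t : f.support → ℤ) (P : Fin n → ℤ), eval P (∑ j : f.support, monomial (j : Fin n →₀ ℕ) (t j)) =
      ∑ j : f.support, eval P (monomial (j : Fin n →₀ ℕ) (1 : ℤ)) * t j := by
    intro t P
    rw [map_sum]
    refine Finset.sum_congr rfl (fun j _ => ?_)
    rw [eval_monomial, eval_monomial]; ring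
  have hfs : ∑ j : f.support, monomial (j : Fin n →₀ ℕ) (coeff (j : Fin n →₀ ℕ) f) = f := by
    rw [Finset.sum_coe_sort f.support (fun j => monomial j (coeff j f))]
    exact support_sum_monomial_coeff f
  have hcs : ∀ (t : f.support → ℤ) (j : f.support), coeff (j : Fin n →₀ ℕ) (∑ j : f.support, monomial (j : Fin n →₀ ℕ) (t j)) = t j := by
    intro t j
    rw [coeff_sum, Finset.sum_eq_single j]
    · simp
    · intro b _ hb
      rw [coeff_monomial, if_neg (fun h => hb (Subtype.ext h))]
    · simp
  have hcs0 : ∀ (t : f.support → ℤ) (α : Fin n →₀ ℕ), α ∉ f.support → coeff α (∑ j : f.support, monomial (j : Fin n →₀ ℕ) (t j)) = 0 := by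
    intro t α hα
    rw [coeff_sum]
    refine Finset.sum_eq_zero (fun j _ => ?_)
    rw [coeff_monomial, if_neg (fun h : (j : Fin n →₀ ℕ) = α => hα (h ▸ j.2))]
  obtain ⟨κ, a, ha, hspan, hli⟩ := exists_linearIndependent' ℚ MQ.row
  have : Finite κ := Finite.of_injective a ha
  have : Fintype κ := Fintype.ofFinite κ
  have hMf : ∀ P : S, ∑ j, MQ P j * ((coeff (j : Fin n →₀ ℕ) f : ℤ) : ℚ) = 0 := by
    intro P
    have h := hevs (fun j => coeff (j : Fin n →₀ ℕ) f) P
    rw [hfs, (hS P P.2).1] at h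
    have h2 := congrArg (Int.cast : ℤ → ℚ) h
    push_cast at h2
    rw [h2]
    rfl
  have hcard : Fintype.card κ < Fintype.card f.support := by
    have hle := hli.fintype_card_le_finrank
    rw [Module.finrank_fintype_fun_eq_card] at hle
    refine lt_of_le_of_ne hle (fun heq => ?_)
    have htop : Submodule.span ℚ (Set.range (MQ.row ∘ a)) = ⊤ :=
      hli.span_eq_top_of_card_eq_finrank' (by rw [Module.finrank_fintype_fun_eq_card, heq])
    let φ : (f.support → ℚ) →ₗ[ℚ] ℚ := Fintype.linearCombination ℚ (fun j => ((coeff (j : Fin n →₀ ℕ) f : ℤ) : ℚ))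
    have hφ : Submodule.span ℚ (Set.range (MQ.row ∘ a)) ≤ LinearMap.ker φ := by
      rw [Submodule.span_le]
      rintro _ ⟨k, rfl⟩
      simp only [SetLike.mem_coe, LinearMap.mem_ker, φ, Fintype.linearCombination_apply, Function.comp]
      exact hMf (a k)
    rw [htop] at hφ
    obtain ⟨α, hα⟩ := support_nonempty.2 hf
    have h1 : φ (Pi.single ⟨α, hα⟩ 1) = 0 := hφ Submodule.mem_top
    simp only [φ, Fintype.linearCombination_apply_single, one_smul] at h1
    exact (mem_support_iff.1 hα) (by exact_mod_cast h1)
  have hB' : (1 : ℝ) ≤ B := by exact_mod_cast hB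
  have hrow : ∀ P : S, ∀ j : f.support, |M P j| ≤ (B : ℤ) ^ d := by
    intro P j
    refine (abs_eval_monomial_le _ _ B (hS P P.2).2).trans ?_
    exact pow_le_pow_right₀ (by exact_mod_cast hB) ((le_totalDegree j.2).trans hd)
  obtain ⟨t, ht0, htA, htn⟩ : ∃ t : f.support → ℤ, t ≠ 0 ∧ (M.submatrix a id).mulVec t = 0 ∧
      ∀ j, |t j| ≤ (((d + 1) ^ n * B ^ d) ^ ((d + 1) ^ n) : ℕ) := by
    by_cases hκ : 0 < Fintype.card κ
    swap
    · have : IsEmpty κ := Fintype.card_eq_zero_iff.1 (by omega)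
      obtain ⟨α, hα⟩ := support_nonempty.2 hf
      refine ⟨fun _ => 1, fun h => by simpa using congrFun h ⟨α, hα⟩, funext (fun k => isEmptyElim k), fun j => ?_⟩
      rw [abs_one]
      exact_mod_cast Nat.one_le_pow _ _ (by positivity)
    obtain ⟨t, ht0, htA, htn⟩ := Int.Matrix.exists_ne_zero_int_vec_norm_le (M.submatrix a id) hcard hκ
    refine ⟨t, ht0, htA, fun j0 => ?_⟩
    have h1 : |(t j0 : ℝ)| ≤ ‖t‖ := by
      have := norm_le_pi_norm t j0
      rwa [Int.norm_eq_abs] at this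
    have hA : max 1 ‖M.submatrix a id‖ ≤ (B : ℝ) ^ d := by
      refine max_le (one_le_pow₀ hB') ?_
      rw [Matrix.norm_le_iff (by positivity)]
      intro k j
      rw [Int.norm_eq_abs]
      exact_mod_cast hrow (a k) j
    have hs := card_support_le hd
    have hN : (Fintype.card f.support : ℝ) ≤ ((d + 1) ^ n : ℕ) := by
      rw [Fintype.card_coe]; exact_mod_cast hs
    have hmn : (Fintype.card κ : ℝ) + 1 ≤ Fintype.card f.support := by exact_mod_cast hcard
    have hbase : (Fintype.card f.support : ℝ) * max 1 ‖M.submatrix a id‖ ≤ ((d + 1) ^ n * B ^ d : ℕ) := by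
      push_cast at hN ⊢
      exact mul_le_mul hN hA (by positivity) (by positivity)
    have h1b : (1 : ℝ) ≤ Fintype.card f.support * max 1 ‖M.submatrix a id‖ :=
      one_le_mul_of_one_le_of_one_le (by linarith [show (0 : ℝ) ≤ Fintype.card κ from Nat.cast_nonneg _]) (le_max_left _ _)
    have hexp : (Fintype.card κ : ℝ) / (Fintype.card f.support - Fintype.card κ) ≤ ((d + 1) ^ n : ℕ) := by
      rw [div_le_iff₀ (by linarith)]
      have h0 : (0 : ℝ) ≤ ((d + 1) ^ n : ℕ) := Nat.cast_nonneg _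
      nlinarith
    have h2 := htn.trans (Real.rpow_le_rpow_of_exponent_le h1b hexp)
    rw [Real.rpow_natCast] at h2
    have h3 := h1.trans (h2.trans (pow_le_pow_left₀ (by linarith) hbase _))
    exact_mod_cast h3
  refine ⟨∑ j : f.support, monomial (j : Fin n →₀ ℕ) (t j), ?_, ?_, ?_, ?_⟩
  · intro h0
    apply ht0
    funext j
    rw [← hcs t j, h0]; simp
  · refine Finset.sup_mono ?_
    intro α hα
    by_contra hn
    exact (mem_support_iff.1 hα) (hcs0 t α hn)
  · intro P hP
    rw [hevs]
    let φ : (f.support → ℚ) →ₗ[ℚ] ℚ := Fintype.linearCombination ℚ (fun j => ((t j : ℤ) : ℚ))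
    have hφ : Submodule.span ℚ (Set.range (MQ.row ∘ a)) ≤ LinearMap.ker φ := by
      rw [Submodule.span_le]
      rintro _ ⟨k, rfl⟩
      simp only [SetLike.mem_coe, LinearMap.mem_ker, φ, Fintype.linearCombination_apply, Function.comp]
      have := congrArg (Int.cast : ℤ → ℚ) (congrFun htA k)
      simp only [Matrix.mulVec, dotProduct, Matrix.submatrix_apply, id, Pi.zero_apply] at this
      push_cast at this
      exact this
    rw [hspan] at hφ
    have h1 : φ (MQ.row ⟨P, hP⟩) = 0 := hφ (Submodule.subset_span ⟨_, rfl⟩)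
    simp only [φ, Fintype.linearCombination_apply, smul_eq_mul] at h1
    have h2 : ((∑ j : f.support, eval P (monomial (j : Fin n →₀ ℕ) (1 : ℤ)) * t j : ℤ) : ℚ) = 0 := by
      push_cast; exact h1
    exact_mod_cast h2
  · intro α
    by_cases hα : α ∈ f.support
    swap
    · rw [hcs0 t α hα, abs_zero]; positivity
    rw [show α = ((⟨α, hα⟩ : f.support) : Fin n →₀ ℕ) from rfl, hcs]
    exact htn _

end PartH2

section PartH3

theorem evc {K σ : Type*} [CommRing K] (f : MvPolynomial σ ℤ) (P : σ → ℤ) :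
    eval (fun i => (P i : K)) (map (Int.castRingHom K) f) = ((eval P f : ℤ) : K) := by
  rw [show (fun i => ((P i : ℤ) : K)) = Int.castRingHom K ∘ P from rfl, eval_map, ← eval₂_comp]; rfl

theorem pd_not_dvd {k : Type*} [Field k] [CharZero k] {n d : ℕ} {f : MvPolynomial (Fin (n+1)) k} (hd1 : 1 ≤ d)
    (hd : f.totalDegree ≤ d) (hc : coeff (Finsupp.single 0 d) f ≠ 0) : ¬ f ∣ pderiv 0 f := by
  classical
  refine not_dvd_of_degreeOf_lt hd hc ?_ ?_
  · intro h
    have h1 := congrArg (coeff (Finsupp.single 0 (d - 1))) h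
    rw [coeff_pderiv, ← Finsupp.single_add, Nat.sub_add_cancel hd1, coeff_zero] at h1
    refine (mul_ne_zero hc ?_) h1
    simp only [Finsupp.single_eq_same]
    exact_mod_cast (show d - 1 + 1 ≠ 0 by omega)
  · rw [degreeOf_lt_iff (by omega)]
    intro m hm
    rw [mem_support_iff, coeff_pderiv] at hm
    have := (le_totalDegree (mem_support_iff.2 (left_ne_zero_of_mul hm))).trans hd
    change (m + Finsupp.single 0 1).degree ≤ d at this
    have h2 := (Finsupp.le_degree 0 (m + Finsupp.single (0 : Fin (n+1)) 1)).trans this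
    simp at h2
    omega

theorem pool (m N : ℕ) (hN : 1 ≤ N) : ∃ W : Finset ℕ, W.card = m ∧ ∀ p ∈ W, p.Prime ∧ N < p ∧ p ≤ 2 ^ m * N := by
  classical
  induction m with
  | zero => exact ⟨∅, by simp, by simp⟩
  | succ m ih =>
    obtain ⟨W, hW, h⟩ := ih
    obtain ⟨p, hp, h1, h2⟩ := Nat.exists_prime_lt_and_le_two_mul (2 ^ m * N) (by positivity)
    have hpW : p ∉ W := fun hpW => by have := (h p hpW).2.2; omega
    refine ⟨insert p W, by rw [Finset.card_insert_of_notMem hpW, hW], ?_⟩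
    intro q hq
    rcases Finset.mem_insert.1 hq with rfl | hq
    · exact ⟨hp, lt_of_le_of_lt (Nat.le_mul_of_pos_left _ (by positivity)) h1, by rw [pow_succ]; linarith⟩
    · obtain ⟨a, b, c⟩ := h q hq
      exact ⟨a, b, c.trans (by rw [pow_succ]; nlinarith [Nat.zero_le (2 ^ m * N)])⟩

theorem few_bad {W : Finset ℕ} {N k : ℕ} (hN : 2 ≤ N) (hW : ∀ p ∈ W, p.Prime ∧ N < p) {A : ℤ} (hA : A ≠ 0)
    (hAk : |A| ≤ (N ^ k : ℕ)) : (W.filter (fun p : ℕ => (p : ℤ) ∣ A)).card ≤ k := by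
  set V := W.filter (fun p : ℕ => (p : ℤ) ∣ A) with hV
  have h1 : (∏ p ∈ V, p) ∣ A.natAbs := by
    refine Finset.prod_primes_dvd _ (fun p hp => ?_) (fun p hp => ?_)
    · exact (hW p (Finset.mem_filter.1 hp).1).1.prime
    · exact Int.natCast_dvd.1 (Finset.mem_filter.1 hp).2
  have h2 : N ^ V.card ≤ ∏ p ∈ V, p := by
    rw [← Finset.prod_const]
    exact Finset.prod_le_prod' (fun p hp => (hW p (Finset.mem_filter.1 hp).1).2.le)
  have h3 := Nat.le_of_dvd (Int.natAbs_pos.2 hA) h1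
  have h4 : A.natAbs ≤ N ^ k := by zify; exact_mod_cast hAk
  exact (Nat.pow_le_pow_iff_right (by omega)).1 (h2.trans (h3.trans h4))

theorem abs_eval_le {n d B H : ℕ} {g : MvPolynomial (Fin n) ℤ} (hd : g.totalDegree ≤ d) (hB : 1 ≤ B)
    (hg : ∀ α, |coeff α g| ≤ H) (P : Fin n → ℤ) (hP : ∀ i, |P i| ≤ B) :
    |eval P g| ≤ ((d + 1) ^ n * (H * B ^ d) : ℕ) := by
  conv_lhs => rw [g.as_sum, map_sum]
  refine (Finset.abs_sum_le_sum_abs _ _).trans ?_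
  have h1 : ∀ α ∈ g.support, |eval P (monomial α (coeff α g))| ≤ ((H * B ^ d : ℕ) : ℤ) := by
    intro α hα
    have h2 : eval P (monomial α (coeff α g)) = coeff α g * eval P (monomial α (1 : ℤ)) := by
      rw [eval_monomial, eval_monomial]; ring
    rw [h2, abs_mul]
    push_cast
    refine mul_le_mul (hg α) ((abs_eval_monomial_le _ _ B hP).trans ?_) (abs_nonneg _) (by positivity)
    exact pow_le_pow_right₀ (by exact_mod_cast hB) ((le_totalDegree hα).trans hd)
  refine (Finset.sum_le_card_nsmul _ _ _ h1).trans ?_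
  rw [nsmul_eq_mul]
  exact_mod_cast Nat.mul_le_mul_right _ (card_support_le hd)

theorem abs_coeff_pderiv {n d H : ℕ} {g : MvPolynomial (Fin n) ℤ} (hd : g.totalDegree ≤ d) (i : Fin n)
    (hg : ∀ α, |coeff α g| ≤ H) (α : Fin n →₀ ℕ) : |coeff α (pderiv i g)| ≤ (H * d : ℕ) := by
  rw [coeff_pderiv]
  by_cases h : coeff (α + Finsupp.single i 1) g = 0
  · rw [h, zero_mul, abs_zero]; positivity
  have h1 : (α + Finsupp.single i 1).degree ≤ d := (le_totalDegree (mem_support_iff.2 h)).trans hd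
  have h2 := (Finsupp.le_degree i (α + Finsupp.single i 1)).trans h1
  simp at h2
  rw [abs_mul]
  push_cast
  refine mul_le_mul (hg _) ?_ (abs_nonneg _) (by positivity)
  rw [abs_of_nonneg (by positivity)]
  exact_mod_cast h2

theorem bez_int {f : MvPolynomial (Fin 2) ℤ} {g : MvPolynomial (Fin 2) ℚ} (hf : Irreducible (map (Int.castRingHom ℚ) f))
    (hg : ¬ map (Int.castRingHom ℚ) f ∣ g) (S : Finset (Fin 2 → ℤ))
    (hS : ∀ P ∈ S, eval P f = 0 ∧ eval (fun i => (P i : ℚ)) g = 0) :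
    S.card ≤ f.totalDegree * g.totalDegree := by
  classical
  have h := bezout_points hf.ne_zero (fun h => hg (by rw [h]; exact dvd_zero _)) (hf.isRelPrime_iff_not_dvd.2 hg)
    (S.image (fun P i => (P i : ℚ))) (by
      intro Q hQ
      obtain ⟨P, hP, rfl⟩ := Finset.mem_image.1 hQ
      exact ⟨by rw [evc, (hS P hP).1, Int.cast_zero], (hS P hP).2⟩)
  rw [Finset.card_image_of_injective] at h
  · exact h.trans (Nat.mul_le_mul_right _ (tdeg_map_le _ _))
  · intro P Q h
    funext i
    have := congrFun h i
    exact Int.cast_injective this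

theorem height_red' {n d m L : ℕ} {f : MvPolynomial (Fin (n+1)) ℤ} (hd : f.totalDegree ≤ d)
    (hc : coeff (Finsupp.single 0 d) f ≠ 0) (hL : 2 ≤ L)
    (S : Finset (Fin (n+1) → ℤ)) (hS : ∀ P ∈ S, eval P f = 0 ∧ ∀ i, |P i| ≤ (L ^ m : ℕ)) :
    ∃ f' : MvPolynomial (Fin (n+1)) ℤ, f'.totalDegree ≤ d ∧ (∀ P ∈ S, eval P f' = 0) ∧
      (∀ α, |coeff α f'| ≤ (L ^ (((d + 1) ^ (n+1) + m * d) * (d + 1) ^ (n+1)) : ℕ)) ∧ f' ≠ 0 ∧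
      (¬ map (Int.castRingHom ℚ) f ∣ map (Int.castRingHom ℚ) f' ∨
        ∃ u : ℚ, u ≠ 0 ∧ map (Int.castRingHom ℚ) f' = C u * map (Int.castRingHom ℚ) f) := by
  have hf0 : f ≠ 0 := fun h => hc (by rw [h, coeff_zero])
  obtain ⟨f', h0, h1, h2, h3⟩ := height_red hf0 hd (Nat.one_le_pow m L (by omega)) S hS
  refine ⟨f', h1.trans hd, h2, fun α => (h3 α).trans ?_, h0, ?_⟩
  · rw [pow_mul L]
    refine Nat.cast_le.2 (Nat.pow_le_pow_left ?_ _)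
    rw [pow_add L, ← pow_mul]
    refine Nat.mul_le_mul_right _ ?_
    exact (Nat.lt_pow_self (show 1 < 2 by omega)).le.trans (Nat.pow_le_pow_left hL _)
  · by_cases hdv : map (Int.castRingHom ℚ) f ∣ map (Int.castRingHom ℚ) f'
    · right
      obtain ⟨q, hq⟩ := hdv
      have hinj : Function.Injective (map (Int.castRingHom ℚ) : MvPolynomial (Fin (n+1)) ℤ → _) :=
        map_injective _ (RingHom.injective_int _)
      have hf'0 : map (Int.castRingHom ℚ) f' ≠ 0 := fun h => h0 (hinj (by rw [h, map_zero]))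
      have hcQ : coeff (Finsupp.single 0 d) (map (Int.castRingHom ℚ) f) ≠ 0 := by
        rw [coeff_map]; exact fun h => hc (Int.cast_injective (α := ℚ) (by simpa using h))
      have hdQ : (map (Int.castRingHom ℚ) f).totalDegree = d := tdeg_eq ((tdeg_map_le _ _).trans hd) hcQ
      have hfQ0 : map (Int.castRingHom ℚ) f ≠ 0 := fun h => hcQ (by rw [h, coeff_zero])
      have hq0 : q ≠ 0 := by rintro rfl; exact hf'0 (by rw [hq, mul_zero])
      have hdeg : (map (Int.castRingHom ℚ) f').totalDegree ≤ d := (tdeg_map_le _ _).trans (h1.trans hd)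
      rw [hq, totalDegree_mul_of_isDomain hfQ0 hq0, hdQ] at hdeg
      have hqC := (totalDegree_eq_zero_iff_eq_C).1 (show q.totalDegree = 0 by omega)
      refine ⟨coeff 0 q, ?_, ?_⟩
      · intro h; rw [h, map_zero] at hqC; exact hq0 hqC
      · rw [hq, ← hqC, mul_comm]
    · exact Or.inl hdv

end PartH3

section PartH4

theorem poly_gen {n d m : ℕ} {ι : Type*} [Fintype ι] (ε : ι → (Fin (n+1) →₀ ℕ)) (hε : Function.Injective ε)
    (h0 : ∀ j, ε j 0 < d) (hm : ∀ j, (ε j).degree ≤ m) (c : ι → ℚ) (hc : c ≠ 0) :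
    (∑ j, monomial (ε j) (c j)) ≠ 0 ∧ (∑ j, monomial (ε j) (c j)).totalDegree ≤ m ∧
    degreeOf 0 (∑ j, monomial (ε j) (c j)) < d := by
  classical
  obtain ⟨j0, hj0⟩ := Function.ne_iff.1 hc
  have hsup : ∀ v ∈ (∑ j, monomial (ε j) (c j)).support, ∃ j, v = ε j := by
    intro v hv
    rw [mem_support_iff, coeff_sum] at hv
    obtain ⟨j, _, hj⟩ := Finset.exists_ne_zero_of_sum_ne_zero hv
    rw [coeff_monomial] at hj
    by_contra hcon
    push Not at hcon
    rw [if_neg (fun h => hcon j h.symm)] at hj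
    exact hj rfl
  refine ⟨fun h => hj0 ?_, ?_, ?_⟩
  · have h1 := congrArg (coeff (ε j0)) h
    rw [coeff_sum, Finset.sum_eq_single j0] at h1
    · simpa using h1
    · intro j _ hj
      rw [coeff_monomial, if_neg (fun h => hj (hε h))]
    · simp
  · refine Finset.sup_le (fun v hv => ?_)
    obtain ⟨j, rfl⟩ := hsup v hv
    exact hm j
  · rw [degreeOf_lt_iff (by have := h0 j0; omega)]
    intro v hv
    obtain ⟨j, rfl⟩ := hsup v hv
    exact h0 j

theorem bp_class {δ T L p : ℕ} (hδ : 2 ≤ δ) (hL : 2 ≤ L) [Fact p.Prime]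
    (hp : (δ * (4 * T + 4)).factorial * L ^ (T + 1) < p) {h : MvPolynomial (Fin 2) ℤ} (hd : h.totalDegree ≤ δ)
    (hc : coeff (Finsupp.single 0 δ) h ≠ 0) (hirr : Irreducible (map (Int.castRingHom ℚ) h)) (S : Finset (Fin 2 → ℤ))
    (hS : ∀ P ∈ S, eval P h = 0 ∧ ¬ (p : ℤ) ∣ eval P (pderiv 0 h) ∧ ∀ i, |P i| ≤ (L ^ (2 * T) : ℕ))
    (hcong : ∀ P ∈ S, ∀ Q ∈ S, ∀ l, (p : ℤ) ∣ P l - Q l) : S.card ≤ δ * (δ + (4 * T + 4)) := by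
  classical
  set D := 4 * T + 4 with hD
  let ε : Fin δ × Fin D → (Fin 2 →₀ ℕ) := fun j => Finsupp.single 0 (j.1 : ℕ) + Finsupp.single 1 (j.2 : ℕ)
  have hε0 : ∀ j, ε j 0 = j.1 := fun j => by simp [ε]
  have hε1 : ∀ j, ε j 1 = j.2 := fun j => by simp [ε]
  have hεd : ∀ j, (ε j).degree = (j.1 : ℕ) + j.2 := fun j => by
    rw [Finsupp.degree_eq_sum, Fin.sum_univ_two, hε0, hε1]
  have hinj : Function.Injective ε := by
    intro i j hij
    have h0 := DFunLike.congr_fun hij 0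
    have h1 := DFunLike.congr_fun hij 1
    rw [hε0, hε0] at h0
    rw [hε1, hε1] at h1
    exact Prod.ext (Fin.ext h0) (Fin.ext h1)
  rcases interp ε hinj S with ⟨c, hc0, hg⟩ | ⟨pts, -, hptS, hdet⟩
  · obtain ⟨h1, h2, h3⟩ := poly_gen ε hinj (d := δ) (m := δ + D) (fun j => by rw [hε0]; exact j.1.2)
      (fun j => by rw [hεd]; have := j.1.2; have := j.2.2; omega) c hc0
    have hcQ : coeff (Finsupp.single 0 δ) (map (Int.castRingHom ℚ) h) ≠ 0 := by
      rw [coeff_map]; exact fun h => hc (Int.cast_injective (α := ℚ) (by simpa using h))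
    have hnd := not_dvd_of_degreeOf_lt ((tdeg_map_le (Int.castRingHom ℚ) h).trans hd) hcQ h1 h3
    exact (bez_int hirr hnd S (fun P hP => ⟨(hS P hP).1, hg P hP⟩)).trans (Nat.mul_le_mul hd h2)
  exfalso
  set s := δ * D with hs
  have hcard : Fintype.card (Fin δ × Fin D) = s := by simp [hs]
  have hs1 : 1 ≤ s := Nat.mul_pos (by omega) (by omega)
  have hE2 : s * (s + 1) / 2 ≤ s * s := by
    have : s * (s + 1) ≤ 2 * (s * s) := by nlinarith
    omega
  set E := s * s - s * (s + 1) / 2 with hE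
  have hdvd : (p : ℤ) ^ E ∣ (Matrix.of fun i j => eval (pts i) (monomial (ε j) (1 : ℤ))).det := by
    refine det_dvd p h pts (fun j => monomial (ε j) 1) (fun i => (hS _ (hptS i)).1) Finset.univ
      (fun i _ => (hS _ (hptS i)).2.1) 1 ?_ s (s * (s + 1) / 2) _ (sumT1' _) ?_
    · rw [Finset.card_le_one]
      intro a ha b hb
      obtain ⟨i, _, rfl⟩ := Finset.mem_image.1 ha
      obtain ⟨j, _, rfl⟩ := Finset.mem_image.1 hb
      funext l
      rw [ZMod.intCast_eq_intCast_iff_dvd_sub]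
      exact hcong _ (hptS j) _ (hptS i) l
    · rw [Finset.card_univ, hcard]; omega
  have hle := Int.le_of_dvd (abs_pos.2 hdet) ((dvd_abs _ _).2 hdvd)
  have hub := det_le ε pts _ (fun i => (hS _ (hptS i)).2.2)
  have hfin := hle.trans hub
  rw [hcard] at hfin
  set Sd := ∑ j, (ε j).degree with hSg
  have hfin' : p ^ E ≤ s.factorial * (L ^ (2 * T)) ^ Sd := by exact_mod_cast hfin
  have hSg2 : 2 * Sd ≤ s * (δ + D) := by
    have h1 : Sd = (∑ i ∈ Finset.range δ, i) * D + δ * ∑ a ∈ Finset.range D, a := by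
      rw [hSg]
      simp_rw [hεd]
      rw [Fintype.sum_prod_type]
      simp only [Finset.sum_add_distrib, Finset.sum_const, Finset.card_univ, Fintype.card_fin, smul_eq_mul]
      rw [← Finset.mul_sum, Fin.sum_univ_eq_sum_range (fun i => i), Fin.sum_univ_eq_sum_range (fun i => i)]
      ring
    have h2 := Finset.sum_range_id_mul_two δ
    have h3 := Finset.sum_range_id_mul_two D
    have h4 : δ * (δ - 1) ≤ δ * δ := Nat.mul_le_mul_left _ (by omega)
    have h5 : D * (D - 1) ≤ D * D := Nat.mul_le_mul_left _ (by omega)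
    rw [h1, hs]
    nlinarith
  have hE3 : 2 * E = s * (s - 1) := by
    have he : 2 ∣ s * (s + 1) := even_iff_two_dvd.1 (Nat.even_mul_succ_self s)
    obtain ⟨w, hw⟩ := he
    have : s * (s + 1) / 2 = w := by omega
    obtain ⟨s', hs'⟩ : ∃ s', s = s' + 1 := ⟨s - 1, by omega⟩
    rw [hE, this, hs', Nat.add_sub_cancel]
    rw [hs'] at hw
    have : (s' + 1) * (s' + 1) - w = w - (s' + 1) := by
      have : (s' + 1) * (s' + 1 + 1) = (s' + 1) * (s' + 1) + (s' + 1) := by ring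
      omega
    rw [this]
    have : (s' + 1) * (s' + 1 + 1) = (s' + 1) * s' + 2 * (s' + 1) := by ring
    omega
  have hmain : 2 * T * Sd ≤ (T + 1) * E := by
    have h1 : 2 * T * (δ + D) ≤ (T + 1) * (s - 1) := by
      have : 2 * T * (δ + D) + (T + 1) ≤ (T + 1) * s := by
        rw [hs, hD]
        nlinarith [Nat.mul_le_mul_right (T * (4 * T + 4)) hδ, Nat.mul_le_mul_right (T + 4) hδ]
      obtain ⟨s', hs'⟩ : ∃ s', s = s' + 1 := ⟨s - 1, by omega⟩
      rw [hs'] at this ⊢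
      rw [Nat.add_sub_cancel]
      linarith
    have h2 := Nat.mul_le_mul_left s h1
    have h3 := Nat.mul_le_mul_left (2 * T) hSg2
    have h4 : (T + 1) * (2 * E) = (T + 1) * (s * (s - 1)) := by rw [hE3]
    have h5 : s * ((T + 1) * (s - 1)) = (T + 1) * (s * (s - 1)) := by ring
    have h6 : s * (2 * T * (δ + D)) = 2 * T * (s * (δ + D)) := by ring
    have h7 : 2 * T * (2 * Sd) = 2 * (2 * T * Sd) := by ring
    have h8 : (T + 1) * (2 * E) = 2 * ((T + 1) * E) := by ring
    omega
  have hE1 : 1 ≤ E := by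
    have h1 : 8 ≤ s := by rw [hs, hD]; nlinarith
    have : 1 ≤ s * (s - 1) := Nat.mul_pos (by omega) (by omega)
    omega
  have hlt : (s.factorial * L ^ (T + 1)) ^ E < p ^ E := Nat.pow_lt_pow_left hp (by omega)
  rw [mul_pow, ← pow_mul] at hlt
  rw [← pow_mul] at hfin'
  have h1 : s.factorial ≤ s.factorial ^ E := Nat.le_self_pow (by omega) _
  have h2 : L ^ (2 * T * Sd) ≤ L ^ ((T + 1) * E) := Nat.pow_le_pow_right (by omega) hmain
  exact absurd (Nat.mul_le_mul h1 h2) (by omega)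

end PartH4

section PartH5

theorem abs_A {n d c m L : ℕ} (hL : 2 ≤ L) {f : MvPolynomial (Fin (n+1)) ℤ} (hd : f.totalDegree ≤ d)
    (hH : ∀ α, |coeff α f| ≤ (L ^ c : ℕ)) (P : Fin (n+1) → ℤ) (hP : ∀ i, |P i| ≤ (L ^ m : ℕ)) :
    |coeff (Finsupp.single 0 d) f * eval P (pderiv 0 f)| ≤ (L ^ ((d + 1) ^ (n+1) * d + 2 * c + m * d) : ℕ) := by
  have h1 := abs_eval_le ((tdeg_pderiv 0 f).trans hd) (Nat.one_le_pow m L (by omega))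
    (abs_coeff_pderiv hd 0 hH) P hP
  rw [abs_mul]
  refine (mul_le_mul (hH _) h1 (abs_nonneg _) (by positivity)).trans ?_
  norm_cast
  have h2 : (d + 1) ^ (n+1) * d ≤ L ^ ((d + 1) ^ (n+1) * d) :=
    (Nat.lt_pow_self (show 1 < 2 by omega)).le.trans (Nat.pow_le_pow_left hL _)
  calc L ^ c * ((d + 1) ^ (n+1) * (L ^ c * d * (L ^ m) ^ d)) = ((d + 1) ^ (n+1) * d) * L ^ (2 * c + m * d) := by
        rw [pow_add L, mul_comm 2 c, pow_mul, pow_mul]; ring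
    _ ≤ _ := by rw [add_assoc, pow_add L ((d + 1) ^ (n+1) * d)]; exact Nat.mul_le_mul_right _ h2

theorem card_classes {n d p : ℕ} [Fact p.Prime] {f : MvPolynomial (Fin (n+1)) ℤ} (hd : f.totalDegree ≤ d)
    (hc : ¬ (p : ℤ) ∣ coeff (Finsupp.single 0 d) f) (S : Finset (Fin (n+1) → ℤ)) (hS : ∀ P ∈ S, eval P f = 0) :
    (S.image (fun P l => (P l : ZMod p))).card ≤ d * p ^ n := by
  classical
  refine (card_tails (f := map (Int.castRingHom (ZMod p)) f) ((tdeg_map_le _ _).trans hd) ?_ Finset.univ _ ?_).trans ?_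
  · rw [coeff_map]
    exact fun h => hc ((ZMod.intCast_zmod_eq_zero_iff_dvd _ _).1 h)
  · intro Q hQ
    obtain ⟨P, hP, rfl⟩ := Finset.mem_image.1 hQ
    exact ⟨by rw [evc, hS P hP, Int.cast_zero], Finset.mem_univ _⟩
  · simp [ZMod.card]

theorem bp_small (δ T c : ℕ) (hδ : 2 ≤ δ) : ∃ C : ℕ, ∀ L, 2 ≤ L → ∀ h : MvPolynomial (Fin 2) ℤ, h.totalDegree ≤ δ →
    coeff (Finsupp.single 0 δ) h ≠ 0 → Irreducible (map (Int.castRingHom ℚ) h) →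
    (∀ α, |coeff α h| ≤ (L ^ c : ℕ)) → ∀ S : Finset (Fin 2 → ℤ),
    (∀ P ∈ S, eval P h = 0 ∧ ∀ i, |P i| ≤ (L ^ (2 * T) : ℕ)) → S.card ≤ C * L ^ (T + 1) := by
  classical
  set k := (δ + 1) ^ 2 * δ + 2 * c + 2 * T * δ with hk
  set F := (δ * (4 * T + 4)).factorial with hF
  have hF1 : 1 ≤ F := Nat.factorial_pos _
  refine ⟨δ * δ + (k + 1) * (δ * (δ + (4 * T + 4)) * (δ * (2 ^ (k + 1) * F))), fun L hL h hd hc hirr hH S hS => ?_⟩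
  have hLT : 1 ≤ L ^ (T + 1) := Nat.one_le_pow _ _ (by omega)
  have hLL : L ≤ L ^ (T + 1) := Nat.le_self_pow (by omega) L
  have hN2 : L ≤ F * L ^ (T + 1) := hLL.trans (Nat.le_mul_of_pos_left _ hF1)
  obtain ⟨W, hWc, hW⟩ := pool (k + 1) (F * L ^ (T + 1)) (by omega)
  have hcQ : coeff (Finsupp.single 0 δ) (map (Int.castRingHom ℚ) h) ≠ 0 := by
    rw [coeff_map]; exact fun h => hc (Int.cast_injective (α := ℚ) (by simpa using h))
  have h0 : (S.filter (fun P => eval P (pderiv 0 h) = 0)).card ≤ δ * δ := by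
    refine (bez_int hirr (pd_not_dvd (by omega) ((tdeg_map_le _ _).trans hd) hcQ) _ ?_).trans
      (Nat.mul_le_mul hd ((tdeg_pderiv _ _).trans ((tdeg_map_le _ _).trans hd)))
    intro P hP
    rw [Finset.mem_filter] at hP
    refine ⟨(hS P hP.1).1, ?_⟩
    rw [pderiv_map, evc, hP.2, Int.cast_zero]
  set S' := S.filter (fun P => ¬ eval P (pderiv 0 h) = 0) with hS'
  let G : ℕ → Finset (Fin 2 → ℤ) := fun p => S'.filter (fun P => ¬ (p : ℤ) ∣ coeff (Finsupp.single 0 δ) h * eval P (pderiv 0 h))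
  have hsub : S' ⊆ W.biUnion G := by
    intro P hP
    rw [Finset.mem_biUnion]
    by_contra hcon
    push Not at hcon
    have hP2 := Finset.mem_filter.1 hP
    have hA := few_bad (k := k) (by omega) (fun p hp => ⟨(hW p hp).1, (hW p hp).2.1⟩) (mul_ne_zero hc hP2.2) ((abs_A hL hd hH P (hS P hP2.1).2).trans
        (Nat.cast_le.2 (Nat.pow_le_pow_left hN2 k)))
    rw [Finset.filter_true_of_mem, hWc] at hA
    · omega
    · intro p hp
      by_contra hnd
      exact hcon p hp (Finset.mem_filter.2 ⟨hP, hnd⟩)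
  have hG : ∀ p ∈ W, (G p).card ≤ δ * (δ + (4 * T + 4)) * (δ * (2 ^ (k + 1) * F)) * L ^ (T + 1) := by
    intro p hp
    obtain ⟨hpp, hp1, hp2⟩ := hW p hp
    haveI : Fact p.Prime := ⟨hpp⟩
    have hGS : ∀ P ∈ G p, P ∈ S ∧ ¬ (p : ℤ) ∣ coeff (Finsupp.single 0 δ) h ∧ ¬ (p : ℤ) ∣ eval P (pderiv 0 h) := by
      intro P hP
      have h1 := Finset.mem_filter.1 hP
      exact ⟨(Finset.mem_filter.1 h1.1).1, fun h => h1.2 (dvd_mul_of_dvd_left h _), fun h => h1.2 (dvd_mul_of_dvd_right h _)⟩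
    rcases (G p).eq_empty_or_nonempty with he | ⟨P0, hP0⟩
    · rw [he]; simp
    have hcl := card_classes (p := p) hd (hGS P0 hP0).2.1 (G p) (fun P hP => (hS P (hGS P hP).1).1)
    have := Finset.card_le_mul_card_image (f := fun (P : Fin 2 → ℤ) l => (P l : ZMod p)) (G p) (δ * (δ + (4 * T + 4))) (by
      intro b _
      refine bp_class hδ hL hp1 hd hc hirr _ ?_ ?_
      · intro P hP
        have hP := (Finset.mem_filter.1 hP).1
        exact ⟨(hS P (hGS P hP).1).1, (hGS P hP).2.2, (hS P (hGS P hP).1).2⟩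
      · intro P hP Q hQ l
        have h1 := (Finset.mem_filter.1 hP).2
        have h2 := (Finset.mem_filter.1 hQ).2
        rw [← ZMod.intCast_eq_intCast_iff_dvd_sub]
        exact congrFun (h2.trans h1.symm) l)
    refine this.trans ?_
    rw [mul_assoc _ (δ * _)]
    refine Nat.mul_le_mul_left _ (hcl.trans ?_)
    rw [pow_one, mul_assoc δ]
    refine Nat.mul_le_mul_left _ (hp2.trans (le_of_eq (by ring)))
  have h3 := (Finset.card_le_card hsub).trans (Finset.card_biUnion_le_card_mul _ _ _ hG)
  rw [hWc] at h3
  have h4 := Finset.card_filter_add_card_filter_not (s := S) (fun P => eval P (pderiv 0 h) = 0)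
  rw [← hS'] at h4
  have h5 : δ * δ ≤ δ * δ * L ^ (T + 1) := Nat.le_mul_of_pos_right _ hLT
  rw [add_mul, mul_assoc (k + 1)]
  omega

theorem bp_irr (δ T : ℕ) (hδ : 2 ≤ δ) : ∃ C : ℕ, ∀ L, 2 ≤ L → ∀ h : MvPolynomial (Fin 2) ℤ, h.totalDegree ≤ δ →
    coeff (Finsupp.single 0 δ) h ≠ 0 → Irreducible (map (Int.castRingHom ℚ) h) → ∀ S : Finset (Fin 2 → ℤ),
    (∀ P ∈ S, eval P h = 0 ∧ ∀ i, |P i| ≤ (L ^ (2 * T) : ℕ)) → S.card ≤ C * L ^ (T + 1) := by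
  obtain ⟨C0, hC⟩ := bp_small δ T (((δ + 1) ^ (1+1) + 2 * T * δ) * (δ + 1) ^ (1+1)) hδ
  refine ⟨δ * δ + C0, fun L hL h hd hc hirr S hS => ?_⟩
  have hLT : 1 ≤ L ^ (T + 1) := Nat.one_le_pow _ _ (by omega)
  obtain ⟨f', h1, h2, h3, h4, h5⟩ := height_red' hd hc hL S hS
  rw [add_mul]
  rcases h5 with h5 | ⟨u, hu, h5⟩
  · have := (bez_int hirr h5 S (fun P hP => ⟨(hS P hP).1, by rw [evc, h2 P hP, Int.cast_zero]⟩)).trans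
      (Nat.mul_le_mul hd ((tdeg_map_le _ _).trans h1))
    nlinarith [Nat.zero_le (C0 * L ^ (T + 1)), Nat.zero_le (δ * δ)]
  · have h6 : Irreducible (map (Int.castRingHom ℚ) f') := by
      rw [h5]
      exact (irreducible_isUnit_mul ((isUnit_iff_ne_zero.2 hu).map C)).2 hirr
    have h7 : coeff (Finsupp.single 0 δ) f' ≠ 0 := by
      intro h0
      have := congrArg (coeff (Finsupp.single 0 δ)) h5
      rw [coeff_map, h0, map_zero, coeff_C_mul, coeff_map] at this
      exact mul_ne_zero hu (fun h => hc (Int.cast_injective (α := ℚ) (by simpa using h))) this.symm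
    have := hC L hL f' h1 h7 h6 h3 S (fun P hP => ⟨h2 P hP, (hS P hP).2⟩)
    omega

end PartH5

section PartH6

theorem clear_den {σ : Type*} (h : MvPolynomial σ ℚ) : ∃ (h' : MvPolynomial σ ℤ) (u : ℚ), u ≠ 0 ∧
    map (Int.castRingHom ℚ) h' = C u * h := by
  obtain ⟨b, hb⟩ := IsLocalization.exist_integer_multiples_of_finset (nonZeroDivisors ℤ) h.coeffs
  have hb0 : ((b : ℤ) : ℚ) ≠ 0 := by exact_mod_cast nonZeroDivisors.coe_ne_zero b
  have : C ((b : ℤ) : ℚ) * h ∈ Set.range (MvPolynomial.map (σ := σ) (Int.castRingHom ℚ)) := by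
    rw [mem_range_map_iff_coeffs_subset]
    intro a ha
    obtain ⟨m, hm, rfl⟩ := mem_coeffs_iff.1 ha
    rw [coeff_C_mul]
    rw [mem_support_iff, coeff_C_mul] at hm
    obtain ⟨c, hc⟩ := hb (coeff m h) (coeff_mem_coeffs m (right_ne_zero_of_mul hm))
    refine ⟨c, ?_⟩
    rw [zsmul_eq_mul] at hc
    exact hc
  obtain ⟨h', hh⟩ := this
  exact ⟨h', _, hb0, hh⟩

theorem tdeg_map_eq {σ R S : Type*} [CommRing R] [CommRing S] {φ : R →+* S} (hφ : Function.Injective φ)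
    (f : MvPolynomial σ R) : (map φ f).totalDegree = f.totalDegree := by
  rw [totalDegree, totalDegree, support_map_of_injective _ hφ]

theorem factors {k σ : Type*} [Field k] (r : MvPolynomial σ k) (hr : r ≠ 0) : ∃ H : Finset (MvPolynomial σ k),
    H.card ≤ r.totalDegree ∧ (∀ h ∈ H, Irreducible h ∧ h ∣ r) ∧ ∀ P, eval P r = 0 → ∃ h ∈ H, eval P h = 0 := by
  classical
  induction hn : r.totalDegree using Nat.strong_induction_on generalizing r with
  | _ n ih =>
    by_cases hu : IsUnit r
    · exact ⟨∅, by simp, by simp, fun P hP => ((hu.map (eval P)).ne_zero hP).elim⟩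
    obtain ⟨h, hh, g, rfl⟩ := WfDvdMonoid.exists_irreducible_factor hu hr
    have hg0 := right_ne_zero_of_mul hr
    have h1 := one_le_tdeg hh.ne_zero hh.not_isUnit
    rw [totalDegree_mul_of_isDomain hh.ne_zero hg0] at hn
    obtain ⟨H, a, b, c⟩ := ih g.totalDegree (by omega) g hg0 rfl
    refine ⟨insert h H, (Finset.card_insert_le _ _).trans (by omega), ?_, ?_⟩
    · intro x hx
      rcases Finset.mem_insert.1 hx with rfl | hx
      · exact ⟨hh, dvd_mul_right _ _⟩
      · exact ⟨(b x hx).1, (b x hx).2.mul_left _⟩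
    · intro P hP
      rw [map_mul] at hP
      rcases mul_eq_zero.1 hP with hP | hP
      · exact ⟨h, Finset.mem_insert_self _ _, hP⟩
      · obtain ⟨x, hx, hx2⟩ := c P hP
        exact ⟨x, Finset.mem_insert_of_mem hx, hx2⟩

theorem shp_inj {R : Type*} [CommRing R] {n : ℕ} (v : Fin n → ℤ) : Function.Injective (shp (R := R) v) := by
  intro P Q h
  have h1 := shp_neg (-v) P
  have h2 := shp_neg (-v) Q
  rw [neg_neg] at h1 h2
  rw [← h1, ← h2, h]

theorem shp_box {n : ℕ} {d B : ℕ} {v : Fin n → ℤ} (hv : ∀ i, |v i| ≤ d) {P : Fin (n+1) → ℤ} (hP : ∀ i, |P i| ≤ B) (i) :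
    |shp v P i| ≤ ((d + 1) * B : ℕ) := by
  have hdB : (0 : ℤ) ≤ d * B := by positivity
  push_cast
  refine Fin.cases ?_ (fun i => ?_) i
  · have := hP 0
    simp only [shp, Fin.cons_zero]
    linarith
  · simp only [shp, Fin.cons_succ, Int.cast_id]
    have h1 := abs_add_le (P i.succ) (v i * P 0)
    rw [abs_mul] at h1
    have h2 := mul_le_mul (hv i) (hP 0) (abs_nonneg _) (by positivity)
    linarith [hP i.succ]

theorem box_up {d L T : ℕ} (hT : 1 ≤ T) : (d + 1) * L ^ (2 * T) ≤ ((d + 1) * L) ^ (2 * T) := by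
  rw [mul_pow]
  exact Nat.mul_le_mul_right _ (Nat.le_self_pow (by omega) _)

theorem bp0 (Δ T : ℕ) (hT : 1 ≤ T) : ∃ C : ℕ, ∀ L, 2 ≤ L → ∀ h : MvPolynomial (Fin 2) ℚ, Irreducible h →
    2 ≤ h.totalDegree → h.totalDegree ≤ Δ → ∀ S : Finset (Fin 2 → ℤ),
    (∀ P ∈ S, eval (fun i => (P i : ℚ)) h = 0 ∧ ∀ i, |P i| ≤ (L ^ (2 * T) : ℕ)) → S.card ≤ C * L ^ (T + 1) := by
  classical
  choose! c hc using fun δ (hδ : 2 ≤ δ) => bp_irr δ T hδ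
  refine ⟨∑ δ ∈ Finset.range (Δ + 1), c δ * (δ + 1) ^ (T + 1), fun L hL h hirr hd1 hd2 S hS => ?_⟩
  obtain ⟨h', u, hu, hh⟩ := clear_den h
  have hiC : IsUnit (C u : MvPolynomial (Fin 2) ℚ) := (isUnit_iff_ne_zero.2 hu).map C
  have hirr' : Irreducible (map (Int.castRingHom ℚ) h') := by
    rw [hh]; exact (irreducible_isUnit_mul hiC).2 hirr
  have hdeg : h'.totalDegree = h.totalDegree := by
    rw [← tdeg_map_eq (RingHom.injective_int (Int.castRingHom ℚ)) h', hh,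
      totalDegree_mul_of_isDomain hiC.ne_zero hirr.ne_zero, totalDegree_C, zero_add]
  have h'0 : h' ≠ 0 := by rintro rfl; exact hirr'.ne_zero (map_zero _)
  obtain ⟨v, hv, hv2⟩ := shear_exists h'0
  set δ := h'.totalDegree with hδ
  have key := hc δ (by omega) ((δ + 1) * L) (by nlinarith) (aeval (shr (R := ℤ) v) h') (tdeg_shr v h') hv2
    (by rw [map_shr]; exact irr_shr v hirr') (S.image (shp (-v))) (by
      intro Q hQ
      obtain ⟨P, hP, rfl⟩ := Finset.mem_image.1 hQ
      refine ⟨?_, fun i => (shp_box (d := δ) (fun i => by simpa using hv i) (hS P hP).2 i).trans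
        (Nat.cast_le.2 (box_up hT))⟩
      rw [eval_shr, shp_neg]
      have h1 := evc (K := ℚ) h' P
      rw [hh, map_mul, (hS P hP).1, mul_zero] at h1
      exact_mod_cast h1.symm)
  rw [Finset.card_image_of_injective _ (shp_inj _)] at key
  refine key.trans ?_
  rw [mul_pow, ← mul_assoc]
  exact Nat.mul_le_mul_right _ (Finset.single_le_sum (f := fun δ => c δ * (δ + 1) ^ (T + 1)) (fun _ _ => Nat.zero_le _)
    (Finset.mem_range.2 (by omega)))

theorem bp (Δ T : ℕ) (hT : 1 ≤ T) : ∃ C : ℕ, ∀ L, 2 ≤ L → ∀ F : MvPolynomial (Fin 2) ℚ, F ≠ 0 → F.totalDegree ≤ Δ →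
    ∀ S : Finset (Fin 2 → ℤ), (∀ P ∈ S, eval (fun i => (P i : ℚ)) F = 0 ∧ (∀ i, |P i| ≤ (L ^ (2 * T) : ℕ)) ∧
      ∀ l, l ∣ F → l.totalDegree = 1 → eval (fun i => (P i : ℚ)) l ≠ 0) → S.card ≤ C * L ^ (T + 1) := by
  classical
  obtain ⟨c, hc⟩ := bp0 Δ T hT
  refine ⟨Δ * c, fun L hL F hF hd S hS => ?_⟩
  obtain ⟨H, h1, h2, h3⟩ := factors F hF
  have hsub : S ⊆ H.biUnion (fun h => S.filter (fun P => eval (fun i => (P i : ℚ)) h = 0)) := by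
    intro P hP
    obtain ⟨h, hh, hP2⟩ := h3 _ (hS P hP).1
    exact Finset.mem_biUnion.2 ⟨h, hh, Finset.mem_filter.2 ⟨hP, hP2⟩⟩
  refine (Finset.card_le_card hsub).trans ((Finset.card_biUnion_le_card_mul _ _ (c * L ^ (T + 1)) ?_).trans ?_)
  · intro h hh
    rcases Finset.eq_empty_or_nonempty (S.filter (fun P => eval (fun i => (P i : ℚ)) h = 0)) with he | ⟨P0, hP0⟩
    · rw [he]; simp
    rw [Finset.mem_filter] at hP0
    have hd1 := one_le_tdeg (h2 h hh).1.ne_zero (h2 h hh).1.not_isUnit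
    have hd2 : h.totalDegree ≠ 1 := fun h1 => (hS P0 hP0.1).2.2 h (h2 h hh).2 h1 hP0.2
    obtain ⟨g, hg⟩ := (h2 h hh).2
    have hd3 : h.totalDegree ≤ F.totalDegree := by
      rw [hg, totalDegree_mul_of_isDomain (h2 h hh).1.ne_zero (by rintro rfl; exact hF (by rw [hg, mul_zero]))]
      omega
    refine hc L hL h (h2 h hh).1 (by omega) (by omega) _ (fun P hP => ?_)
    rw [Finset.mem_filter] at hP
    exact ⟨hP.2, (hS P hP.1).2.1⟩
  · rw [mul_assoc]
    exact Nat.mul_le_mul_right _ (h1.trans hd)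

end PartH6

section PartI1

theorem dvd_eval_zero {k σ : Type*} [CommRing k] {f a : MvPolynomial σ k} {P : σ → k} (hP : eval P f = 0) (h : f ∣ a) :
    eval P a = 0 := by
  obtain ⟨b, rfl⟩ := h
  rw [map_mul, hP, zero_mul]

theorem exists_frac {k σ : Type} [Field k] {f : MvPolynomial σ k} (hf : Irreducible f) :
    ∃ (K : Type) (_ : Field K) (π : MvPolynomial σ k →+* K), (∀ a, π a = 0 ↔ f ∣ a) ∧
      ∀ p : Polynomial K, ∃ (q : Polynomial (MvPolynomial σ k)) (s : MvPolynomial σ k), ¬ f ∣ s ∧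
        q.map π = Polynomial.C (π s) * p := by
  let I := Ideal.span {f}
  haveI : I.IsPrime := (Ideal.span_singleton_prime hf.ne_zero).2 hf.prime
  let A := MvPolynomial σ k ⧸ I
  let K := FractionRing A
  let π : MvPolynomial σ k →+* K := (algebraMap A K).comp (Ideal.Quotient.mk I)
  have h0 : ∀ a, π a = 0 ↔ f ∣ a := by
    intro a
    rw [← Ideal.mem_span_singleton, ← Ideal.Quotient.eq_zero_iff_mem, RingHom.comp_apply]
    exact map_eq_zero_iff _ (IsFractionRing.injective A K)
  refine ⟨K, inferInstance, π, h0, fun p => ?_⟩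
  obtain ⟨b, hb⟩ := IsLocalization.integerNormalization_map_to_map (nonZeroDivisors A) p
  obtain ⟨q, hq⟩ := Polynomial.map_surjective (Ideal.Quotient.mk I) Ideal.Quotient.mk_surjective
    (IsLocalization.integerNormalization (nonZeroDivisors A) p)
  obtain ⟨s, hs⟩ := Ideal.Quotient.mk_surjective (b : A)
  refine ⟨q, s, ?_, ?_⟩
  · rw [← Ideal.mem_span_singleton, ← Ideal.Quotient.eq_zero_iff_mem, hs]
    exact nonZeroDivisors.coe_ne_zero b
  · rw [← Polynomial.map_map, hq, hb, RingHom.comp_apply, hs, ← Polynomial.smul_eq_C_mul]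
    exact (algebraMap_smul K (b : A) p).symm

theorem elim_m {k σ : Type} [Field k] [IsAlgClosed k] {f : MvPolynomial σ k} (hf : Irreducible f) (N e : ℕ)
    (ψ : ℕ → Polynomial (MvPolynomial σ k)) (h1 : ∀ j i, ((ψ j).coeff i).totalDegree ≤ e)
    (h2 : ∀ j, (ψ j).natDegree ≤ e) :
    (∃ E, ¬ f ∣ E ∧ E.totalDegree ≤ 2 * e * e + e ∧ ∀ P, eval P f = 0 → ∀ μ,
      (∀ j < N, ((ψ j).map (eval P)).eval μ = 0) → eval P E = 0) ∨
    (∃ Q, ¬ f ∣ Q ∧ ∀ P, eval P f = 0 → eval P Q ≠ 0 → ∃ μ, ∀ j < N, ((ψ j).map (eval P)).eval μ = 0) := by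
  classical
  obtain ⟨K, _, π, hπ, hcl⟩ := exists_frac hf
  obtain ⟨Ω, _, _, _, _⟩ : ∃ (Ω : Type) (_ : Field Ω) (_ : Algebra K Ω) (_ : IsAlgClosed Ω), Algebra.IsAlgebraic K Ω :=
    ⟨AlgebraicClosure K, inferInstance, inferInstance, inferInstance, inferInstance⟩
  let ι : k →+* Ω := (algebraMap K Ω).comp (π.comp C)
  by_cases hβ : ∃ β : Ω, ∀ j < N, Polynomial.aeval β ((ψ j).map π) = 0
  · right
    obtain ⟨β, hβ⟩ := hβ
    have hdv : ∀ j < N, ∃ H, (ψ j).map π = minpoly K β * H := fun j hj => minpoly.dvd K β (hβ j hj)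
    choose! H hH using hdv
    obtain ⟨G, s0, hs0, hG⟩ := hcl (minpoly K β)
    choose H' s hs hH' using fun j => hcl (H j)
    have hint : IsIntegral K β := Algebra.IsIntegral.isIntegral β
    set n := (minpoly K β).natDegree with hn
    have hn1 : 0 < n := minpoly.natDegree_pos hint
    have hlc : π (G.coeff n) = π s0 := by
      rw [← Polynomial.coeff_map, hG, Polynomial.coeff_C_mul, hn, Polynomial.coeff_natDegree,
        (minpoly.monic hint).leadingCoeff, mul_one]
    refine ⟨G.coeff n * (s0 * ∏ j ∈ Finset.range N, s j), ?_, fun P hP hQ => ?_⟩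
    · have hp := hf.prime
      intro h
      rcases hp.dvd_or_dvd h with h | h
      · rw [← hπ, hlc, hπ] at h; exact hs0 h
      rcases hp.dvd_or_dvd h with h | h
      · exact hs0 h
      · obtain ⟨j, _, hj⟩ := (Prime.dvd_finsetProd_iff hp _).1 h
        exact hs j hj
    · rw [map_mul, map_mul, map_prod] at hQ
      have hq1 := left_ne_zero_of_mul hQ
      have hq2 := left_ne_zero_of_mul (right_ne_zero_of_mul hQ)
      have hq3 := right_ne_zero_of_mul (right_ne_zero_of_mul hQ)
      rw [Finset.prod_ne_zero_iff] at hq3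
      have hdeg : (G.map (eval P)).degree ≠ 0 := by
        intro h0
        have h1 : (G.map (eval P)).natDegree = 0 := Polynomial.natDegree_eq_of_degree_eq_some h0
        have h2 := Polynomial.coeff_eq_zero_of_natDegree_lt (p := G.map (eval P)) (n := n) (by omega)
        rw [Polynomial.coeff_map] at h2
        exact hq1 h2
      obtain ⟨μ, hμ⟩ := IsAlgClosed.exists_root _ hdeg
      refine ⟨μ, fun j hj => ?_⟩
      have key : (Polynomial.C (s0 * s j) * ψ j).map π = (G * H' j).map π := by
        rw [Polynomial.map_mul, Polynomial.map_mul, hG, hH', hH j hj, Polynomial.map_C, map_mul, Polynomial.C_mul]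
        ring
      have key2 : (Polynomial.C (s0 * s j) * ψ j).map (eval P) = (G * H' j).map (eval P) := by
        ext i
        have h3 := congrArg (fun q => Polynomial.coeff q i) key
        simp only [Polynomial.coeff_map] at h3 ⊢
        rw [← sub_eq_zero, ← map_sub, hπ] at h3
        have h4 := dvd_eval_zero hP h3
        rw [map_sub, sub_eq_zero] at h4
        exact h4
      have h5 := congrArg (Polynomial.eval μ) key2
      rw [Polynomial.map_mul, Polynomial.map_mul, Polynomial.eval_mul, Polynomial.eval_mul, hμ.eq_zero, zero_mul,
        Polynomial.map_C, Polynomial.eval_C, map_mul] at h5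
      exact (mul_eq_zero.1 h5).resolve_left (mul_ne_zero hq2 (hq3 j (Finset.mem_range.2 hj)))
  · left
    push Not at hβ
    obtain ⟨a, haN, ha⟩ := hβ 0
    have ha0 : (ψ a).map π ≠ 0 := fun h => ha (by rw [h, map_zero])
    -- generic combination
    let R : Ω → Polynomial Ω := fun β => ∑ j ∈ Finset.range N, Polynomial.monomial j (Polynomial.aeval β ((ψ j).map π))
    have hR : ∀ β, R β ≠ 0 := by
      intro β h
      obtain ⟨j, hj, hj2⟩ := hβ β
      have := congrArg (fun q => Polynomial.coeff q j) h
      simp only [R, Polynomial.finsetSum_coeff, Polynomial.coeff_monomial, Polynomial.coeff_zero] at this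
      rw [Finset.sum_ite_eq' (Finset.range N) j, if_pos (Finset.mem_range.2 hj)] at this
      exact hj2 this
    let Bad : Finset Ω := (((ψ a).map π).aroots Ω).toFinset.biUnion (fun β => (R β).roots.toFinset)
    obtain ⟨c, hc⟩ := Set.Infinite.nonempty ((Finset.finite_toSet Bad).preimage (f := ι) ι.injective.injOn).infinite_compl
    let g : Polynomial (MvPolynomial σ k) := ∑ j ∈ Finset.range N, Polynomial.C (C (c ^ j)) * ψ j
    have hco : IsCoprime ((ψ a).map π) (g.map π) := by
      rw [Polynomial.isCoprime_iff_aeval_ne_zero_of_isAlgClosed K Ω]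
      intro β
      by_contra hcon
      push Not at hcon
      apply hc
      rw [Set.mem_preimage, Finset.mem_coe, Finset.mem_biUnion]
      refine ⟨β, Multiset.mem_toFinset.2 (Polynomial.mem_aroots.2 ⟨ha0, hcon.1⟩), ?_⟩
      rw [Multiset.mem_toFinset, Polynomial.mem_roots (hR β), Polynomial.IsRoot]
      rw [← hcon.2]
      simp only [R, g, Polynomial.eval_finsetSum, Polynomial.eval_monomial, Polynomial.map_sum, map_sum, Polynomial.map_mul,
        map_mul, Polynomial.map_C, Polynomial.aeval_C, map_pow]
      exact Finset.sum_congr rfl (fun j _ => by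
        rw [Polynomial.map_pow, Polynomial.map_C, map_pow, Polynomial.aeval_C]; exact mul_comm _ _)
    set m := ((ψ a).map π).natDegree with hm
    set n := (g.map π).natDegree with hn
    have hres : ((ψ a).map π).resultant (g.map π) m (n + 1) ≠ 0 := by
      rw [Polynomial.resultant_add_right_deg _ _ _ _ 1 le_rfl]
      refine mul_ne_zero (pow_ne_zero _ ?_) (Polynomial.resultant_ne_zero _ _ hco)
      rw [hm, Polynomial.coeff_natDegree]
      exact Polynomial.leadingCoeff_ne_zero.2 ha0
    have hgd : g.natDegree ≤ e := Polynomial.natDegree_sum_le_of_forall_le _ _ (fun j _ =>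
      (Polynomial.natDegree_C_mul_le _ _).trans (h2 j))
    have hgc : ∀ i, (g.coeff i).totalDegree ≤ e := by
      intro i
      simp only [g, Polynomial.finsetSum_coeff, Polynomial.coeff_C_mul]
      refine (totalDegree_finsetSum_le (fun j _ => ?_))
      exact (totalDegree_mul _ _).trans (by rw [totalDegree_C, zero_add]; exact h1 j i)
    refine ⟨(ψ a).resultant g m (n + 1), ?_, ?_, ?_⟩
    · rw [← hπ, ← Polynomial.resultant_map_map]; exact hres
    · refine (totalDegree_resultant _ _ _ _ e e (h1 a) hgc).trans ?_
      have hm2 : m ≤ e := Polynomial.natDegree_map_le.trans (h2 a)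
      have hn2 : n ≤ e := Polynomial.natDegree_map_le.trans hgd
      nlinarith [Nat.mul_le_mul_right e hm2, Nat.mul_le_mul_right e hn2]
    · intro P hP μ hμ
      have hdeg : ∀ q : Polynomial (MvPolynomial σ k), (q.map (eval P)).natDegree ≤ (q.map π).natDegree := by
        intro q
        rw [Polynomial.natDegree_le_iff_coeff_eq_zero]
        intro i hi
        rw [Polynomial.coeff_map]
        apply dvd_eval_zero hP
        rw [← hπ, ← Polynomial.coeff_map]
        exact Polynomial.coeff_eq_zero_of_natDegree_lt hi
      obtain ⟨p, q, -, -, h⟩ := Polynomial.exists_mul_add_mul_eq_C_resultant _ _ (hdeg (ψ a)) ((hdeg g).trans (Nat.le_succ _))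
        (Or.inr (Nat.succ_ne_zero _))
      have h3 := congrArg (Polynomial.eval μ) h
      rw [Polynomial.eval_C, Polynomial.resultant_map_map, Polynomial.eval_add, Polynomial.eval_mul, Polynomial.eval_mul,
        hμ a haN, zero_mul, zero_add] at h3
      have h4 : (g.map (eval P)).eval μ = 0 := by
        simp only [g, Polynomial.map_sum, Polynomial.map_mul, Polynomial.eval_finsetSum, Polynomial.eval_mul]
        exact Finset.sum_eq_zero (fun j hj => by rw [hμ j (Finset.mem_range.1 hj), mul_zero])
      rw [h4, zero_mul] at h3
      exact h3.symm

end PartI1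

section PartI2

theorem tdeg_aeval' {R σ τ : Type*} [CommRing R] {e : ℕ}
    (Φ : σ → MvPolynomial τ R) (hΦ : ∀ i, (Φ i).totalDegree ≤ e) (f : MvPolynomial σ R) :
    (aeval Φ f).totalDegree ≤ f.totalDegree * e := by
  rw [aeval_def, eval₂_eq]
  refine totalDegree_finsetSum_le (fun v hv => ?_)
  refine (totalDegree_mul _ _).trans ?_
  rw [algebraMap_eq, totalDegree_C, zero_add]
  refine (totalDegree_finsetProd _ _).trans (le_trans ?_ (Nat.mul_le_mul_right e (le_totalDegree hv)))
  rw [Finsupp.sum, Finset.sum_mul]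
  exact Finset.sum_le_sum (fun i _ => (totalDegree_pow _ _).trans (Nat.mul_le_mul_left _ (hΦ i)))

theorem exists_pt {k σ : Type} [Field k] [IsAlgClosed k] [Finite σ] {f g : MvPolynomial σ k} (hf : Irreducible f)
    (hg : ¬ f ∣ g) : ∃ P, eval P f = 0 ∧ eval P g ≠ 0 := by
  by_contra hcon
  push Not at hcon
  apply hg
  haveI : (Ideal.span {f}).IsPrime := (Ideal.span_singleton_prime hf.ne_zero).2 hf.prime
  rw [← Ideal.mem_span_singleton, ← IsPrime.vanishingIdeal_zeroLocus (K := k) (Ideal.span {f}), mem_vanishingIdeal_iff]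
  intro P hP
  rw [mem_zeroLocus_iff] at hP
  have := hcon P (by simpa using hP f (Ideal.mem_span_singleton_self f))
  simpa using this

/-- restriction of a polynomial to a parametrized line -/
noncomputable def lpl {k σ : Type*} [CommRing k] (f : MvPolynomial σ k) (P v : σ → k) : Polynomial k :=
  aeval (fun i => Polynomial.C (P i) + Polynomial.X * Polynomial.C (v i)) f

theorem eval_lpl {k σ : Type*} [CommRing k] (f : MvPolynomial σ k) (P v : σ → k) (t : k) :
    (lpl f P v).eval t = eval (fun i => P i + t * v i) f := by
  unfold lpl
  induction f using MvPolynomial.induction_on <;> simp_all [mul_comm t]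

theorem lpl_zero {k σ : Type*} [Field k] [Infinite k] {f : MvPolynomial σ k} {P v : σ → k}
    (h : ∀ t, eval (fun i => P i + t * v i) f = 0) : lpl f P v = 0 :=
  Polynomial.funext (fun t => by rw [eval_lpl, h, Polynomial.eval_zero])

theorem deriv_lpl {k σ : Type*} [Field k] [Fintype σ] (f : MvPolynomial σ k) (P v : σ → k) :
    (Polynomial.derivative (lpl f P v)).eval 0 = ∑ i, v i * eval P (pderiv i f) := by
  classical
  have h0 : ∀ f, (lpl f P v).eval 0 = eval P f := fun f => by rw [eval_lpl]; simp
  induction f using MvPolynomial.induction_on with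
  | C a => simp [lpl]
  | add p q hp hq =>
    have : lpl (p + q) P v = lpl p P v + lpl q P v := by simp [lpl]
    rw [this, Polynomial.derivative_add, Polynomial.eval_add, hp, hq, ← Finset.sum_add_distrib]
    exact Finset.sum_congr rfl (fun i _ => by rw [map_add, map_add]; ring)
  | mul_X p j hp =>
    have : lpl (p * X j) P v = lpl p P v * (Polynomial.C (P j) + Polynomial.X * Polynomial.C (v j)) := by simp [lpl]
    rw [this, Polynomial.derivative_mul, Polynomial.eval_add, Polynomial.eval_mul, Polynomial.eval_mul, hp, h0]
    simp only [Derivation.leibniz, pderiv_X, map_add, smul_eq_mul, map_mul, eval_X, mul_add, Finset.sum_add_distrib]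
    have h1 : ∀ x, v x * (eval P p * eval P ((Pi.single x 1 : σ → MvPolynomial σ k) j)) = if x = j then v x * eval P p else 0 := by
      intro x
      by_cases h : x = j
      · subst h; simp
      · rw [Pi.single_eq_of_ne (Ne.symm h), if_neg h]; simp
    simp only [h1, Finset.sum_ite_eq', Finset.mem_univ, if_true]
    simp only [Polynomial.eval_add, Polynomial.eval_mul, Polynomial.eval_C, Polynomial.eval_X, zero_mul, add_zero,
      Polynomial.derivative_add, Polynomial.derivative_C, Polynomial.derivative_mul, Polynomial.derivative_X, zero_add,
      one_mul, mul_zero, Finset.sum_mul]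
    rw [add_comm, mul_comm (v j)]
    congr 1
    exact Finset.sum_congr rfl (fun i _ => by ring)

/-- tangent direction -/
noncomputable def vv {k : Type} [Field k] (f : MvPolynomial (Fin 3) k) (a0 a1 b0 b1 : k) (P : Fin 3 → k) (μ : k) : Fin 3 → k :=
  ![-((a0 + a1 * μ) * eval P (pderiv 1 f) + (b0 + b1 * μ) * eval P (pderiv 2 f)), (a0 + a1 * μ) * eval P (pderiv 0 f),
    (b0 + b1 * μ) * eval P (pderiv 0 f)]

theorem exists_Phi {k : Type} [Field k] [Infinite k] {d : ℕ} (f : MvPolynomial (Fin 3) k) (hd : f.totalDegree ≤ d) (a0 a1 b0 b1 : k) :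
    ∃ ψ : ℕ → Polynomial (MvPolynomial (Fin 3) k), (∀ j i, ((ψ j).coeff i).totalDegree ≤ d * (d + 2)) ∧
      (∀ j, (ψ j).natDegree ≤ d * (d + 2)) ∧ ∀ P μ, (∀ t, eval (fun i => P i + t * vv f a0 a1 b0 b1 P μ i) f = 0) ↔
        ∀ j < d * (d + 2) + 1, ((ψ j).map (eval P)).eval μ = 0 := by
  let ρ : MvPolynomial (Fin 3) k → MvPolynomial (Fin 5) k := rename (fun i => i.succ.succ)
  let A : MvPolynomial (Fin 5) k := C a0 + C a1 * X 1
  let B : MvPolynomial (Fin 5) k := C b0 + C b1 * X 1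
  let V : Fin 3 → MvPolynomial (Fin 5) k :=
    ![-(A * ρ (pderiv 1 f) + B * ρ (pderiv 2 f)), A * ρ (pderiv 0 f), B * ρ (pderiv 0 f)]
  let Φ : MvPolynomial (Fin 5) k := aeval (fun i : Fin 3 => X i.succ.succ + X 0 * V i) f
  have hlin : ∀ a b : k, (C a + C b * X 1 : MvPolynomial (Fin 5) k).totalDegree ≤ 1 := by
    intro a b
    refine (totalDegree_add _ _).trans (max_le (by rw [totalDegree_C]; omega) ((totalDegree_mul _ _).trans ?_))
    rw [totalDegree_C, zero_add]; exact tdeg_X 1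
  have hρ : ∀ i, (ρ (pderiv i f)).totalDegree ≤ d := fun i => (totalDegree_rename_le _ _).trans ((tdeg_pderiv i f).trans hd)
  have hm : ∀ (a b : k) i, ((C a + C b * X 1 : MvPolynomial (Fin 5) k) * ρ (pderiv i f)).totalDegree ≤ d + 1 := fun a b i =>
    (totalDegree_mul _ _).trans (by have := hlin a b; have := hρ i; omega)
  have hV : ∀ i, (V i).totalDegree ≤ d + 1 := by
    intro i
    fin_cases i
    · change (-(A * ρ (pderiv 1 f) + B * ρ (pderiv 2 f))).totalDegree ≤ _
      rw [totalDegree_neg]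
      exact (totalDegree_add _ _).trans (max_le (hm _ _ _) (hm _ _ _))
    · exact hm _ _ _
    · exact hm _ _ _
  have hΦd : Φ.totalDegree ≤ d * (d + 2) := by
    refine (tdeg_aeval' (e := d + 2) _ (fun i => ?_) f).trans (Nat.mul_le_mul_right _ hd)
    refine (totalDegree_add _ _).trans (max_le ((tdeg_X _).trans (by omega)) ((totalDegree_mul _ _).trans ?_))
    have := tdeg_X (R := k) (0 : Fin 5)
    have := hV i
    omega
  have hev : ∀ P μ t, eval (Fin.cons t (Fin.cons μ P : Fin 4 → k) : Fin 5 → k) Φ =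
      eval (fun i => P i + t * vv f a0 a1 b0 b1 P μ i) f := by
    intro P μ t
    rw [eval_aeval']
    congr 2
    funext i
    have hr : ∀ g, eval (Fin.cons t (Fin.cons μ P : Fin 4 → k) : Fin 5 → k) (ρ g) = eval P g := by
      intro g
      rw [eval_rename]; rfl
    have h1 : (Fin.cons t (Fin.cons μ P : Fin 4 → k) : Fin 5 → k) 1 = μ := rfl
    rw [map_add, map_mul, eval_X, eval_X, Fin.cons_succ, Fin.cons_succ, Fin.cons_zero]
    congr 2
    fin_cases i <;> simp [V, vv, A, B, hr, h1]
  refine ⟨fun j => finSuccEquiv k 3 ((finSuccEquiv k 4 Φ).coeff j), fun j i =>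
    (totalDegree_coeff_fse _ i).trans ((totalDegree_coeff_fse _ j).trans hΦd), fun j =>
    (natDegree_fse _).trans ((totalDegree_coeff_fse _ j).trans hΦd), fun P μ => ?_⟩
  simp only [← hev, eval_eq_eval_mv_eval']
  simp only [← eval_eq_eval_mv_eval', ← Polynomial.coeff_map]
  constructor
  · intro h j _
    have : (finSuccEquiv k 4 Φ).map (eval (Fin.cons μ P : Fin 4 → k)) = 0 := Polynomial.funext (fun t => by
      rw [← eval_eq_eval_mv_eval', h, Polynomial.eval_zero])
    rw [this, Polynomial.coeff_zero]
  · intro h t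
    rw [eval_eq_eval_mv_eval']
    have : (finSuccEquiv k 4 Φ).map (eval (Fin.cons μ P : Fin 4 → k)) = 0 := by
      ext j
      rw [Polynomial.coeff_zero]
      by_cases hj : j < d * (d + 2) + 1
      · exact h j hj
      · exact Polynomial.coeff_eq_zero_of_natDegree_lt (lt_of_le_of_lt (Polynomial.natDegree_map_le.trans
          ((natDegree_fse _).trans hΦd)) (by omega))
    rw [this, Polynomial.eval_zero]

theorem lines_chart {k : Type} [Field k] [IsAlgClosed k] [CharZero k] {d : ℕ} {f Q : MvPolynomial (Fin 3) k} (hf : Irreducible f)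
    (hd : f.totalDegree ≤ d) (hz : ¬ f ∣ pderiv 0 f) (hQ : ¬ f ∣ Q)
    (hline : ∀ P v : Fin 3 → k, v ≠ 0 → (∀ t, eval (fun i => P i + t * v i) f = 0) → eval P Q = 0) (a0 a1 b0 b1 : k)
    (hab : ∀ μ, a0 + a1 * μ ≠ 0 ∨ b0 + b1 * μ ≠ 0) :
    ∃ E, ¬ f ∣ E ∧ E.totalDegree ≤ 2 * (d * (d + 2)) * (d * (d + 2)) + d * (d + 2) ∧ ∀ P μ, eval P f = 0 →
      (∀ t, eval (fun i => P i + t * vv f a0 a1 b0 b1 P μ i) f = 0) → eval P E = 0 := by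
  obtain ⟨ψ, h1, h2, h3⟩ := exists_Phi f hd a0 a1 b0 b1
  rcases elim_m hf (d * (d + 2) + 1) _ ψ h1 h2 with ⟨E, e1, e2, e3⟩ | ⟨Q0, q1, q2⟩
  · exact ⟨E, e1, e2, fun P μ hP h => e3 P hP μ ((h3 P μ).1 h)⟩
  · exfalso
    obtain ⟨P, hP, hPQ⟩ := exists_pt hf (g := Q0 * (Q * pderiv 0 f)) (fun h => by
      rcases hf.prime.dvd_or_dvd h with h | h
      · exact q1 h
      rcases hf.prime.dvd_or_dvd h with h | h
      · exact hQ h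
      · exact hz h)
    rw [map_mul, map_mul] at hPQ
    have hz2 := right_ne_zero_of_mul (right_ne_zero_of_mul hPQ)
    obtain ⟨μ, hμ⟩ := q2 P hP (left_ne_zero_of_mul hPQ)
    refine left_ne_zero_of_mul (right_ne_zero_of_mul hPQ) (hline P _ ?_ ((h3 P μ).2 hμ))
    intro h0
    rcases hab μ with h | h
    · exact mul_ne_zero h hz2 (congrFun h0 1)
    · exact mul_ne_zero h hz2 (congrFun h0 2)

theorem lines_E {k : Type} [Field k] [IsAlgClosed k] [CharZero k] {d : ℕ} {f Q : MvPolynomial (Fin 3) k} (hf : Irreducible f)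
    (hd : f.totalDegree ≤ d) (hz : ¬ f ∣ pderiv 0 f) (hQ : ¬ f ∣ Q)
    (hline : ∀ P v : Fin 3 → k, v ≠ 0 → (∀ t, eval (fun i => P i + t * v i) f = 0) → eval P Q = 0) :
    ∃ E, ¬ f ∣ E ∧ E.totalDegree ≤ 2 * (2 * (d * (d + 2)) * (d * (d + 2)) + d * (d + 2)) + d ∧ ∀ P v : Fin 3 → k, v ≠ 0 →
      (∀ t, eval (fun i => P i + t * v i) f = 0) → eval P E = 0 := by
  obtain ⟨E1, a1, a2, a3⟩ := lines_chart hf hd hz hQ hline 1 0 0 1 (fun μ => Or.inl (by simp))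
  obtain ⟨E2, b1, b2, b3⟩ := lines_chart hf hd hz hQ hline 0 1 1 0 (fun μ => Or.inr (by simp))
  refine ⟨E1 * (E2 * pderiv 0 f), fun h => ?_, ?_, fun P v hv h => ?_⟩
  · rcases hf.prime.dvd_or_dvd h with h | h
    · exact a1 h
    rcases hf.prime.dvd_or_dvd h with h | h
    · exact b1 h
    · exact hz h
  · have h1 := totalDegree_mul E1 (E2 * pderiv 0 f)
    have h2 := totalDegree_mul E2 (pderiv 0 f)
    have h3 := (tdeg_pderiv 0 f).trans hd
    omega
  · rw [map_mul, map_mul]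
    by_contra hne
    have n1 := left_ne_zero_of_mul hne
    have n2 := left_ne_zero_of_mul (right_ne_zero_of_mul hne)
    have n3 := right_ne_zero_of_mul (right_ne_zero_of_mul hne)
    have hP : eval P f = 0 := by have := h 0; simpa using this
    have ht := deriv_lpl f P v
    rw [lpl_zero h, Polynomial.derivative_zero, Polynomial.eval_zero, Fin.sum_univ_three] at ht
    have key : ∀ (w : Fin 3 → k) (s : k), (∀ i, s * v i = w i) → ∀ t, eval (fun i => P i + t * w i) f = 0 := by
      intro w s hw t
      rw [← h (t * s)]
      congr 2
      funext i
      rw [← hw i]; ring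
    by_cases hv1 : v 1 = 0
    · by_cases hv2 : v 2 = 0
      · apply hv
        rw [hv1, hv2, zero_mul, zero_mul, add_zero, add_zero] at ht
        have := (mul_eq_zero.1 ht.symm).resolve_right n3
        funext i; fin_cases i <;> assumption
      · refine n2 (b3 P (v 1 / v 2) hP (key _ (eval P (pderiv 0 f) / v 2) (fun i => ?_)))
        fin_cases i
        · simp only [vv]; simp; field_simp; linear_combination -ht
        · simp [vv]; ring
        · simp [vv]; field_simp
    · refine n1 (a3 P (v 2 / v 1) hP (key _ (eval P (pderiv 0 f) / v 1) (fun i => ?_)))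
      fin_cases i
      · simp only [vv]; simp; field_simp; linear_combination -ht
      · simp [vv]; field_simp
      · simp [vv]; ring

end PartI2

section PartG1

theorem bez_fac {r s : MvPolynomial (Fin 2) ℚ} (hr : r ≠ 0) (hs : s ≠ 0) (W : Finset (Fin 2 → ℚ))
    (hW : ∀ P ∈ W, eval P s = 0 ∧ ∃ h, Irreducible h ∧ h ∣ r ∧ ¬ h ∣ s ∧ eval P h = 0) :
    W.card ≤ r.totalDegree * s.totalDegree := by
  classical
  induction hn : r.totalDegree using Nat.strong_induction_on generalizing r W with
  | _ n ih =>
    by_cases hu : IsUnit r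
    · have : W = ∅ := Finset.eq_empty_of_forall_notMem (fun P hP => by
        obtain ⟨-, h, h1, h2, -⟩ := hW P hP
        exact h1.not_isUnit (isUnit_of_dvd_unit h2 hu))
      rw [this]; simp
    obtain ⟨h, hh, g, rfl⟩ := WfDvdMonoid.exists_irreducible_factor hu hr
    have hg0 := right_ne_zero_of_mul hr
    have h1 := one_le_tdeg hh.ne_zero hh.not_isUnit
    rw [totalDegree_mul_of_isDomain hh.ne_zero hg0] at hn
    have hA := ih g.totalDegree (by omega) hg0 (W.filter (fun P => ∃ h, Irreducible h ∧ h ∣ g ∧ ¬ h ∣ s ∧ eval P h = 0))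
      (fun P hP => by rw [Finset.mem_filter] at hP; exact ⟨(hW P hP.1).1, hP.2⟩) rfl
    have hB : (W.filter (fun P => ¬ ∃ h, Irreducible h ∧ h ∣ g ∧ ¬ h ∣ s ∧ eval P h = 0)).card ≤
        h.totalDegree * s.totalDegree := by
      have key : ∀ P ∈ W.filter (fun P => ¬ ∃ h, Irreducible h ∧ h ∣ g ∧ ¬ h ∣ s ∧ eval P h = 0),
          eval P s = 0 ∧ ¬ h ∣ s ∧ eval P h = 0 := by
        intro P hP
        rw [Finset.mem_filter] at hP
        obtain ⟨e0, h', e1, e2, e3, e4⟩ := hW P hP.1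
        rcases e1.prime.dvd_or_dvd e2 with h5 | h5
        · have h6 := (e1.dvd_irreducible_iff_associated hh).1 h5
          exact ⟨e0, fun h7 => e3 (h6.dvd.trans h7), dvd_eval_zero e4 h5⟩
        · exact (hP.2 ⟨h', e1, h5, e3, e4⟩).elim
      by_cases hds : h ∣ s
      · rw [Finset.eq_empty_of_forall_notMem (fun P hP => (key P hP).2.1 hds)]; simp
      · exact bezout_points hh.ne_zero hs (hh.isRelPrime_iff_not_dvd.2 hds) _ (fun P hP => ⟨(key P hP).2.2, (key P hP).1⟩)
    rw [← Finset.card_filter_add_card_filter_not (fun P => ∃ h, Irreducible h ∧ h ∣ g ∧ ¬ h ∣ s ∧ eval P h = 0), ← hn, add_mul]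
    omega

/-- residues modulo a set of moduli -/
def key (Q : Finset ℕ) (P : Fin 3 → ℤ) : (p : Q) → Fin 3 → ZMod p := fun p l => (P l : ZMod p)

theorem key_mono {Q Q' : Finset ℕ} (h : Q ⊆ Q') {P P' : Fin 3 → ℤ} (hk : key Q' P = key Q' P') : key Q P = key Q P' := by
  funext p
  exact congrFun hk ⟨p, h p.2⟩

theorem key_dvd {Q : Finset ℕ} {P P' : Fin 3 → ℤ} (hk : key Q P = key Q P') {p : ℕ} (hp : p ∈ Q) (l) : (p : ℤ) ∣ P l - P' l :=
  (ZMod.intCast_eq_intCast_iff_dvd_sub _ _ _).1 (congrFun (congrFun hk ⟨p, hp⟩) l).symm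

theorem card_key {d M : ℕ} {f : MvPolynomial (Fin 3) ℤ} (hd : f.totalDegree ≤ d) {Q : Finset ℕ}
    (hQ : ∀ p ∈ Q, p.Prime ∧ p ≤ M ∧ ¬ (p : ℤ) ∣ coeff (Finsupp.single 0 d) f) (S : Finset (Fin 3 → ℤ))
    (hS : ∀ P ∈ S, eval P f = 0) [DecidableEq ((p : Q) → Fin 3 → ZMod p)] : (S.image (key Q)).card ≤ (d * M ^ 2) ^ Q.card := by
  classical
  have h1 : S.image (key Q) ⊆ Fintype.piFinset (fun p : Q => S.image (fun P l => (P l : ZMod p))) := by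
    intro κ hκ
    obtain ⟨P, hP, rfl⟩ := Finset.mem_image.1 hκ
    exact Fintype.mem_piFinset.2 (fun p => Finset.mem_image_of_mem _ hP)
  refine (Finset.card_le_card h1).trans ?_
  rw [Fintype.card_piFinset]
  refine (Finset.prod_le_prod' (g := fun _ => d * M ^ 2) (fun p _ => ?_)).trans (by simp)
  haveI : Fact (p : ℕ).Prime := ⟨(hQ p p.2).1⟩
  exact (card_classes hd (hQ p p.2).2.2 S hS).trans (Nat.mul_le_mul_left _ (Nat.pow_le_pow_left (hQ p p.2).2.1 _))

/-- the rational tail of an integer point -/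
def tl (P : Fin 3 → ℤ) : Fin 2 → ℚ := fun i => (P i.succ : ℚ)

theorem card_tl {d N : ℕ} {f : MvPolynomial (Fin 3) ℤ} (hd : f.totalDegree ≤ d) (hc : coeff (Finsupp.single 0 d) f ≠ 0)
    (S : Finset (Fin 3 → ℤ)) (hS : ∀ P ∈ S, eval P f = 0) [DecidableEq (Fin 2 → ℚ)] (hN : (S.image tl).card ≤ N) : S.card ≤ d * N := by
  classical
  refine (card_tails hd hc (S.image Fin.tail) S (fun P hP => ⟨hS P hP, Finset.mem_image_of_mem _ hP⟩)).trans
    (Nat.mul_le_mul_left _ (le_trans (le_of_eq ?_) hN))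
  have : S.image tl = (S.image Fin.tail).image (fun (Q : Fin 2 → ℤ) i => (Q i : ℚ)) := by
    rw [Finset.image_image]; rfl
  rw [this, Finset.card_image_of_injective (S.image Fin.tail) (f := fun (Q : Fin 2 → ℤ) i => (Q i : ℚ))]
  intro Q Q' h
  funext i
  exact Int.cast_injective (congrFun h i)

theorem tree_count {d t K L R : ℕ} (hd1 : 1 ≤ d) (hK : 1 ≤ K) {f : MvPolynomial (Fin 3) ℤ} (hd : f.totalDegree ≤ d)
    (hc : coeff (Finsupp.single 0 d) f ≠ 0) (Q : ℕ → Finset ℕ) (hm : Monotone Q) (hq : ∀ j ≤ t, (Q j).card = j)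
    (hQ : ∀ j, ∀ p ∈ Q j, p.Prime ∧ p ≤ K * L ∧ ¬ (p : ℤ) ∣ coeff (Finsupp.single 0 d) f) (S : Finset (Fin 3 → ℤ))
    (hS : ∀ P ∈ S, eval P f = 0) (r : ℕ → (Fin 3 → ℤ) → MvPolynomial (Fin 2) ℚ)
    (hr : ∀ j ≤ t, ∀ P ∈ S, r j P ≠ 0 ∧ (r j P).totalDegree ≤ R * L ^ (t - j) ∧ eval (tl P) (r j P) = 0)
    (hrc : ∀ j P P', key (Q j) P = key (Q j) P' → r j P = r j P')
    (hB : ∀ P ∈ S, ∃ j < t, ∃ h, Irreducible h ∧ h ∣ r j P ∧ ¬ h ∣ r (j + 1) P ∧ eval (tl P) h = 0) :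
    S.card ≤ t * (d * (R * R) * (d * K ^ 2) ^ t) * L ^ (2 * t + 1) := by
  classical
  let B : ℕ → Finset (Fin 3 → ℤ) := fun j => S.filter
    (fun P => ∃ h, Irreducible h ∧ h ∣ r j P ∧ ¬ h ∣ r (j + 1) P ∧ eval (tl P) h = 0)
  have hsub : S ⊆ (Finset.range t).biUnion B := by
    intro P hP
    obtain ⟨j, hj, h⟩ := hB P hP
    exact Finset.mem_biUnion.2 ⟨j, Finset.mem_range.2 hj, Finset.mem_filter.2 ⟨hP, h⟩⟩
  refine (Finset.card_le_card hsub).trans ((Finset.card_biUnion_le_card_mul _ _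
    (d * (R * R) * (d * K ^ 2) ^ t * L ^ (2 * t + 1)) (fun j hj => ?_)).trans (by rw [Finset.card_range, ← mul_assoc]))
  rw [Finset.mem_range] at hj
  have h1 : (B j).card ≤ d * ((R * L ^ (t - j)) * (R * L ^ (t - (j + 1)))) * ((B j).image (key (Q (j + 1)))).card := by
    refine Finset.card_le_mul_card_image _ _ (fun κ hκ => ?_)
    obtain ⟨P0, hP0, rfl⟩ := Finset.mem_image.1 hκ
    have hP0S := (Finset.mem_filter.1 hP0).1
    have a := hr j hj.le P0 hP0S
    have b := hr (j + 1) hj P0 hP0S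
    refine card_tl hd hc _ (fun P hP => hS P (Finset.mem_filter.1 (Finset.mem_filter.1 hP).1).1)
      ((bez_fac a.1 b.1 _ (fun P' hP' => ?_)).trans (Nat.mul_le_mul a.2.1 b.2.1))
    obtain ⟨P, hP, rfl⟩ := Finset.mem_image.1 hP'
    rw [Finset.mem_filter, Finset.mem_filter] at hP
    obtain ⟨⟨hPS, h⟩, hk⟩ := hP
    rw [hrc (j + 1) P P0 hk, hrc j P P0 (key_mono (hm (Nat.le_succ j)) hk)] at h
    refine ⟨?_, h⟩
    rw [← hrc (j + 1) P P0 hk]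
    exact (hr (j + 1) hj P hPS).2.2
  have h2 := card_key hd (hQ (j + 1)) (B j) (fun P hP => hS P (Finset.mem_filter.1 hP).1)
  rw [hq _ hj] at h2
  refine h1.trans ((Nat.mul_le_mul_left _ h2).trans ?_)
  have h3 : d * (R * L ^ (t - j) * (R * L ^ (t - (j + 1)))) * (d * (K * L) ^ 2) ^ (j + 1) =
      d * (R * R) * (d * K ^ 2) ^ (j + 1) * L ^ (2 * t + 1) := by
    have : L ^ (2 * t + 1) = L ^ (t - j) * L ^ (t - (j + 1)) * (L ^ 2) ^ (j + 1) := by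
      rw [← pow_mul, ← pow_add, ← pow_add]; congr 1; omega
    rw [this, mul_pow K L, ← mul_assoc d (K ^ 2), mul_pow (d * K ^ 2)]; ring
  rw [h3]
  exact Nat.mul_le_mul_right _ (Nat.mul_le_mul_left _ (Nat.pow_le_pow_right (by positivity) hj))

end PartG1

section PartG2

theorem deg_one {h : MvPolynomial (Fin 2) ℚ} (h1 : h.totalDegree = 1) : ∃ a b c : ℚ, (a ≠ 0 ∨ b ≠ 0) ∧
    ∀ P, eval P h = a * P 0 + b * P 1 + c := by
  classical
  have key : ∀ P, eval P h = coeff (Finsupp.single 0 1) h * P 0 + coeff (Finsupp.single 1 1) h * P 1 + coeff 0 h := by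
    intro P
    have hs : h.support ⊆ {Finsupp.single 0 1, Finsupp.single 1 1, 0} := by
      intro v hv
      have h2 : v.degree ≤ h.totalDegree := le_totalDegree hv
      rw [h1, Finsupp.degree_eq_sum, Fin.sum_univ_two] at h2
      simp only [Finset.mem_insert, Finset.mem_singleton, Finsupp.ext_iff, Fin.forall_fin_two]
      simp
      omega
    rw [eval_eq', Finset.sum_subset hs (fun v _ hv => by rw [notMem_support_iff.1 hv, zero_mul])]
    rw [Finset.sum_insert, Finset.sum_insert, Finset.sum_singleton]
    · simp [add_assoc]
    · simp
    · simp [Finsupp.ext_iff, Fin.forall_fin_two]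
  refine ⟨_, _, _, ?_, key⟩
  by_contra hcon
  push Not at hcon
  have : h = C (coeff 0 h) := MvPolynomial.funext (fun P => by rw [key, hcon.1, hcon.2]; simp)
  rw [this, totalDegree_C] at h1
  omega

/-- no rational line through the point in the surface -/
def NL (f : MvPolynomial (Fin 3) ℤ) (P : Fin 3 → ℤ) : Prop :=
  ∀ v : Fin 3 → ℚ, v ≠ 0 → ¬ ∀ t : ℚ, eval (fun i => P i + t * v i) (map (Int.castRingHom ℚ) f) = 0

theorem per_lin (d T : ℕ) (hT : 1 ≤ T) : ∃ C : ℕ, ∀ L, 2 ≤ L → ∀ f : MvPolynomial (Fin 3) ℤ,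
    f.totalDegree ≤ d → coeff (Finsupp.single 0 d) f ≠ 0 → ∀ (σ : Fin 3) (e c : Fin 3 → ℚ), e 0 = 0 → e ≠ 0 →
    ∀ S : Finset (Fin 3 → ℤ), (∀ P ∈ S, eval P f = 0 ∧ (∀ i, |P i| ≤ (L ^ (2 * T) : ℕ)) ∧
      (∀ i, i ≠ 0 → (P i : ℚ) = e i * P σ + c i) ∧ NL f P) → S.card ≤ C * L ^ (T + 1) := by
  classical
  obtain ⟨K, hK⟩ := bp d T hT
  refine ⟨K, fun L hL f hd hc σ e c he0 he S hS => ?_⟩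
  let Φ : Fin 3 → MvPolynomial (Fin 2) ℚ := Fin.cons (X 0) (fun i => C (e i.succ) * X 1 + C (c i.succ))
  have hΦ : ∀ i, (Φ i).totalDegree ≤ 1 := by
    intro i
    refine Fin.cases (tdeg_X _) (fun i => ?_) i
    refine (totalDegree_add _ _).trans (max_le ((totalDegree_mul _ _).trans ?_) (by rw [totalDegree_C]; omega))
    rw [totalDegree_C, zero_add]; exact tdeg_X _
  let g := map (Int.castRingHom ℚ) f
  have hgd : g.totalDegree ≤ d := (tdeg_map_le _ _).trans hd
  let F := aeval Φ g
  have hF0 : F ≠ 0 := by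
    intro h
    have h1 := coeff_top_subst Φ hΦ hgd
    have h2 : (fun i => coeff (Finsupp.single 0 1) (Φ i)) = (Fin.cons 1 (fun _ => 0) : Fin 3 → ℚ) := by
      funext i
      refine Fin.cases (by simp [Φ]) (fun i => ?_) i
      simp only [Φ, Fin.cons_succ, coeff_add, coeff_C_mul, coeff_X, coeff_C]
      rw [if_neg (by simp [Finsupp.ext_iff, Fin.forall_fin_two]), if_neg (by simp [Finsupp.ext_iff, Fin.forall_fin_two])]
      simp
    rw [h2, ← coeff_top, show aeval Φ g = 0 from h, coeff_zero, coeff_map] at h1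
    exact hc (Int.cast_injective (α := ℚ) (by simpa using h1.symm))
  have hev : ∀ u : Fin 2 → ℚ, eval u F = eval (Fin.cons (u 0) (fun i => e i.succ * u 1 + c i.succ) : Fin 3 → ℚ) g := by
    intro u
    rw [eval_aeval']
    congr 2
    funext i
    refine Fin.cases (by simp [Φ]) (fun i => by simp [Φ]) i
  let τ : (Fin 3 → ℤ) → (Fin 2 → ℤ) := fun P => ![P 0, P σ]
  have hinj : Set.InjOn τ S := by
    intro P hP P' hP' h
    have h0 : P 0 = P' 0 := congrFun h 0
    have h1 : P σ = P' σ := congrFun h 1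
    funext i
    by_cases hi : i = 0
    · rw [hi, h0]
    · have a := (hS P hP).2.2.1 i hi
      rw [h1, ← (hS P' hP').2.2.1 i hi] at a
      exact_mod_cast a
  have hline : ∀ P ∈ S, ∀ w0 w1 : ℚ, ∀ t : ℚ, eval (fun i => P i + t * (Fin.cons w0 (fun i => e i.succ * w1) : Fin 3 → ℚ) i) g =
      eval ![P 0 + t * w0, P σ + t * w1] F := by
    intro P hP w0 w1 t
    rw [hev]
    congr 2
    funext i
    refine Fin.cases (by simp) (fun i => ?_) i
    rw [(hS P hP).2.2.1 _ (Fin.succ_ne_zero i)]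
    simp; ring
  have key := hK L hL F hF0 ((tdeg_aeval Φ hΦ g).trans hgd) (S.image τ) (by
    intro Q hQ
    obtain ⟨P, hP, rfl⟩ := Finset.mem_image.1 hQ
    obtain ⟨a1, a2, a3, a4⟩ := hS P hP
    have hτ : (fun i => ((τ P i : ℤ) : ℚ)) = ![(P 0 : ℚ), (P σ : ℚ)] := by
      funext i; fin_cases i <;> rfl
    rw [hτ]
    refine ⟨?_, fun i => by fin_cases i; exacts [a2 0, a2 σ], fun l hl hl1 hl0 => ?_⟩
    · have := hline P hP 0 0 0
      simp only [zero_mul, add_zero] at this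
      rw [← this, evc, a1, Int.cast_zero]
    · obtain ⟨a, b, γ, hab, hl2⟩ := deg_one hl1
      refine a4 (Fin.cons (-b) (fun i => e i.succ * a)) ?_ (fun t => ?_)
      · intro h
        have hb : b = 0 := by simpa using congrFun h 0
        apply he
        funext i
        refine Fin.cases he0 (fun i => ?_) i
        have := congrFun h i.succ
        simp only [Fin.cons_succ, Pi.zero_apply] at this
        exact (mul_eq_zero.1 this).resolve_right (hab.resolve_right (fun h => h hb))
      · rw [hline P hP]
        refine dvd_eval_zero ?_ hl
        rw [hl2] at hl0 ⊢
        simp at hl0 ⊢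
        linear_combination hl0)
  rwa [Finset.card_image_of_injOn hinj] at key

theorem per_h (d Δ T : ℕ) (hT : 1 ≤ T) : ∃ C : ℕ, ∀ L, 2 ≤ L → ∀ f : MvPolynomial (Fin 3) ℤ,
    f.totalDegree ≤ d → coeff (Finsupp.single 0 d) f ≠ 0 → ∀ h : MvPolynomial (Fin 2) ℚ, Irreducible h → h.totalDegree ≤ Δ →
    ∀ S : Finset (Fin 3 → ℤ), (∀ P ∈ S, eval P f = 0 ∧ (∀ i, |P i| ≤ (L ^ (2 * T) : ℕ)) ∧ eval (tl P) h = 0 ∧ NL f P) →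
    S.card ≤ C * L ^ (T + 1) := by
  classical
  obtain ⟨C1, h1⟩ := bp0 Δ T hT
  obtain ⟨C2, h2⟩ := per_lin d T hT
  refine ⟨d * C1 + C2, fun L hL f hd hc h hh hΔ S hS => ?_⟩
  rcases Nat.lt_or_ge 1 h.totalDegree with h3 | h3
  · have := h1 L hL h hh h3 hΔ (S.image Fin.tail) (by
      intro Q hQ
      obtain ⟨P, hP, rfl⟩ := Finset.mem_image.1 hQ
      exact ⟨(hS P hP).2.2.1, fun i => (hS P hP).2.1 i.succ⟩)
    have h4 := card_tails hd hc (S.image Fin.tail) S (fun P hP => ⟨(hS P hP).1, Finset.mem_image_of_mem _ hP⟩)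
    refine h4.trans ((Nat.mul_le_mul_left d this).trans ?_)
    rw [← mul_assoc]
    exact Nat.mul_le_mul_right _ (by omega)
  · have h4 := one_le_tdeg hh.ne_zero hh.not_isUnit
    obtain ⟨a, b, c, hab, he⟩ := deg_one (le_antisymm h3 h4)
    have : S.card ≤ C2 * L ^ (T + 1) := by
      by_cases hb : b = 0
      · have ha := hab.resolve_right (fun h => h hb)
        refine h2 L hL f hd hc 2 ![0, 0, 1] ![0, -c / a, 0] rfl (fun h => one_ne_zero (congrFun h 2)) S (fun P hP => ?_)
        obtain ⟨a1, a2, a3, a4⟩ := hS P hP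
        refine ⟨a1, a2, fun i hi => ?_, a4⟩
        rw [he, hb] at a3
        simp only [tl] at a3
        fin_cases i
        · exact (hi rfl).elim
        · simp at a3 ⊢; field_simp; linear_combination a3
        · simp
      · refine h2 L hL f hd hc 1 ![0, 1, -a / b] ![0, 0, -c / b] rfl (fun h => one_ne_zero (congrFun h 1)) S (fun P hP => ?_)
        obtain ⟨a1, a2, a3, a4⟩ := hS P hP
        refine ⟨a1, a2, fun i hi => ?_, a4⟩
        rw [he] at a3
        simp only [tl] at a3
        fin_cases i
        · exact (hi rfl).elim
        · simp
        · simp at a3 ⊢; field_simp; linear_combination a3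
    refine this.trans (Nat.mul_le_mul_right _ (by omega))

end PartG2

section PartG3

theorem chain (W : Finset ℕ) : ∃ Q : ℕ → Finset ℕ, Monotone Q ∧ (∀ j ≤ W.card, (Q j).card = j) ∧ ∀ j, Q j ⊆ W := by
  classical
  refine ⟨fun j => (W.toList.take j).toFinset, fun i j h => ?_, fun j hj => ?_, fun j x hx => ?_⟩
  · intro x hx
    rw [List.mem_toFinset] at hx ⊢
    exact (List.take_sublist_take_left h).subset hx
  · rw [List.toFinset_card_of_nodup (W.nodup_toList.sublist (List.take_sublist _ _)), List.length_take, Finset.length_toList]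
    omega
  · rw [List.mem_toFinset] at hx
    exact Finset.mem_toList.1 (List.mem_of_mem_take hx)

theorem tree (d T c K : ℕ) (hd4 : 4 ≤ d) (hT : 1 ≤ T) (hK : 1 ≤ K) : ∃ C : ℕ, ∀ f : MvPolynomial (Fin 3) ℤ,
    f.totalDegree ≤ d → coeff (Finsupp.single 0 d) f ≠ 0 → Irreducible (map (Int.castRingHom ℚ) f) →
    ∀ L : ℕ, 2 ≤ L → (∀ α, |coeff α f| ≤ (L ^ c : ℕ)) → ∀ W : Finset ℕ, W.card = T + 1 →
    (∀ p ∈ W, p.Prime ∧ L ≤ p ∧ p ≤ K * L) → ∀ S : Finset (Fin 3 → ℤ),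
    (∀ P ∈ S, eval P f = 0 ∧ (∀ i, |P i| ≤ (L ^ (2 * T) : ℕ)) ∧ NL f P ∧
      ∀ p ∈ W, ¬ (p : ℤ) ∣ coeff (Finsupp.single 0 d) f * eval P (pderiv 0 f)) → S.card ≤ C * L ^ (2 * T + 3) := by
  classical
  obtain ⟨D0, hD0, haux⟩ := aux d T c hd4 hT
  set R := 2 * d * (D0 + d) with hR
  obtain ⟨C1, hC1⟩ := per_h d R T hT
  set t := T + 1 with ht
  refine ⟨R * C1 + t * (d * (R * R) * (d * K ^ 2) ^ t), fun f hd hc hirr L hL hH W hWc hW S hS => ?_⟩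
  rcases S.eq_empty_or_nonempty with rfl | ⟨P0, hP0⟩
  · simp
  obtain ⟨Q, hm, hq, hQW⟩ := chain W
  rw [hWc] at hq
  have hL1 : 1 ≤ L := by omega
  have hbase : ∀ j ≤ t, ∀ S' ⊆ S, (∀ P ∈ S', ∀ P' ∈ S', key (Q j) P = key (Q j) P') →
      ∃ r : MvPolynomial (Fin 2) ℚ, r ≠ 0 ∧ r.totalDegree ≤ R * L ^ (t - j) ∧ ∀ P ∈ S', eval (tl P) r = 0 := by
    intro j hj S' hS' hk
    obtain ⟨g, g1, g2, g3, g4⟩ := haux f hd hc hirr L hL hH S' (fun P hP => by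
        obtain ⟨a1, a2, a3, a4⟩ := hS P (hS' hP)
        obtain ⟨p, hp⟩ := Finset.card_pos.1 (by rw [hWc]; omega : 0 < W.card)
        exact ⟨a1, fun h => a4 p hp (by rw [h, mul_zero]; exact dvd_zero _), a2⟩) j hj (Q j) (by rw [hq j hj]; exact hj)
      (fun p hp => (hW p (hQW j hp)).1) (by
        have := Finset.prod_le_prod' (s := Q j) (f := fun _ => L) (g := fun p => p) (fun p hp => (hW p (hQW j hp)).2.1)
        rwa [Finset.prod_const, hq j hj] at this)
      (fun p hp P hP P' hP' l => key_dvd (hk P hP P' hP') hp l)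
      (fun p hp P hP h => (hS P (hS' hP)).2.2.2 p (hQW j hp) (h.mul_left _))
    have hd' : (map (Int.castRingHom ℚ) f).totalDegree ≤ d := (tdeg_map_le _ _).trans hd
    have hc' : coeff (Finsupp.single 0 d) (map (Int.castRingHom ℚ) f) ≠ 0 := by
      rw [coeff_map]; exact fun h => hc (Int.cast_injective (α := ℚ) (by simpa using h))
    obtain ⟨r, r1, r2, A, B, hr⟩ := elim hirr hd' hc' (not_dvd_of_degreeOf_lt hd' hc' g1 g2)
    refine ⟨r, r1, r2.trans ?_, fun P hP => ?_⟩
    · rw [hR, mul_assoc _ (D0 + d)]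
      refine Nat.mul_le_mul_left _ (g3.trans ?_)
      rw [add_mul]
      exact Nat.add_le_add_left (Nat.le_mul_of_pos_right _ (by positivity)) _
    · have h1 := congrArg (eval (fun i => (P i : ℚ))) hr
      rw [eval_rename, map_add, map_mul, map_mul, g4 P hP, evc, (hS P (hS' hP)).1] at h1
      rw [Int.cast_zero, mul_zero, mul_zero, add_zero] at h1
      exact h1
  choose! ρ hρ using hbase
  let cl : ℕ → (Fin 3 → ℤ) → Finset (Fin 3 → ℤ) := fun j P => S.filter (fun P' => key (Q j) P' = key (Q j) P)
  let r : ℕ → (Fin 3 → ℤ) → MvPolynomial (Fin 2) ℚ := fun j P => ρ j (cl j P)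
  have hcl : ∀ j ≤ t, ∀ P, r j P ≠ 0 ∧ (r j P).totalDegree ≤ R * L ^ (t - j) ∧ ∀ P' ∈ cl j P, eval (tl P') (r j P) = 0 :=
    fun j hj P => hρ j hj (cl j P) (Finset.filter_subset _ _) (fun P1 h1 P2 h2 =>
      (Finset.mem_filter.1 h1).2.trans (Finset.mem_filter.1 h2).2.symm)
  have hself : ∀ j, ∀ P ∈ S, P ∈ cl j P := fun j P hP => Finset.mem_filter.2 ⟨hP, rfl⟩
  have hrc : ∀ j P P', key (Q j) P = key (Q j) P' → r j P = r j P' := by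
    intro j P P' h
    simp only [r, cl, h]
  have hr0 : ∀ P ∈ S, r 0 P = r 0 P0 := fun P _ => hrc 0 _ _ (by
    have : Q 0 = ∅ := Finset.card_eq_zero.1 (hq 0 (Nat.zero_le _))
    funext p
    exact (Finset.notMem_empty (p : ℕ) (by have := p.2; simp_all)).elim)
  obtain ⟨H, H1, H2, H3⟩ := factors (r 0 P0) (hcl 0 (Nat.zero_le _) P0).1
  let A := S.filter (fun P => ∃ h ∈ H, eval (tl P) h = 0 ∧ h.totalDegree ≤ R)
  have hA : A.card ≤ R * C1 * L ^ (2 * T + 3) := by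
    have hsub : A ⊆ H.biUnion (fun h => S.filter (fun P => eval (tl P) h = 0 ∧ h.totalDegree ≤ R)) := by
      intro P hP
      obtain ⟨hP, h, hh, h1⟩ := Finset.mem_filter.1 hP
      exact Finset.mem_biUnion.2 ⟨h, hh, Finset.mem_filter.2 ⟨hP, h1⟩⟩
    refine (Finset.card_le_card hsub).trans ((Finset.card_biUnion_le_card_mul _ _ (C1 * L ^ (T + 1)) (fun h hh => ?_)).trans ?_)
    · by_cases hdeg : h.totalDegree ≤ R
      · refine hC1 L hL f hd hc h (H2 h hh).1 hdeg _ (fun P hP => ?_)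
        rw [Finset.mem_filter] at hP
        exact ⟨(hS P hP.1).1, (hS P hP.1).2.1, hP.2.1, (hS P hP.1).2.2.1⟩
      · rw [Finset.filter_false_of_mem (fun P _ h => hdeg h.2)]; simp
    · refine (Nat.mul_le_mul_right _ (H1.trans (hcl 0 (Nat.zero_le _) P0).2.1)).trans ?_
      have : R * L ^ (t - 0) * (C1 * L ^ (T + 1)) = R * C1 * L ^ (2 * T + 2) := by
        rw [show 2 * T + 2 = (t - 0) + (T + 1) by omega, pow_add]; ring
      rw [this]
      exact Nat.mul_le_mul_left _ (Nat.pow_le_pow_right hL1 (by omega))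
  have hB := tree_count (t := t) (R := R) (L := L) (by omega : 1 ≤ d) hK hd hc Q hm hq
    (fun j p hp => ⟨(hW p (hQW j hp)).1, (hW p (hQW j hp)).2.2, fun h => (hS P0 hP0).2.2.2 p (hQW j hp) (h.mul_right _)⟩)
    (S.filter (fun P => ¬ ∃ h ∈ H, eval (tl P) h = 0 ∧ h.totalDegree ≤ R)) (fun P hP => (hS P (Finset.mem_filter.1 hP).1).1) r
    (fun j hj P hP => ⟨(hcl j hj P).1, (hcl j hj P).2.1, (hcl j hj P).2.2 P (hself j P (Finset.mem_filter.1 hP).1)⟩) hrc (by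
      intro P hP
      obtain ⟨hPS, hP2⟩ := Finset.mem_filter.1 hP
      have h0 := (hcl 0 (Nat.zero_le _) P).2.2 P (hself 0 P hPS)
      rw [hr0 P hPS] at h0
      obtain ⟨h, hh, hz⟩ := H3 _ h0
      by_contra hcon
      push Not at hcon
      have hall : ∀ j ≤ t, h ∣ r j P := by
        intro j
        induction j with
        | zero => intro _; rw [hr0 P hPS]; exact (H2 h hh).2
        | succ j ih =>
          intro hj
          by_contra hnd
          exact hcon j hj h (H2 h hh).1 (ih (by omega)) hnd hz
      apply hP2
      refine ⟨h, hh, hz, ?_⟩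
      obtain ⟨g, hg⟩ := hall t le_rfl
      have h1 := (hcl t le_rfl P).2.1
      have hg0 : g ≠ 0 := by rintro rfl; exact (hcl t le_rfl P).1 (by rw [hg, mul_zero])
      rw [hg, totalDegree_mul_of_isDomain (H2 h hh).1.ne_zero hg0, Nat.sub_self, pow_zero, mul_one] at h1
      omega)
  rw [show 2 * t + 1 = 2 * T + 3 by omega] at hB
  rw [← Finset.card_filter_add_card_filter_not (s := S) (fun P => ∃ h ∈ H, eval (tl P) h = 0 ∧ h.totalDegree ≤ R), add_mul]
  exact Nat.add_le_add hA hB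

end PartG3

section PartJ1

theorem mid (d T c : ℕ) (hd4 : 4 ≤ d) (hT : 1 ≤ T) : ∃ C : ℕ, ∀ f : MvPolynomial (Fin 3) ℤ,
    f.totalDegree ≤ d → coeff (Finsupp.single 0 d) f ≠ 0 → Irreducible (map (Int.castRingHom ℚ) f) →
    ∀ L : ℕ, 2 ≤ L → (∀ α, |coeff α f| ≤ (L ^ c : ℕ)) → ∀ S : Finset (Fin 3 → ℤ),
    (∀ P ∈ S, eval P f = 0 ∧ (∀ i, |P i| ≤ (L ^ (2 * T) : ℕ)) ∧ NL f P ∧ eval P (pderiv 0 f) ≠ 0) →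
    S.card ≤ C * L ^ (2 * T + 3) := by
  classical
  set k := (d + 1) ^ 3 * d + 2 * c + 2 * T * d with hk
  set m := T + 1 + k with hm
  obtain ⟨C0, h0⟩ := tree d T c (2 ^ m) hd4 hT Nat.one_le_two_pow
  refine ⟨m.choose (T + 1) * C0, fun f hd hc hirr L hL hH S hS => ?_⟩
  obtain ⟨W, hW1, hW2⟩ := pool m L (by omega)
  have hsub : S ⊆ (W.powersetCard (T + 1)).biUnion (fun V => S.filter
      (fun P => ∀ p ∈ V, ¬ (p : ℤ) ∣ coeff (Finsupp.single 0 d) f * eval P (pderiv 0 f))) := by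
    intro P hP
    obtain ⟨a1, a2, a3, a4⟩ := hS P hP
    have h1 : (W.filter (fun p : ℕ => (p : ℤ) ∣ coeff (Finsupp.single 0 d) f * eval P (pderiv 0 f))).card ≤ k := few_bad hL (fun p hp => ⟨(hW2 p hp).1, (hW2 p hp).2.1⟩) (mul_ne_zero hc a4) (abs_A hL hd hH P a2)
    have h2 := Finset.card_filter_add_card_filter_not (s := W)
      (fun p : ℕ => (p : ℤ) ∣ coeff (Finsupp.single 0 d) f * eval P (pderiv 0 f))
    rw [hW1, hm] at h2
    have h3 : T + 1 ≤ (W.filter (fun p : ℕ => ¬ (p : ℤ) ∣ coeff (Finsupp.single 0 d) f * eval P (pderiv 0 f))).card := by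
      omega
    obtain ⟨V, hV1, hV2⟩ := Finset.exists_subset_card_eq h3
    exact Finset.mem_biUnion.2 ⟨V, Finset.mem_powersetCard.2 ⟨hV1.trans (Finset.filter_subset _ _), hV2⟩,
      Finset.mem_filter.2 ⟨hP, fun p hp => (Finset.mem_filter.1 (hV1 hp)).2⟩⟩
  refine (Finset.card_le_card hsub).trans ((Finset.card_biUnion_le_card_mul _ _ (C0 * L ^ (2 * T + 3)) (fun V hV => ?_)).trans ?_)
  · rw [Finset.mem_powersetCard] at hV
    refine h0 f hd hc hirr L hL hH V hV.2 (fun p hp => ?_) _ (fun P hP => ?_)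
    · exact ⟨(hW2 p (hV.1 hp)).1, (hW2 p (hV.1 hp)).2.1.le, (hW2 p (hV.1 hp)).2.2⟩
    · rw [Finset.mem_filter] at hP
      exact ⟨(hS P hP.1).1, (hS P hP.1).2.1, (hS P hP.1).2.2.1, hP.2⟩
  · rw [Finset.card_powersetCard, hW1, mul_assoc]

theorem lpl_map {k K σ : Type*} [CommRing k] [CommRing K] (φ : k →+* K) (f : MvPolynomial σ k) (P v : σ → k) :
    (lpl f P v).map φ = lpl (map φ f) (fun i => φ (P i)) (fun i => φ (v i)) := by
  unfold lpl
  induction f using MvPolynomial.induction_on <;> simp_all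

theorem irr_of_map {k K σ : Type*} [Field k] [Field K] (φ : k →+* K) {g : MvPolynomial σ k} (h : Irreducible (map φ g)) :
    Irreducible g := by
  have hu : ∀ a : MvPolynomial σ k, a ≠ 0 → IsUnit (map φ a) → IsUnit a := by
    intro a ha h
    have h1 := (isUnit_iff_totalDegree_of_isReduced.1 h).2
    rw [tdeg_map_eq φ.injective, totalDegree_eq_zero_iff_eq_C] at h1
    rw [h1] at ha ⊢
    exact (isUnit_iff_ne_zero.2 (fun h => ha (by rw [h, map_zero]))).map C
  have hg0 : g ≠ 0 := by rintro rfl; exact h.ne_zero (map_zero _)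
  refine ⟨fun hg => h.not_isUnit (hg.map _), fun a b hab => ?_⟩
  rw [hab] at h hg0
  rw [map_mul] at h
  exact (h.isUnit_or_isUnit rfl).imp (hu a (left_ne_zero_of_mul hg0)) (hu b (right_ne_zero_of_mul hg0))

theorem main_nat (d T : ℕ) (hd4 : 4 ≤ d) (hT : 1 ≤ T) : ∃ C : ℕ, ∀ (k : Type) [Field k] [IsAlgClosed k] [CharZero k]
    (f : MvPolynomial (Fin 3) ℤ) (Q : MvPolynomial (Fin 3) k),
    f.totalDegree ≤ d → coeff (Finsupp.single 0 d) f ≠ 0 → Irreducible (map (Int.castRingHom k) f) →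
    ¬ map (Int.castRingHom k) f ∣ Q →
    (∀ P v : Fin 3 → k, v ≠ 0 → (∀ t, eval (fun i => P i + t * v i) (map (Int.castRingHom k) f) = 0) → eval P Q = 0) →
    ∀ L : ℕ, 2 ≤ L → ∀ S : Finset (Fin 3 → ℤ), (∀ P ∈ S, eval P f = 0 ∧ ∀ i, |P i| ≤ (L ^ (2 * T) : ℕ)) →
    S.card ≤ C * L ^ (2 * T + 3) := by
  classical
  set c := ((d + 1) ^ 3 + 2 * T * d) * (d + 1) ^ 3 with hc0
  obtain ⟨C0, h0⟩ := mid d T c hd4 hT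
  set e := 2 * (2 * (d * (d + 2)) * (d * (d + 2)) + d * (d + 2)) + d with he
  have hde : d ≤ e := by omega
  refine ⟨C0 + 2 * (d * (2 * d * e * 3)), fun k _ _ _ f Q hd hc hirr hQ hline L hL S hS => ?_⟩
  have hL1 : 1 ≤ L := by omega
  have hB : ∀ m ≤ e, d * (2 * d * m * (2 * L ^ (2 * T) + 1)) ≤ d * (2 * d * e * 3) * L ^ (2 * T + 3) := by
    intro m hm
    have h1 : L ^ (2 * T) ≤ L ^ (2 * T + 3) := Nat.pow_le_pow_right hL1 (by omega)
    have h2 : 1 ≤ L ^ (2 * T + 3) := Nat.one_le_pow _ _ hL1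
    rw [mul_assoc d, mul_assoc (2 * d * e)]
    exact Nat.mul_le_mul_left _ (Nat.mul_le_mul (Nat.mul_le_mul_left _ hm) (by omega))
  have hmm : map (Int.castRingHom k) f = map (Rat.castHom k) (map (Int.castRingHom ℚ) f) := by
    rw [map_map, show (Rat.castHom k).comp (Int.castRingHom ℚ) = Int.castRingHom k from RingHom.ext_int _ _]
  have hirrQ : Irreducible (map (Int.castRingHom ℚ) f) := irr_of_map (Rat.castHom k) (by rw [← hmm]; exact hirr)
  have hd' : ∀ (K : Type) [Field K], (map (Int.castRingHom K) f).totalDegree ≤ d := fun K _ => (tdeg_map_le _ _).trans hd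
  have hck : coeff (Finsupp.single 0 d) (map (Int.castRingHom k) f) ≠ 0 := by
    rw [coeff_map]; exact fun h => hc (Int.cast_injective (α := k) (by simpa using h))
  have hcQ : coeff (Finsupp.single 0 d) (map (Int.castRingHom ℚ) f) ≠ 0 := by
    rw [coeff_map]; exact fun h => hc (Int.cast_injective (α := ℚ) (by simpa using h))
  obtain ⟨f', f1, f2, f3, f4, f5⟩ := height_red' hd hc hL S hS
  rcases f5 with f5 | ⟨u, hu, f5⟩
  · refine ((triv hirrQ hd hc f5 ((tdeg_map_le _ _).trans f1) S (fun P hP => ⟨(hS P hP).2, (hS P hP).1, ?_⟩)).trans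
      (hB d hde)).trans (Nat.mul_le_mul_right _ (by omega))
    rw [evc, f2 P hP, Int.cast_zero]
  have hiC : IsUnit (C u : MvPolynomial (Fin 3) ℚ) := (isUnit_iff_ne_zero.2 hu).map C
  have hirr' : Irreducible (map (Int.castRingHom ℚ) f') := by
    rw [f5]; exact (irreducible_isUnit_mul hiC).2 hirrQ
  have hc' : coeff (Finsupp.single 0 d) f' ≠ 0 := by
    intro h
    have h1 := congrArg (coeff (Finsupp.single 0 d)) f5
    rw [coeff_map, h, map_zero, coeff_C_mul] at h1
    exact mul_ne_zero hu hcQ h1.symm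
  obtain ⟨E, E1, E2, E3⟩ := lines_E hirr (hd' k) (pd_not_dvd (by omega) (hd' k) hck) hQ hline
  have hS1 := triv hirr hd hc E1 E2 (S.filter (fun P => ¬ NL f' P)) (fun P hP => by
    obtain ⟨hP, h⟩ := Finset.mem_filter.1 hP
    refine ⟨(hS P hP).2, (hS P hP).1, ?_⟩
    unfold NL at h
    push Not at h
    obtain ⟨v, hv, h⟩ := h
    have h1 : lpl (map (Int.castRingHom ℚ) f) (fun i => (P i : ℚ)) v = 0 := lpl_zero (fun t => by
      have := h t
      rw [f5, map_mul, eval_C] at this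
      exact (mul_eq_zero.1 this).resolve_left hu)
    have h2 := lpl_map (Rat.castHom k) (map (Int.castRingHom ℚ) f) (fun i => (P i : ℚ)) v
    rw [h1, Polynomial.map_zero, ← hmm] at h2
    refine E3 _ (fun i => (Rat.castHom k) (v i)) (fun h => hv ?_) (fun t => ?_)
    · funext i
      exact (Rat.castHom k).injective (by rw [Pi.zero_apply, map_zero]; exact congrFun h i)
    · have h3 := congrArg (Polynomial.eval t) h2
      rw [eval_lpl, Polynomial.eval_zero] at h3
      simpa using h3.symm)
  have hd'' : (map (Int.castRingHom ℚ) f').totalDegree ≤ d := (tdeg_map_le _ _).trans f1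
  have hS2 := triv hirr' f1 hc' (pd_not_dvd (by omega) hd'' (by rw [f5, coeff_C_mul]; exact mul_ne_zero hu hcQ))
    ((tdeg_pderiv 0 _).trans hd'') (S.filter (fun P => eval P (pderiv 0 f') = 0)) (fun P hP => by
    obtain ⟨hP, h⟩ := Finset.mem_filter.1 hP
    refine ⟨(hS P hP).2, f2 P hP, ?_⟩
    rw [pderiv_map, evc, h, Int.cast_zero])
  have hS3 := h0 f' f1 hc' hirr' L hL f3 (S.filter (fun P => NL f' P ∧ eval P (pderiv 0 f') ≠ 0)) (fun P hP => by
    obtain ⟨hP, h⟩ := Finset.mem_filter.1 hP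
    exact ⟨f2 P hP, (hS P hP).2, h⟩)
  have hsub : S ⊆ S.filter (fun P => NL f' P ∧ eval P (pderiv 0 f') ≠ 0) ∪ (S.filter (fun P => ¬ NL f' P) ∪
      S.filter (fun P => eval P (pderiv 0 f') = 0)) := by
    intro P hP
    simp only [Finset.mem_union, Finset.mem_filter]
    tauto
  have h1 := Finset.card_le_card hsub
  have h2 := Finset.card_union_le (S.filter (fun P => NL f' P ∧ eval P (pderiv 0 f') ≠ 0)) (S.filter (fun P => ¬ NL f' P) ∪
      S.filter (fun P => eval P (pderiv 0 f') = 0))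
  have h3 := Finset.card_union_le (S.filter (fun P => ¬ NL f' P)) (S.filter (fun P => eval P (pderiv 0 f') = 0))
  have h4 := hS1.trans (hB e le_rfl)
  have h5 := hS2.trans (hB d hde)
  rw [add_mul, mul_assoc 2]
  omega

end PartJ1

section PartK

theorem lines_Q {k : Type} [Field k] {f : MvPolynomial (Fin 3) k} (hf : Irreducible f) (hd : 2 ≤ f.totalDegree)
    (hfin : {S : AffineSubspace k (Fin 3 → k) | Module.finrank k S.direction = 1 ∧
      (S : Set (Fin 3 → k)) ⊆ {y | eval y f = 0}}.Finite) :
    ∃ Q, ¬ f ∣ Q ∧ ∀ P v : Fin 3 → k, v ≠ 0 → (∀ t, eval (fun i => P i + t * v i) f = 0) → eval P Q = 0 := by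
  classical
  have hex : ∀ S : AffineSubspace k (Fin 3 → k), Module.finrank k S.direction = 1 → ∃ q : MvPolynomial (Fin 3) k,
      q ≠ 0 ∧ q.totalDegree ≤ 1 ∧ ∀ P ∈ S, eval P q = 0 := by
    intro S hS
    obtain ⟨P0, hP0⟩ : (S : Set (Fin 3 → k)).Nonempty := by
      rw [AffineSubspace.nonempty_iff_ne_bot]
      rintro rfl
      rw [AffineSubspace.direction_bot, finrank_bot] at hS
      omega
    obtain ⟨φ, hφ, hφ2⟩ := Submodule.exists_le_ker_of_lt_top S.direction (lt_of_le_of_ne le_top (fun h => by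
      rw [h, finrank_top, Module.finrank_fin_fun] at hS; omega))
    let q : MvPolynomial (Fin 3) k := ∑ i, C (φ (Pi.single i 1)) * X i - C (φ P0)
    have hq : ∀ P, eval P q = φ P - φ P0 := by
      intro P
      simp only [q, map_sub, map_sum, map_mul, eval_C, eval_X]
      rw [LinearMap.pi_apply_eq_sum_univ φ P]
      congr 1
      refine Finset.sum_congr rfl (fun i _ => ?_)
      rw [smul_eq_mul, mul_comm]
      congr 2
      funext j
      simp [Pi.single_apply, eq_comm]
    refine ⟨q, fun h => hφ ?_, ?_, fun P hP => ?_⟩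
    · ext x
      have := hq (P0 + Pi.single x 1)
      rw [h, map_zero, map_add, add_sub_cancel_left] at this
      simpa using this.symm
    · refine (totalDegree_sub _ _).trans (max_le (totalDegree_finsetSum_le (fun i _ => (totalDegree_mul _ _).trans ?_)) ?_)
      · rw [totalDegree_C, zero_add]; exact tdeg_X _
      · rw [totalDegree_C]; omega
    · rw [hq, ← map_sub]
      exact hφ2 (AffineSubspace.vsub_mem_direction hP hP0)
  choose! q hq using hex
  refine ⟨∏ S ∈ hfin.toFinset, q S, fun h => ?_, fun P v hv h => ?_⟩
  · obtain ⟨S, hS, g, hg⟩ := (Prime.dvd_finsetProd_iff hf.prime _).1 h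
    obtain ⟨h1, h2, -⟩ := hq S ((Set.Finite.mem_toFinset _).1 hS).1
    rw [hg] at h1 h2
    rw [totalDegree_mul_of_isDomain hf.ne_zero (right_ne_zero_of_mul h1)] at h2
    omega
  · rw [map_prod]
    have hdir : Module.finrank k (AffineSubspace.mk' P (Submodule.span k {v})).direction = 1 := by
      rw [AffineSubspace.direction_mk', finrank_span_singleton hv]
    refine Finset.prod_eq_zero (i := AffineSubspace.mk' P (Submodule.span k {v})) ?_
      ((hq _ hdir).2.2 P (AffineSubspace.self_mem_mk' _ _))
    rw [Set.Finite.mem_toFinset]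
    refine ⟨hdir, fun y hy => ?_⟩
    rw [SetLike.mem_coe, AffineSubspace.mem_mk', Submodule.mem_span_singleton] at hy
    obtain ⟨t, ht⟩ := hy
    change eval y f = 0
    rw [← h t]
    congr 2
    funext i
    have := congrFun ht i
    simp only [Pi.smul_apply, smul_eq_mul, vsub_eq_sub, Pi.sub_apply] at this
    rw [this]; ring

theorem main_B (d T : ℕ) (hd4 : 4 ≤ d) (hT : 1 ≤ T) : ∃ C : ℕ, ∀ (k : Type) [Field k] [IsAlgClosed k] [CharZero k]
    (f : MvPolynomial (Fin 3) ℤ), f.totalDegree = d → Irreducible (map (Int.castRingHom k) f) →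
    {S : AffineSubspace k (Fin 3 → k) | Module.finrank k S.direction = 1 ∧
      (S : Set (Fin 3 → k)) ⊆ {y | eval y (map (Int.castRingHom k) f) = 0}}.Finite →
    ∀ L N : ℕ, 2 ≤ L → (d + 1) * N ≤ L ^ (2 * T) → ∀ S : Finset (Fin 3 → ℤ), (∀ P ∈ S, eval P f = 0 ∧ ∀ i, |P i| ≤ N) →
    S.card ≤ C * L ^ (2 * T + 3) := by
  classical
  obtain ⟨C0, h0⟩ := main_nat d T hd4 hT
  refine ⟨C0, fun k _ _ _ f hd hirr hfin L N hL hN S hS => ?_⟩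
  have hdk : (map (Int.castRingHom k) f).totalDegree = d := by
    rw [tdeg_map_eq (RingHom.injective_int (Int.castRingHom k)), hd]
  obtain ⟨Q, hQ, hline⟩ := lines_Q hirr (by omega) hfin
  have hf0 : f ≠ 0 := by rintro rfl; exact hirr.ne_zero (map_zero _)
  obtain ⟨w, hw, hw2⟩ := shear_exists hf0
  rw [hd] at hw hw2
  have key := h0 k (aeval (shr (R := ℤ) w) f) (aeval (shr (R := k) w) Q) ((tdeg_shr w f).trans hd.le) hw2
    (by rw [map_shr]; exact irr_shr w hirr) (by
      rw [map_shr, ← shE_apply, ← shE_apply]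
      exact fun h => hQ ((map_dvd_iff (shE w)).1 h)) (by
      intro P v hv h
      rw [eval_shr]
      refine hline _ (shp w v) (fun h => hv (shp_inj w ?_)) (fun t => ?_)
      · rw [h]; funext i; refine Fin.cases (by simp [shp]) (fun i => by simp [shp]) i
      · rw [← h t, map_shr, eval_shr]
        congr 2
        funext i
        refine Fin.cases (by simp [shp]) (fun i => ?_) i
        simp [shp]; ring) L hL (S.image (shp (-w))) (by
      intro P' hP'
      obtain ⟨P, hP, rfl⟩ := Finset.mem_image.1 hP'
      refine ⟨by rw [eval_shr, shp_neg]; exact (hS P hP).1, fun i => ?_⟩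
      exact (shp_box (d := d) (fun i => by simpa using hw i) (hS P hP).2 i).trans (Nat.cast_le.2 hN))
  rwa [Finset.card_image_of_injective _ (shp_inj _)] at key

end PartK

theorem stmt_1 (d : ℕ) (hd : 4 ≤ d) (ε : ℝ) (hε : 0 < ε) :
    ∃ C : ℝ, ∀ f : MvPolynomial (Fin 3) ℤ,
      f.totalDegree = d →
      Irreducible (MvPolynomial.map (Int.castRingHom (AlgebraicClosure ℚ)) f) →
      {S : AffineSubspace (AlgebraicClosure ℚ) (Fin 3 → AlgebraicClosure ℚ) |
          Module.finrank (AlgebraicClosure ℚ) S.direction = 1 ∧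
          (S : Set (Fin 3 → AlgebraicClosure ℚ)) ⊆ {y | aeval y f = 0}}.Finite →
      ∀ B : ℝ, 1 ≤ B →
        (({y : Fin 3 → ℤ | (∀ i, (|y i| : ℝ) ≤ B) ∧ eval y f = 0}.ncard : ℝ)
          ≤ C * B ^ (1 + ε)) := by
  obtain ⟨T0, hT0⟩ := exists_nat_ge (3 / (2 * ε))
  set T := T0 + 1 with hT
  obtain ⟨C0, h0⟩ := main_B d T hd (by omega)
  refine ⟨C0 * (2 ^ (2 * T + 3) * ((d : ℝ) + 1) ^ (1 + ε)), fun f hf hirr hfin B hB => ?_⟩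
  have hfin2 : {S : AffineSubspace (AlgebraicClosure ℚ) (Fin 3 → AlgebraicClosure ℚ) |
      Module.finrank (AlgebraicClosure ℚ) S.direction = 1 ∧ (S : Set (Fin 3 → AlgebraicClosure ℚ)) ⊆
        {y | eval y (map (Int.castRingHom (AlgebraicClosure ℚ)) f) = 0}}.Finite := by
    refine hfin.subset (fun S hS => ⟨hS.1, fun y hy => ?_⟩)
    have := hS.2 hy
    rw [Set.mem_ofPred_eq, eval_map] at this
    rw [Set.mem_ofPred_eq, aeval_def, ← this]
    congr 1
  have hT1 : (0 : ℝ) < T := by exact_mod_cast (by omega : 0 < T)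
  have hTε : ((2 * T + 3 : ℕ) : ℝ) / (2 * T : ℕ) ≤ 1 + ε := by
    rw [div_le_iff₀ (by positivity)] at hT0
    rw [div_le_iff₀ (by push_cast; positivity)]
    push_cast [hT]
    nlinarith
  have hd0 : (4 : ℝ) ≤ d := by exact_mod_cast hd
  set z : ℝ := ((d : ℝ) + 1) * B with hz
  have hz1 : 1 < z := by nlinarith
  set x : ℝ := z ^ (1 / ((2 * T : ℕ) : ℝ)) with hx
  have hx1 : 1 < x := Real.one_lt_rpow hz1 (by positivity)
  set L := ⌈x⌉₊ with hL
  have hL2 : 2 ≤ L := Nat.lt_ceil.2 (by exact_mod_cast hx1)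
  have hxz : x ^ (2 * T) = z := by
    rw [hx, ← Real.rpow_natCast, ← Real.rpow_mul (by linarith), one_div_mul_cancel (by positivity), Real.rpow_one]
  have hxL : (L : ℝ) ≤ 2 * x := by linarith [Nat.ceil_lt_add_one (by linarith : 0 ≤ x)]
  have hLp : (L : ℝ) ^ (2 * T + 3) ≤ 2 ^ (2 * T + 3) * ((d : ℝ) + 1) ^ (1 + ε) * B ^ (1 + ε) := by
    refine (pow_le_pow_left₀ (by positivity) hxL _).trans ?_
    rw [mul_pow, mul_assoc, ← Real.mul_rpow (by positivity) (by linarith)]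
    refine mul_le_mul_of_nonneg_left ?_ (by positivity)
    rw [hx, ← Real.rpow_natCast, ← Real.rpow_mul (by linarith), one_div_mul_eq_div]
    exact Real.rpow_le_rpow_of_exponent_le hz1.le hTε
  rcases Set.finite_or_infinite {y : Fin 3 → ℤ | (∀ i, (|y i| : ℝ) ≤ B) ∧ eval y f = 0} with hs | hs
  · have key := h0 (AlgebraicClosure ℚ) f hf hirr hfin2 L ⌊B⌋₊ hL2 (by
      have h1 : (⌊B⌋₊ : ℝ) ≤ B := Nat.floor_le (by linarith)
      have h2 : z ≤ (L : ℝ) ^ (2 * T) := by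
        rw [← hxz]; exact pow_le_pow_left₀ (by linarith) (Nat.le_ceil x) _
      have : (((d + 1) * ⌊B⌋₊ : ℕ) : ℝ) ≤ ((L ^ (2 * T) : ℕ) : ℝ) := by
        push_cast
        refine le_trans ?_ h2
        exact mul_le_mul_of_nonneg_left h1 (by positivity)
      exact_mod_cast this) hs.toFinset (by
      intro P hP
      rw [Set.Finite.mem_toFinset] at hP
      refine ⟨hP.2, fun i => ?_⟩
      have h1 : (P i).natAbs ≤ ⌊B⌋₊ := Nat.le_floor (by rw [Nat.cast_natAbs]; push_cast; exact hP.1 i)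
      rw [Int.abs_eq_natAbs]
      exact_mod_cast h1)
    rw [Set.ncard_eq_toFinset_card _ hs]
    have k2 : (hs.toFinset.card : ℝ) ≤ C0 * (L : ℝ) ^ (2 * T + 3) := by exact_mod_cast key
    refine k2.trans ?_
    rw [mul_assoc]
    exact mul_le_mul_of_nonneg_left hLp (by positivity)
  · rw [hs.ncard]
    simp only [Nat.cast_zero]
    positivity
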